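/- (Intermediate inequality (7.3) in the proof of Theorem 7.3.) Let 2 ≤ p ≤ n and let K₁, …, K_p, L₁, …, L_{n−p} be nonempty compact convex sets in ℝⁿ. Then MV(K₁, …, K_p, L₁, …, L_{n−p})^{p(p−1)} ≥ Π_{s=1}^{p} Π_{i ≠ s} MV(K_i^{(p−1)}, K_s, L₁, …, L_{n−p}). -/

import Mathlib

open scoped Pointwise
open MeasureTheory Finset

/-- Lebesgue volume of a subset of ℝⁿ, as a real number. -/
noncomputable def vol {n : ℕ} (A : Set (Fin n → ℝ)) : ℝ := (volume A).toReal

/-- The mixed volume of `n` convex bodies in ℝⁿ, defined by the inclusion–exclusion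
formula. -/
noncomputable def MV (n : ℕ) (K : Fin n → Set (Fin n → ℝ)) : ℝ :=
  ∑ j ∈ Finset.Icc 1 n, (-1 : ℝ) ^ (n - j) *
    ∑ S ∈ Finset.univ.powersetCard j, vol (∑ i ∈ S, K i)

/-- The family `(K₁, …, K_p, L₁, …, L_{n−p})` of `n` sets. -/
def combine {n p : ℕ} (hpn : p ≤ n) {α : Type*} (K : Fin p → α) (L : Fin (n - p) → α) :
    Fin n → α :=
  fun i => if h : (i : ℕ) < p then K ⟨i, h⟩
    else L ⟨(i : ℕ) - p, by have := i.isLt; omega⟩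

/-- The family `(A₁, …, A_{p−1}, H, L₁, …, L_{n−p})` of `n` sets. -/
def fam {n p : ℕ} (hp1 : 1 ≤ p) (hpn : p ≤ n) {α : Type*}
    (A : Fin (p - 1) → α) (H : α) (L : Fin (n - p) → α) : Fin n → α :=
  fun i =>
    if h : (i : ℕ) < p - 1 then A ⟨i, h⟩
    else if h2 : (i : ℕ) = p - 1 then H
    else L ⟨(i : ℕ) - p, by have := i.isLt; omega⟩



lemma af_perron {ι : Type*} [Fintype ι] (A : ι → ι → ℝ)
    (hs : ∀ i j, A i j = A j i) (v w : ι → ℝ) (hv : ∀ i, 0 < v i) :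
    ∑ i, (∑ j, A i j * v j) / v i * w i ^ 2 - ∑ i, w i * ∑ j, A i j * w j
      = (1/2) * ∑ i, ∑ j, A i j * v i * v j * (w i / v i - w j / v j) ^ 2 := by
  have h1 : ∀ i j, A i j * v i * v j * (w i / v i - w j / v j) ^ 2
      = A i j * v j / v i * w i ^ 2 + A j i * v i / v j * w j ^ 2 - 2 * (w i * (A i j * w j)) := by
    intro i j
    have := (hv i).ne'
    have := (hv j).ne'
    rw [hs j i]
    field_simp
    ring
  simp_rw [h1, Finset.sum_sub_distrib, Finset.sum_add_distrib, ← Finset.mul_sum]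
  rw [Finset.sum_comm (f := fun i j => A j i * v i / v j * w j ^ 2)]
  simp_rw [Finset.sum_div, Finset.sum_mul]
  ring

lemma af_LA {ι : Type*} [Fintype ι] (A : ι → ι → ℝ)
    (hs : ∀ i j, A i j = A j i) (J : Set ι) (hJ : ∀ i, i ∉ J → ∀ j, A i j = 0)
    (hoff : ∀ i j, i ≠ j → 0 ≤ A i j) (v : ι → ℝ) (hv : ∀ i, 0 < v i)
    (hAv : ∀ i ∈ J, 0 < ∑ j, A i j * v j)
    (hconn : ∀ S : Set ι, (∃ i ∈ J, i ∈ S) → (∃ i ∈ J, i ∉ S) →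
      ∃ i ∈ J, ∃ j ∈ J, i ∈ S ∧ j ∉ S ∧ 0 < A i j)
    (hB : ∀ w : ι → ℝ, ∑ i, w i * ∑ j, A i j * w j ≤
      ∑ i, v i * (∑ j, A i j * w j) ^ 2 / (∑ j, A i j * v j))
    (w : ι → ℝ) (hw : ∑ i, v i * ∑ j, A i j * w j = 0) :
    ∑ i, w i * ∑ j, A i j * w j ≤ 0 := by
  classical
  set a : ι → ℝ := fun i => ∑ j, A i j * v j with ha
  set d : ι → ℝ := fun i => if i ∈ J then a i / v i else 1 with hd
  have hdpos : ∀ i, 0 < d i := by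
    intro i
    by_cases h : i ∈ J
    · simp only [hd, h, if_true]; exact div_pos (hAv i h) (hv i)
    · simp [hd, h]
  have ha0 : ∀ i, i ∉ J → a i = 0 := by
    intro i hi; simp [ha, hJ i hi]
  set r : ι → ℝ := fun i => √(d i) with hr
  have hrpos : ∀ i, 0 < r i := fun i => Real.sqrt_pos.2 (hdpos i)
  have hrsq : ∀ i, r i * r i = d i := fun i => Real.mul_self_sqrt (hdpos i).le
  set S : Matrix ι ι ℝ := Matrix.of fun i j => A i j / (r i * r j) with hS
  have hH : S.IsHermitian := by
    ext i j; simp [hS, Matrix.conjTranspose_apply, hs j i, mul_comm]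
  set lam := hH.eigenvalues
  let b : ι → ι → ℝ := fun k i => hH.eigenvectorBasis k i
  have hb : ∀ k i, ∑ j, S i j * b k j = lam k * b k i := by
    intro k i
    have := congrFun (hH.mulVec_eigenvectorBasis k) i
    simpa [Matrix.mulVec, dotProduct] using this
  have hbn : ∀ k, ∑ i, b k i ^ 2 = 1 := by
    intro k
    have h := hH.eigenvectorBasis.orthonormal.1 k
    have h2 := EuclideanSpace.norm_sq_eq (hH.eigenvectorBasis k)
    rw [h] at h2
    simpa using h2.symm
  -- scaled eigenvectors
  let u : ι → ι → ℝ := fun k i => b k i / r i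
  have hu : ∀ k i, ∑ j, A i j * u k j = lam k * (r i * b k i) := by
    intro k i
    have := hb k i
    have h2 : ∑ j, A i j * u k j = r i * ∑ j, S i j * b k j := by
      rw [Finset.mul_sum]
      refine Finset.sum_congr rfl fun j _ => ?_
      have := (hrpos i).ne'
      have := (hrpos j).ne'
      simp only [hS, u, Matrix.of_apply]
      field_simp
    rw [h2, this]; ring
  have huu : ∀ k, ∑ i, u k i * ∑ j, A i j * u k j = lam k := by
    intro k
    simp_rw [hu]
    calc ∑ i, u k i * (lam k * (r i * b k i)) = ∑ i, lam k * b k i ^ 2 := by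
          refine Finset.sum_congr rfl fun i _ => ?_
          have := (hrpos i).ne'
          simp only [u]; field_simp
      _ = lam k := by rw [← Finset.mul_sum, hbn]; ring
  have hsq : ∀ k, lam k ≤ lam k ^ 2 := by
    intro k
    have h := hB (u k)
    rw [huu] at h
    refine h.trans ?_
    calc _ ≤ ∑ i, lam k ^ 2 * b k i ^ 2 := by
          refine Finset.sum_le_sum fun i _ => ?_
          rw [hu]
          by_cases hi : i ∈ J
          · have h1 : d i = a i / v i := by simp [hd, hi]
            have h2 := hrsq i
            have h3 := (hAv i hi).ne'
            have h4 := (hv i).ne'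
            rw [h1] at h2
            have : v i * (lam k * (r i * b k i)) ^ 2 / a i
              = (r i * r i) * (v i / a i) * (lam k ^ 2 * b k i ^ 2) := by ring
            change v i * (lam k * (r i * b k i)) ^ 2 / a i ≤ _
            have h3' : a i ≠ 0 := h3
            rw [this, h2]
            apply le_of_eq
            field_simp
          · change v i * (lam k * (r i * b k i)) ^ 2 / a i ≤ _
            rw [ha0 i hi]; simp; positivity
      _ = lam k ^ 2 := by rw [← Finset.mul_sum, hbn]; ring
  have hle : ∀ k, ∑ i, a i / v i * u k i ^ 2 ≤ 1 := by
    intro k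
    rw [← hbn k]
    refine Finset.sum_le_sum fun i _ => ?_
    by_cases hi : i ∈ J
    · have h1 : d i = a i / v i := by simp [hd, hi]
      rw [← h1, ← hrsq]
      have := (hrpos i).ne'
      simp only [u]
      apply le_of_eq; field_simp
    · rw [ha0 i hi]; simp; positivity
  have hnn : ∀ k i j, 0 ≤ A i j * v i * v j * (u k i / v i - u k j / v j) ^ 2 := by
    intro k i j
    by_cases hij : i = j
    · subst hij; simp
    · have := hoff i j hij
      have := hv i
      have := hv j
      positivity
  have hkey : ∀ k, 0 < lam k → ∑ i, b k i * (r i * w i) = 0 := by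
    intro k hk
    have hP := af_perron A hs v (u k) hv
    rw [huu] at hP
    have hge : 1 ≤ lam k := by nlinarith [hsq k]
    have hz : ∑ i, ∑ j, A i j * v i * v j * (u k i / v i - u k j / v j) ^ 2 = 0 := by
      apply le_antisymm
      · have := hle k
        change ∑ i, a i / v i * u k i ^ 2 - _ = _ at hP
        linarith
      · exact Finset.sum_nonneg fun i _ => Finset.sum_nonneg fun j _ => hnn k i j
    have hz' : ∀ i j, A i j * v i * v j * (u k i / v i - u k j / v j) ^ 2 = 0 := by
      intro i j
      rw [Finset.sum_eq_zero_iff_of_nonneg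
        (fun i _ => Finset.sum_nonneg fun j _ => hnn k i j)] at hz
      have := hz i (Finset.mem_univ _)
      rw [Finset.sum_eq_zero_iff_of_nonneg (fun j _ => hnn k i j)] at this
      exact this j (Finset.mem_univ _)
    have hoffJ : ∀ i, i ∉ J → b k i = 0 := by
      intro i hi
      have h := hb k i
      simp only [hS, Matrix.of_apply, hJ i hi, zero_div, zero_mul, Finset.sum_const_zero] at h
      rcases mul_eq_zero.1 h.symm with h | h
      · exact absurd h hk.ne'
      · exact h
    by_cases hne : ∃ i0, i0 ∈ J
    · obtain ⟨i0, hi0⟩ := hne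
      set c := u k i0 / v i0 with hc
      have hall : ∀ i ∈ J, u k i / v i = c := by
        by_contra hcon
        push Not at hcon
        obtain ⟨i1, hi1, hi1'⟩ := hcon
        obtain ⟨i, hi, j, hj, hiS, hjS, hij⟩ :=
          hconn {i | u k i / v i = c} ⟨i0, hi0, rfl⟩ ⟨i1, hi1, hi1'⟩
        have := hz' i j
        have h1 := (hv i).ne'
        have h2 := (hv j).ne'
        simp only [mul_eq_zero, hij.ne', h1, h2, false_or] at this
        have h3 : u k i / v i - u k j / v j = 0 := by simpa using this
        apply hjS
        have h4 : u k i / v i = c := hiS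
        simp only [Set.mem_ofPred_eq]; linarith
      have : ∑ i, b k i * (r i * w i) = c * ∑ i, a i * w i := by
        rw [Finset.mul_sum]
        refine Finset.sum_congr rfl fun i _ => ?_
        by_cases hi : i ∈ J
        · have h1 : d i = a i / v i := by simp [hd, hi]
          have h2 := hall i hi
          have h3 := (hrpos i).ne'
          have h4 := (hv i).ne'
          rw [← h2]
          have h5 : b k i = u k i * r i := by simp only [u]; field_simp
          rw [h5]
          have h6 := hrsq i
          rw [h1] at h6
          calc u k i * r i * (r i * w i) = u k i * (r i * r i) * w i := by ring
            _ = _ := by rw [h6]; field_simp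
        · rw [hoffJ i hi, ha0 i hi]; simp
      rw [this]
      have h7 : ∑ i, a i * w i = ∑ i, v i * ∑ j, A i j * w j := by
        simp only [ha, Finset.sum_mul, Finset.mul_sum]
        rw [Finset.sum_comm]
        refine Finset.sum_congr rfl fun i _ => Finset.sum_congr rfl fun j _ => ?_
        rw [hs i j]; ring
      rw [h7, hw, mul_zero]
    · push Not at hne
      exact Finset.sum_eq_zero fun i _ => by rw [hoffJ i (hne i)]; simp
  -- expand w
  let x : EuclideanSpace ℝ ι := WithLp.toLp 2 fun i => r i * w i
  have hx : ∀ i, r i * w i = ∑ k, (∑ j, b k j * (r j * w j)) * b k i := by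
    intro i
    have h := hH.eigenvectorBasis.sum_repr x
    have h2 := congrArg (fun y : EuclideanSpace ℝ ι => y i) h
    simp only [WithLp.ofLp_sum, Finset.sum_apply, PiLp.smul_apply, smul_eq_mul] at h2
    rw [show r i * w i = x i from rfl, ← h2]
    refine Finset.sum_congr rfl fun k _ => ?_
    congr 1
    rw [OrthonormalBasis.repr_apply_apply]
    simp only [PiLp.inner_apply, x, b]
    refine Finset.sum_congr rfl fun j _ => ?_
    simp; ring
  have hwexp : ∀ i, w i = ∑ k, (∑ j, b k j * (r j * w j)) * u k i := by
    intro i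
    have := (hrpos i).ne'
    have h := hx i
    calc w i = (r i * w i) / r i := by field_simp
      _ = _ := by
        rw [h, Finset.sum_div]
        refine Finset.sum_congr rfl fun k _ => ?_
        simp only [u]; ring
  set y : ι → ℝ := fun k => ∑ j, b k j * (r j * w j) with hy
  have hAw : ∀ i, ∑ j, A i j * w j = ∑ k, y k * (lam k * (r i * b k i)) := by
    intro i
    calc ∑ j, A i j * w j = ∑ j, A i j * ∑ k, y k * u k j := by
          refine Finset.sum_congr rfl fun j _ => ?_
          rw [← hwexp j]
      _ = ∑ k, y k * ∑ j, A i j * u k j := by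
          simp only [Finset.mul_sum]
          rw [Finset.sum_comm]
          refine Finset.sum_congr rfl fun i _ => Finset.sum_congr rfl fun j _ => ?_
          ring
      _ = _ := by simp_rw [hu]
  calc ∑ i, w i * ∑ j, A i j * w j = ∑ k, lam k * y k ^ 2 := by
        simp_rw [hAw, Finset.mul_sum]
        rw [Finset.sum_comm]
        refine Finset.sum_congr rfl fun k _ => ?_
        have hyk : ∑ i, b k i * (r i * w i) = y k := rfl
        calc _ = ∑ i, (lam k * y k) * (b k i * (r i * w i)) :=
              Finset.sum_congr rfl fun i _ => by ring
          _ = _ := by rw [← Finset.mul_sum, hyk]; ring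
    _ ≤ 0 := by
        refine Finset.sum_nonpos fun k _ => ?_
        by_cases hk : 0 < lam k
        · have : y k = 0 := hkey k hk
          rw [this]; simp
        · have := sq_nonneg (y k)
          nlinarith


lemma af_bm1_compact (A B D : Set ℝ) (hA : IsCompact A) (hB : IsCompact B)
    (hAn : A.Nonempty) (hBn : B.Nonempty) (hD : ∀ a ∈ A, ∀ b ∈ B, a + b ∈ D) :
    volume A + volume B ≤ volume D := by
  obtain ⟨a, ha, hamax⟩ := hA.exists_isGreatest hAn
  obtain ⟨b, hb, hbmin⟩ := hB.exists_isLeast hBn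
  have h1 : volume ((fun x => x + b) '' A) = volume A := by
    rw [Set.image_add_right, measure_preimage_add_right]
  have h2 : volume ((fun x => a + x) '' B) = volume B := by
    rw [Set.image_add_left, measure_preimage_add]
  rw [← h1, ← h2]
  have hd : AEDisjoint volume ((fun x => x + b) '' A) ((fun x => a + x) '' B) := by
    have hsub : ((fun x => x + b) '' A) ∩ ((fun x => a + x) '' B) ⊆ {a + b} := by
      rintro _ ⟨⟨x, hx, rfl⟩, ⟨y, hy, hxy⟩⟩
      have := hamax hx
      have := hbmin hy
      simp only at hxy ⊢
      simp only [Set.mem_singleton_iff]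
      linarith
    exact measure_mono_null hsub (by simp)
  have hm : MeasurableSet ((fun x => a + x) '' B) :=
    (hB.image (by fun_prop)).measurableSet
  rw [← measure_union₀ hm.nullMeasurableSet hd]
  apply measure_mono
  rintro _ (⟨x, hx, rfl⟩ | ⟨y, hy, rfl⟩)
  · exact hD _ hx _ hb
  · exact hD _ ha _ hy

lemma af_bm1 (A B D : Set ℝ) (hA : MeasurableSet A) (hB : MeasurableSet B)
    (hAf : volume A ≠ ⊤) (hBf : volume B ≠ ⊤)
    (hAn : A.Nonempty) (hBn : B.Nonempty) (hD : ∀ a ∈ A, ∀ b ∈ B, a + b ∈ D) :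
    volume A + volume B ≤ volume D := by
  obtain ⟨a, ha⟩ := hAn
  obtain ⟨b, hb⟩ := hBn
  refine ENNReal.le_of_forall_pos_le_add fun ε hε _ => ?_
  have hε' : (ε / 2 : ENNReal) ≠ 0 := by
    simp [hε.ne']
  obtain ⟨K, hKA, hK, hKv⟩ := hA.exists_isCompact_lt_add hAf hε'
  obtain ⟨K', hKB, hK', hKv'⟩ := hB.exists_isCompact_lt_add hBf hε'
  have h := af_bm1_compact (insert a K) (insert b K') D (hK.insert a) (hK'.insert b)
    (Set.insert_nonempty _ _) (Set.insert_nonempty _ _) (by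
      intro x hx y hy
      refine hD x ?_ y ?_
      · rcases hx with rfl | hx
        · exact ha
        · exact hKA hx
      · rcases hy with rfl | hy
        · exact hb
        · exact hKB hy)
  calc volume A + volume B ≤ (volume K + ε / 2) + (volume K' + ε / 2) := add_le_add hKv.le hKv'.le
    _ = (volume K + volume K') + (ε / 2 + ε / 2) := by ring
    _ ≤ volume D + ε := by
        rw [ENNReal.add_halves]
        gcongr
        exact (add_le_add (measure_mono (Set.subset_insert _ _))
          (measure_mono (Set.subset_insert _ _))).trans h

lemma af_bm2 (A B D : Set (ℝ × ℝ)) (hA : IsCompact A) (hB : IsCompact B) (hDc : IsCompact D)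
    (hD : ∀ a ∈ A, ∀ b ∈ B, a + b ∈ D) :
    16 * volume.real A * volume.real B ≤ volume.real D ^ 2 := by
  have key : ∀ A : Set (ℝ × ℝ), IsCompact A → ∃ f : ℝ → ℝ, Measurable f ∧
      (∀ x, volume (Prod.mk x ⁻¹' A) = ENNReal.ofReal (f x)) ∧ (∀ x, 0 ≤ f x) ∧
      BddAbove (Set.range f) ∧ ∫⁻ x, ENNReal.ofReal (f x) = volume A ∧
      (∃ R, ∀ x, 0 < f x → |x| ≤ R) := by
    intro A hA
    obtain ⟨R, hR⟩ := hA.isBounded.exists_norm_le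
    have hsl : ∀ x, Prod.mk x ⁻¹' A ⊆ Set.Icc (-R) R := by
      intro x y hy
      have := hR _ hy
      rw [Prod.norm_def, max_le_iff] at this
      exact abs_le.1 this.2
    have hfin : ∀ x, volume (Prod.mk x ⁻¹' A) ≠ ⊤ := fun x =>
      ((measure_mono (hsl x)).trans_lt (by simp)).ne
    refine ⟨fun x => (volume (Prod.mk x ⁻¹' A)).toReal, ?_, ?_, ?_, ?_, ?_, ?_⟩
    · exact (measurable_measure_prodMk_left hA.measurableSet).ennreal_toReal
    · intro x; rw [ENNReal.ofReal_toReal (hfin x)]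
    · intro x; exact ENNReal.toReal_nonneg
    · refine ⟨(volume (Set.Icc (-R) R)).toReal, ?_⟩
      rintro _ ⟨x, rfl⟩
      exact ENNReal.toReal_mono (by simp) (measure_mono (hsl x))
    · simp_rw [ENNReal.ofReal_toReal (hfin _)]
      rw [Measure.volume_eq_prod, Measure.prod_apply hA.measurableSet]
    · refine ⟨R, fun x hx => ?_⟩
      have : (Prod.mk x ⁻¹' A).Nonempty := by
        by_contra h
        rw [Set.not_nonempty_iff_eq_empty] at h
        simp [h] at hx
      obtain ⟨y, hy⟩ := this
      have := hR _ hy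
      rw [Prod.norm_def, max_le_iff] at this
      exact this.1
  obtain ⟨f, hfm, hf, hf0, hfb, hfi, Rf, hRf⟩ := key A hA
  obtain ⟨g, hgm, hg, hg0, hgb, hgi, Rg, hRg⟩ := key B hB
  obtain ⟨k, hkm, hk, hk0, hkb, hki, -⟩ := key D hDc
  have hAfin := hA.measure_lt_top (μ := volume)
  have hBfin := hB.measure_lt_top (μ := volume)
  have hDfin := hDc.measure_lt_top (μ := volume)
  by_cases hA0 : volume A = 0
  · simp only [Measure.real, hA0]; simp
  by_cases hB0 : volume B = 0
  · simp only [Measure.real, hB0]; simp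
  have pos : ∀ (A : Set (ℝ × ℝ)) (f : ℝ → ℝ), ∫⁻ x, ENNReal.ofReal (f x) = volume A →
      volume A ≠ 0 → (∀ x, 0 ≤ f x) → BddAbove (Set.range f) → 0 < sSup (Set.range f) := by
    intro A f hfi hA0 hf0 hfb
    by_contra h
    apply hA0
    rw [← hfi]
    have : ∀ x, f x = 0 := fun x =>
      le_antisymm ((le_csSup hfb ⟨x, rfl⟩).trans (not_lt.1 h)) (hf0 x)
    simp [this]
  set F := sSup (Set.range f) with hF
  set G := sSup (Set.range g) with hG
  have hFpos : 0 < F := pos A f hfi hA0 hf0 hfb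
  have hGpos : 0 < G := pos B g hgi hB0 hg0 hgb
  have hslice : ∀ x y, 0 < f x → 0 < g y → f x + g y ≤ k (x + y) := by
    intro x y hx hy
    have h := af_bm1 (Prod.mk x ⁻¹' A) (Prod.mk y ⁻¹' B) (Prod.mk (x+y) ⁻¹' D)
      (measurable_prodMk_left hA.measurableSet) (measurable_prodMk_left hB.measurableSet)
      (by rw [hf]; simp) (by rw [hg]; simp)
      (by by_contra h; rw [Set.not_nonempty_iff_eq_empty] at h
          have := hf x
          rw [h] at this; simp at this; linarith)
      (by by_contra h; rw [Set.not_nonempty_iff_eq_empty] at h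
          have := hg y
          rw [h] at this; simp at this; linarith)
      (fun a ha b hb => by simpa using hD _ ha _ hb)
    rw [hf, hg, hk, ← ENNReal.ofReal_add hx.le hy.le] at h
    exact (ENNReal.ofReal_le_ofReal_iff (hk0 _)).1 h
  have lc : ∀ (A : Set (ℝ × ℝ)) (f : ℝ → ℝ) (F : ℝ), 0 < F → Measurable f →
      (∀ x, 0 ≤ f x) → ∫⁻ x, ENNReal.ofReal (f x) = volume A →
      ∫⁻ t in Set.Ioi (0:ℝ), volume {x | t < f x / F} = ENNReal.ofReal F⁻¹ * volume A := by
    intro A f F hF hfm hf0 hfi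
    rw [← lintegral_eq_lintegral_meas_lt]
    · rw [← hfi, ← lintegral_const_mul _ hfm.ennreal_ofReal]
      congr 1; ext x
      rw [← ENNReal.ofReal_mul (by positivity), div_eq_inv_mul]
    · exact Filter.Eventually.of_forall fun x => div_nonneg (hf0 x) hF.le
    · exact (hfm.div_const F).aemeasurable
  have h1 := lc A f F hFpos hfm hf0 hfi
  have h2 := lc B g G hGpos hgm hg0 hgi
  have h3 := lc D k (F + G) (by positivity) hkm hk0 hki
  have meas : ∀ (f : ℝ → ℝ) (F t : ℝ), Measurable f → MeasurableSet {x | t < f x / F} :=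
    fun f F t hf => measurableSet_lt measurable_const (hf.div_const F)
  have fin : ∀ (f : ℝ → ℝ) (F t R : ℝ), 0 < F → 0 < t → (∀ x, 0 < f x → |x| ≤ R) →
      volume {x | t < f x / F} ≠ ⊤ := by
    intro f F t R hF ht hR
    refine ((measure_mono (t := Set.Icc (-R) R) ?_).trans_lt (by simp)).ne
    intro x hx
    have hx' : t < f x / F := hx
    have : 0 < f x := by
      by_contra h
      have := div_nonpos_of_nonpos_of_nonneg (not_lt.1 h) hF.le
      linarith
    exact abs_le.1 (hR x this)
  have hmain : ENNReal.ofReal F⁻¹ * volume A + ENNReal.ofReal G⁻¹ * volume B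
      ≤ ENNReal.ofReal (F + G)⁻¹ * volume D := by
    rw [← h1, ← h2, ← h3]
    have hmono : Measurable fun t : ℝ => volume {x | t < f x / F} := by
      apply Antitone.measurable
      intro s t hst
      exact measure_mono fun x hx => lt_of_le_of_lt hst hx
    rw [← lintegral_add_left hmono]
    refine setLIntegral_mono' measurableSet_Ioi fun t ht => ?_
    have ht0 : 0 < t := ht
    by_cases ht1 : t < 1
    · have ex : ∀ (f : ℝ → ℝ) (F : ℝ), F = sSup (Set.range f) → 0 < F →
          {x | t < f x / F}.Nonempty := by
        intro f F hF hFp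
        have : t * F < sSup (Set.range f) := by rw [← hF]; nlinarith
        obtain ⟨_, ⟨x, rfl⟩, hx⟩ := exists_lt_of_lt_csSup (Set.range_nonempty f) this
        exact ⟨x, by simpa [lt_div_iff₀ hFp] using hx⟩
      refine af_bm1 _ _ _ (meas _ _ _ hfm) (meas _ _ _ hgm) (fin f F t Rf hFpos ht0 hRf)
        (fin g G t Rg hGpos ht0 hRg) (ex f F hF hFpos) (ex g G hG hGpos) ?_
      intro x hx y hy
      have hx' : t < f x / F := hx
      have hy' : t < g y / G := hy
      rw [lt_div_iff₀ hFpos] at hx'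
      rw [lt_div_iff₀ hGpos] at hy'
      have := hslice x y (lt_trans (by positivity) hx') (lt_trans (by positivity) hy')
      change t < k (x + y) / (F + G)
      rw [lt_div_iff₀ (by positivity)]
      linarith
    · have e1 : {x | t < f x / F} = ∅ := by
        ext x
        simp only [Set.mem_ofPred_eq, Set.mem_empty_iff_false, iff_false, not_lt]
        have : f x ≤ F := le_csSup hfb ⟨x, rfl⟩
        exact ((div_le_one hFpos).2 this).trans (not_lt.1 ht1)
      have e2 : {x | t < g x / G} = ∅ := by
        ext x
        simp only [Set.mem_ofPred_eq, Set.mem_empty_iff_false, iff_false, not_lt]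
        have : g x ≤ G := le_csSup hgb ⟨x, rfl⟩
        exact ((div_le_one hGpos).2 this).trans (not_lt.1 ht1)
      rw [e1, e2]; simp
  have hreal : F⁻¹ * volume.real A + G⁻¹ * volume.real B ≤ (F + G)⁻¹ * volume.real D := by
    have := ENNReal.toReal_mono (ENNReal.mul_ne_top ENNReal.ofReal_ne_top hDfin.ne) hmain
    rw [ENNReal.toReal_add (ENNReal.mul_ne_top ENNReal.ofReal_ne_top hAfin.ne)
      (ENNReal.mul_ne_top ENNReal.ofReal_ne_top hBfin.ne)] at this
    simp only [ENNReal.toReal_mul] at this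
    rwa [ENNReal.toReal_ofReal (by positivity), ENNReal.toReal_ofReal (by positivity),
      ENNReal.toReal_ofReal (by positivity)] at this
  have ha : 0 ≤ volume.real A := measureReal_nonneg
  have hb : 0 ≤ volume.real B := measureReal_nonneg
  set a := volume.real A
  set b := volume.real B
  set c := volume.real D
  have h4 : (F + G) * (F⁻¹ * a + G⁻¹ * b) ≤ c := by
    have := mul_le_mul_of_nonneg_left hreal (show 0 ≤ F + G by positivity)
    rwa [mul_inv_cancel_left₀ (by positivity)] at this
  set x := F⁻¹ * a with hx
  set y := G⁻¹ * b with hy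
  have hxa : a = F * x := by rw [hx]; field_simp
  have hyb : b = G * y := by rw [hy]; field_simp
  have hx0 : 0 ≤ x := by positivity
  have hy0 : 0 ≤ y := by positivity
  rw [hxa, hyb]
  have h5 : ((F + G) * (x + y)) ^ 2 ≤ c ^ 2 := by gcongr
  have h6 : 4 * (F * G) ≤ (F + G) ^ 2 := by nlinarith [sq_nonneg (F - G)]
  have h7 : 4 * (x * y) ≤ (x + y) ^ 2 := by nlinarith [sq_nonneg (x - y)]
  have h8 := mul_le_mul h6 h7 (by positivity) (by positivity)
  nlinarith

lemma af_bm_fin2 (A B D : Set (Fin 2 → ℝ)) (hA : IsCompact A) (hB : IsCompact B)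
    (hDc : IsCompact D) (hD : ∀ a ∈ A, ∀ b ∈ B, a + b ∈ D) :
    16 * volume.real A * volume.real B ≤ volume.real D ^ 2 := by
  have e := (volume_preserving_finTwoArrow ℝ).symm
  let φ := (MeasurableEquiv.finTwoArrow (α := ℝ)).symm
  have hv : ∀ S : Set (Fin 2 → ℝ), volume.real (φ ⁻¹' S) = volume.real S := by
    intro S
    simp only [Measure.real]
    rw [e.measure_preimage_equiv]
  have hc : ∀ S : Set (Fin 2 → ℝ), IsCompact S → IsCompact (φ ⁻¹' S) := by
    intro S hS
    have : φ ⁻¹' S = (fun x : Fin 2 → ℝ => (x 0, x 1)) '' S := by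
      ext ⟨x, y⟩
      constructor
      · intro h
        exact ⟨φ (x, y), h, rfl⟩
      · rintro ⟨z, hz, hzz⟩
        rw [← hzz]
        change φ (φ.symm z) ∈ S
        simpa using hz
    rw [this]
    exact hS.image (by fun_prop)
  have := af_bm2 (φ ⁻¹' A) (φ ⁻¹' B) (φ ⁻¹' D) (hc _ hA) (hc _ hB) (hc _ hDc) (by
    intro a ha b hb
    have := hD _ ha _ hb
    change φ (a + b) ∈ D
    have h2 : φ (a + b) = φ a + φ b := by
      ext i; fin_cases i <;> rfl
    rwa [h2])
  rwa [hv, hv, hv] at this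


noncomputable def afD {ι : Type} (v : ι → ℝ) :
    Derivation ℝ (MvPolynomial ι ℝ) (MvPolynomial ι ℝ) :=
  MvPolynomial.mkDerivation ℝ (fun i => MvPolynomial.C (v i))

lemma afD_X {ι : Type} (v : ι → ℝ) (i : ι) :
    afD v (MvPolynomial.X i) = MvPolynomial.C (v i) := MvPolynomial.mkDerivation_X _ _ _

lemma afD_C {ι : Type} (v : ι → ℝ) (a : ℝ) :
    afD v (MvPolynomial.C a) = 0 := MvPolynomial.derivation_C _ _

lemma afD_eq {ι : Type} [Fintype ι] (v : ι → ℝ) (p : MvPolynomial ι ℝ) :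
    afD v p = ∑ i, v i • MvPolynomial.pderiv i p := by
  classical
  induction p using MvPolynomial.induction_on with
  | C a => simp
  | add p q hp hq => simp [hp, hq, Finset.sum_add_distrib]
  | mul_X p j hp =>
    have e : ∑ i, v i • (p * MvPolynomial.pderiv i (MvPolynomial.X j : MvPolynomial ι ℝ))
        = p * MvPolynomial.C (v j) := by
      rw [Finset.sum_eq_single j]
      · simp [MvPolynomial.smul_eq_C_mul, mul_comm]
      · intro i _ hi
        rw [MvPolynomial.pderiv_X_of_ne (Ne.symm hi)]; simp
      · simp
    rw [Derivation.leibniz, afD_X, hp]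
    simp only [Derivation.leibniz, smul_add, Finset.sum_add_distrib, smul_eq_mul]
    rw [e, Finset.mul_sum]
    congr 1
    refine Finset.sum_congr rfl fun i _ => ?_
    simp

lemma afD_single {ι : Type} [Fintype ι] [DecidableEq ι] (i : ι) (p : MvPolynomial ι ℝ) :
    afD (Pi.single i 1) p = MvPolynomial.pderiv i p := by
  rw [afD_eq, Finset.sum_eq_single i]
  · simp
  · intro j _ hj; simp [hj]
  · simp

lemma afD_comm {ι : Type} (v w : ι → ℝ) (p : MvPolynomial ι ℝ) :
    afD v (afD w p) = afD w (afD v p) := by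
  induction p using MvPolynomial.induction_on with
  | C a => simp [afD_C]
  | add p q hp hq => simp [hp, hq]
  | mul_X p i hp => simp [Derivation.leibniz, afD_X, afD_C, hp]; ring

noncomputable def afDl {ι : Type} : List (ι → ℝ) → MvPolynomial ι ℝ → MvPolynomial ι ℝ
  | [], p => p
  | v :: l, p => afD v (afDl l p)

lemma afDl_comm {ι : Type} (v : ι → ℝ) (l : List (ι → ℝ)) (p : MvPolynomial ι ℝ) :
    afDl l (afD v p) = afD v (afDl l p) := by
  induction l with
  | nil => rfl
  | cons w l ih => simp only [afDl]; rw [ih, afD_comm]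

lemma afDl_perm {ι : Type} {l l' : List (ι → ℝ)} (h : l.Perm l') (p : MvPolynomial ι ℝ) :
    afDl l p = afDl l' p := by
  induction h with
  | nil => rfl
  | cons v _ ih => simp only [afDl]; rw [ih]
  | swap v w l => simp only [afDl]; rw [afD_comm]
  | trans _ _ h1 h2 => rw [h1, h2]

lemma afDl_zero {ι : Type} (l : List (ι → ℝ)) : afDl l (0 : MvPolynomial ι ℝ) = 0 := by
  induction l with
  | nil => rfl
  | cons v l ih => simp [afDl, ih]

lemma afDl_smul {ι : Type} (l : List (ι → ℝ)) (c : ℝ) (p : MvPolynomial ι ℝ) :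
    afDl l (c • p) = c • afDl l p := by
  induction l with
  | nil => rfl
  | cons v l ih => simp [afDl, ih]

noncomputable def afM {ι : Type} (p : MvPolynomial ι ℝ) (l : List (ι → ℝ)) : ℝ :=
  MvPolynomial.eval 0 (afDl l p)

lemma afM_perm {ι : Type} {l l' : List (ι → ℝ)} (h : l.Perm l') (p : MvPolynomial ι ℝ) :
    afM p l = afM p l' := by
  rw [afM, afDl_perm h, afM]

lemma afM_swap {ι : Type} (p : MvPolynomial ι ℝ) (v w : ι → ℝ) (l : List (ι → ℝ)) :
    afM p (v :: w :: l) = afM p (w :: v :: l) := afM_perm (List.Perm.swap _ _ _) p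

lemma afM_cons {ι : Type} [Fintype ι] [DecidableEq ι] (p : MvPolynomial ι ℝ) (v : ι → ℝ)
    (l : List (ι → ℝ)) : afM p (v :: l) = ∑ i, v i * afM p (Pi.single i 1 :: l) := by
  simp only [afM, afDl, afD_single]
  rw [afD_eq]; simp [map_sum]

lemma afM_cons_pderiv {ι : Type} [Fintype ι] [DecidableEq ι] (p : MvPolynomial ι ℝ) (i : ι)
    (l : List (ι → ℝ)) : afM p (Pi.single i 1 :: l) = afM (MvPolynomial.pderiv i p) l := by
  simp only [afM, afDl]
  rw [← afDl_comm, afD_single]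

lemma afM_add {ι : Type} [Fintype ι] (p : MvPolynomial ι ℝ) (v w : ι → ℝ)
    (l : List (ι → ℝ)) : afM p ((v + w) :: l) = afM p (v :: l) + afM p (w :: l) := by
  classical
  rw [afM_cons p (v + w) l, afM_cons p v l, afM_cons p w l]
  simp only [Pi.add_apply, add_mul, Finset.sum_add_distrib]

lemma afM_smul {ι : Type} [Fintype ι] (p : MvPolynomial ι ℝ) (c : ℝ) (v : ι → ℝ)
    (l : List (ι → ℝ)) : afM p ((c • v) :: l) = c * afM p (v :: l) := by
  classical
  rw [afM_cons p (c • v) l, afM_cons p v l]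
  simp only [Pi.smul_apply, smul_eq_mul, Finset.mul_sum, mul_assoc]

noncomputable def afSub {ι κ : Type} [Fintype ι] [DecidableEq ι] (L : (ι → ℝ) →ₗ[ℝ] (κ → ℝ)) :
    MvPolynomial κ ℝ →ₐ[ℝ] MvPolynomial ι ℝ :=
  MvPolynomial.aeval (fun k => ∑ i, MvPolynomial.C (L (Pi.single i 1) k) * MvPolynomial.X i)

lemma afSub_lin {ι κ : Type} [Fintype ι] [DecidableEq ι] (L : (ι → ℝ) →ₗ[ℝ] (κ → ℝ))
    (h : ι → ℝ) (k : κ) : ∑ i, L (Pi.single i 1) k * h i = L h k := by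
  conv_rhs => rw [LinearMap.pi_apply_eq_sum_univ L h]
  rw [Finset.sum_apply]
  refine Finset.sum_congr rfl fun i _ => ?_
  rw [Pi.smul_apply, smul_eq_mul, mul_comm]
  have : (Pi.single i 1 : ι → ℝ) = fun j => if i = j then 1 else 0 := by
    ext j; simp [Pi.single_apply, eq_comm]
  rw [this]

lemma afSub_eval {ι κ : Type} [Fintype ι] [DecidableEq ι] (L : (ι → ℝ) →ₗ[ℝ] (κ → ℝ))
    (q : MvPolynomial κ ℝ) (h : ι → ℝ) :
    MvPolynomial.eval h (afSub L q) = MvPolynomial.eval (L h) q := by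
  induction q using MvPolynomial.induction_on with
  | C a => simp [afSub]
  | add p q hp hq => simp [hp, hq]
  | mul_X p i hp =>
    rw [map_mul, map_mul, hp, map_mul]
    congr 1
    simp [afSub, afSub_lin]

lemma afSub_D {ι κ : Type} [Fintype ι] [DecidableEq ι] (L : (ι → ℝ) →ₗ[ℝ] (κ → ℝ))
    (q : MvPolynomial κ ℝ) (v : ι → ℝ) :
    afD v (afSub L q) = afSub L (afD (L v) q) := by
  induction q using MvPolynomial.induction_on with
  | C a =>
    have : afSub L (MvPolynomial.C a) = MvPolynomial.C a := by simp [afSub]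
    rw [this]; simp [afD_C]
  | add p q hp hq => simp [hp, hq]
  | mul_X p i hp =>
    have h1 : afD v (afSub L (MvPolynomial.X i)) = MvPolynomial.C (L v i) := by
      rw [← afSub_lin L v i]
      simp [afSub, Derivation.leibniz, afD_X, afD_C]
    have h2 : afSub L (MvPolynomial.C (L v i)) = MvPolynomial.C (L v i) := by simp [afSub]
    rw [map_mul, Derivation.leibniz, Derivation.leibniz, hp, h1, afD_X, map_add]
    simp only [smul_eq_mul, map_mul, h2]

lemma afSub_hom {ι κ : Type} [Fintype ι] [DecidableEq ι] (L : (ι → ℝ) →ₗ[ℝ] (κ → ℝ))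
    (q : MvPolynomial κ ℝ) {n : ℕ} (hq : q.IsHomogeneous n) : (afSub L q).IsHomogeneous n := by
  have := hq.aeval (n := 1) (fun k => ∑ i, MvPolynomial.C (L (Pi.single i 1) k) *
    (MvPolynomial.X i : MvPolynomial ι ℝ)) (fun k => by
      apply MvPolynomial.IsHomogeneous.sum
      intro i _
      simpa using (MvPolynomial.isHomogeneous_C ι (L (Pi.single i 1) k)).mul
        (MvPolynomial.isHomogeneous_X ℝ i))
  simpa [afSub] using this

lemma afSub_Dl {ι κ : Type} [Fintype ι] [DecidableEq ι] (L : (ι → ℝ) →ₗ[ℝ] (κ → ℝ))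
    (q : MvPolynomial κ ℝ) (l : List (ι → ℝ)) :
    afDl l (afSub L q) = afSub L (afDl (l.map L) q) := by
  induction l with
  | nil => rfl
  | cons v l ih => simp only [afDl, List.map_cons]; rw [ih, afSub_D]

lemma afM_facet {ι κ : Type} [Fintype ι] [DecidableEq ι] (L : (ι → ℝ) →ₗ[ℝ] (κ → ℝ))
    (p : MvPolynomial ι ℝ) (q : MvPolynomial κ ℝ) (i : ι) (c : ℝ)
    (h : MvPolynomial.pderiv i p = c • afSub L q) (l : List (ι → ℝ)) :
    afM p (Pi.single i 1 :: l) = c * afM q (l.map L) := by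
  rw [afM_cons_pderiv, h, afM, afDl_smul, afSub_Dl, MvPolynomial.smul_eval, afSub_eval, map_zero]
  rfl

lemma afD_hom {ι : Type} [Fintype ι] {p : MvPolynomial ι ℝ} {n : ℕ} (v : ι → ℝ)
    (h : p.IsHomogeneous (n + 1)) : (afD v p).IsHomogeneous n := by
  rw [afD_eq]
  apply MvPolynomial.IsHomogeneous.sum
  intro i _
  rw [MvPolynomial.smul_eq_C_mul]
  simpa using (MvPolynomial.isHomogeneous_C ι (v i)).mul (h.pderiv (i := i))

lemma afDl_hom {ι : Type} [Fintype ι] (l : List (ι → ℝ)) (p : MvPolynomial ι ℝ) (n : ℕ)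
    (h : p.IsHomogeneous (n + l.length)) : (afDl l p).IsHomogeneous n := by
  induction l generalizing n with
  | nil => simpa [afDl] using h
  | cons v l ih =>
    simp only [afDl]
    apply afD_hom
    apply ih
    convert h using 1
    simp; ring

lemma afM_eval {ι : Type} [Fintype ι] (l : List (ι → ℝ)) (p : MvPolynomial ι ℝ)
    (h : p.IsHomogeneous l.length) (x : ι → ℝ) :
    MvPolynomial.eval x (afDl l p) = afM p l := by
  have h0 : (afDl l p).IsHomogeneous 0 := afDl_hom l p 0 (by simpa using h)
  have : afDl l p = MvPolynomial.C (MvPolynomial.coeff 0 (afDl l p)) :=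
    MvPolynomial.totalDegree_eq_zero_iff_eq_C.1
      ((MvPolynomial.totalDegree_zero_iff_isHomogeneous _).2 h0)
  rw [afM, this]; simp

lemma afD_deriv {ι : Type} (q : MvPolynomial ι ℝ) (x v : ι → ℝ) (t : ℝ) :
    HasDerivAt (fun t : ℝ => MvPolynomial.eval (x + t • v) q)
      (MvPolynomial.eval (x + t • v) (afD v q)) t := by
  induction q using MvPolynomial.induction_on with
  | C a => simpa [afD_C] using hasDerivAt_const t a
  | add p q hp hq => simpa using hp.fun_add hq
  | mul_X p i hp =>
    have h1 : HasDerivAt (fun t : ℝ => x i + t * v i) (v i) t := by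
      simpa using ((hasDerivAt_id t).mul_const (v i)).const_add (x i)
    have := hp.fun_mul h1
    have e1 : (fun t : ℝ => MvPolynomial.eval (x + t • v) (p * MvPolynomial.X i)) =
        fun t => MvPolynomial.eval (x + t • v) p * (x i + t * v i) := by
      funext t; simp
    have e2 : MvPolynomial.eval (x + t • v) (afD v (p * MvPolynomial.X i)) =
        MvPolynomial.eval (x + t • v) (afD v p) * (x i + t * v i)
          + MvPolynomial.eval (x + t • v) p * v i := by
      simp [Derivation.leibniz, afD_X]; ring
    rw [e1, e2]
    exact this

lemma af_euler {ι : Type} [Fintype ι] (p : MvPolynomial ι ℝ) (n : ℕ) (h : p.IsHomogeneous n)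
    (x : ι → ℝ) : MvPolynomial.eval x (afD x p) = n * MvPolynomial.eval x p := by
  have := congrArg (MvPolynomial.eval x) h.sum_X_mul_pderiv
  rw [afD_eq]
  simpa [map_sum, MvPolynomial.smul_eval] using this

lemma af_polar {ι α : Type} [Fintype ι] [DecidableEq α] (v : α → ι → ℝ) (s : Finset α) :
    ∀ (p : MvPolynomial ι ℝ), p.IsHomogeneous s.card → ∀ x : ι → ℝ,
    ∑ T ∈ s.powerset, (-1 : ℝ) ^ (s.card + T.card) * MvPolynomial.eval (x + ∑ i ∈ T, v i) p
      = afM p (s.toList.map v) := by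
  induction s using Finset.induction_on with
  | empty =>
    intro p hp x
    have := afM_eval (ι := ι) [] p (by simpa using hp) x
    simpa [afDl] using this
  | insert a s ha ih =>
    intro p hp x
    rw [Finset.card_insert_of_notMem ha] at hp
    have hperm : ((insert a s).toList.map v).Perm (v a :: s.toList.map v) := by
      rw [← List.map_cons]
      exact (Finset.toList_insert ha).map v
    rw [afM_perm hperm]
    set c := afM p (v a :: s.toList.map v) with hc
    have hcD : ∀ y, ∑ T ∈ s.powerset, (-1 : ℝ) ^ (s.card + T.card) *
        MvPolynomial.eval (y + ∑ i ∈ T, v i) (afD (v a) p) = c := by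
      intro y
      rw [ih _ (afD_hom _ hp) y, hc, afM, afM, afDl_comm]; rfl
    let φ : ℝ → ℝ := fun t => ∑ T ∈ s.powerset, (-1 : ℝ) ^ (s.card + T.card) *
        MvPolynomial.eval ((x + ∑ i ∈ T, v i) + t • v a) p
    have hφ : ∀ t, HasDerivAt φ c t := by
      intro t
      rw [← hcD (x + t • v a)]
      apply HasDerivAt.fun_sum
      intro T _
      have := (afD_deriv p (x + ∑ i ∈ T, v i) (v a) t).const_mul ((-1 : ℝ) ^ (s.card + T.card))
      rw [add_right_comm] at this
      exact this
    have hlin : φ 1 - φ 0 = c := by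
      have hd : ∀ t, HasDerivAt (fun t => φ t - t * c) 0 t := by
        intro t
        simpa using (hφ t).fun_sub ((hasDerivAt_id t).mul_const c)
      have := is_const_of_deriv_eq_zero (fun t => (hd t).differentiableAt)
        (fun t => (hd t).deriv) 1 0
      norm_num at this
      linarith
    rw [Finset.sum_powerset_insert ha, ← hlin, Finset.card_insert_of_notMem ha, add_comm]
    simp only [φ, one_smul, zero_smul, add_zero, sub_eq_add_neg, ← Finset.sum_neg_distrib]
    congr 1
    · refine Finset.sum_congr rfl fun T hT => ?_
      have haT : a ∉ T := fun h => ha (Finset.mem_powerset.1 hT h)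
      rw [Finset.card_insert_of_notMem haT, Finset.sum_insert haT]
      have e : x + (v a + ∑ i ∈ T, v i) = x + ∑ i ∈ T, v i + v a := by abel
      rw [e]
      congr 1
      ring
    · refine Finset.sum_congr rfl fun T hT => ?_
      ring


def afPol {n : ℕ} {ι : Type} (ℓ : ι → (Fin n → ℝ) →ₗ[ℝ] ℝ) (h : ι → ℝ) : Set (Fin n → ℝ) :=
  {x | ∀ j, ℓ j x ≤ h j}

def afAct {n : ℕ} {ι : Type} (ℓ : ι → (Fin n → ℝ) →ₗ[ℝ] ℝ) (h : ι → ℝ) (x : Fin n → ℝ) : Set ι :=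
  {j | ℓ j x = h j}

def afReg {n : ℕ} {ι : Type} (ℓ : ι → (Fin n → ℝ) →ₗ[ℝ] ℝ) (h : ι → ℝ) : Prop :=
  ∀ x ∈ afPol ℓ h, LinearIndepOn ℝ ℓ (afAct ℓ h x)

def afBdd {n : ℕ} {ι : Type} (ℓ : ι → (Fin n → ℝ) →ₗ[ℝ] ℝ) : Prop :=
  ∀ h, Bornology.IsBounded (afPol ℓ h)

/-- every active set of `h0` is contained in an active set of `h`. -/
def afSubo {n : ℕ} {ι : Type} (ℓ : ι → (Fin n → ℝ) →ₗ[ℝ] ℝ) (h h0 : ι → ℝ) : Prop :=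
  ∀ x ∈ afPol ℓ h0, ∃ y ∈ afPol ℓ h, afAct ℓ h0 x ⊆ afAct ℓ h y

section
variable {n : ℕ} {ι : Type} {ℓ : ι → (Fin n → ℝ) →ₗ[ℝ] ℝ}

lemma af_lin_cont (f : (Fin n → ℝ) →ₗ[ℝ] ℝ) : Continuous f := f.continuous_of_finiteDimensional

lemma afPol_closed (h : ι → ℝ) : IsClosed (afPol ℓ h) := by
  have : afPol ℓ h = ⋂ j, {x | ℓ j x ≤ h j} := by ext; simp [afPol]
  rw [this]
  exact isClosed_iInter fun j => isClosed_le (af_lin_cont _) continuous_const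

lemma afPol_compact (hB : afBdd ℓ) (h : ι → ℝ) : IsCompact (afPol ℓ h) :=
  Metric.isCompact_of_isClosed_isBounded (afPol_closed h) (hB h)

lemma afPol_convex (h : ι → ℝ) : Convex ℝ (afPol ℓ h) := by
  have : afPol ℓ h = ⋂ j, {x | ℓ j x ≤ h j} := by ext; simp [afPol]
  rw [this]
  exact convex_iInter fun j => convex_halfSpace_le (ℓ j).isLinear _

lemma afPol_mono {h h' : ι → ℝ} (H : ∀ j, h j ≤ h' j) : afPol ℓ h ⊆ afPol ℓ h' :=
  fun _ hx j => (hx j).trans (H j)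

/-- closedness of the set of parameters with a point with prescribed active constraints -/
lemma af_closed_act [Finite ι] (hB : afBdd ℓ) (I : Set ι) :
    IsClosed {h : ι → ℝ | ∃ x ∈ afPol ℓ h, I ⊆ afAct ℓ h x} := by
  apply IsSeqClosed.isClosed
  intro u h hu hlim
  choose x hx hI using hu
  have hb : ∀ j, ∃ M, ∀ k, u k j ≤ M := by
    intro j
    have := ((tendsto_pi_nhds.1 hlim) j).bddAbove_range
    obtain ⟨M, hM⟩ := this
    exact ⟨M, fun k => hM ⟨k, rfl⟩⟩
  choose M hM using hb
  obtain ⟨y, hy, φ, hφ, hlim2⟩ := (afPol_compact hB M).tendsto_subseq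
    (fun k => afPol_mono (fun j => hM j k) (hx k))
  have h1 : ∀ j, Filter.Tendsto (fun k => ℓ j (x (φ k))) Filter.atTop (nhds (ℓ j y)) := fun j =>
    ((af_lin_cont (ℓ j)).tendsto y).comp hlim2
  have h2 : ∀ j, Filter.Tendsto (fun k => u (φ k) j) Filter.atTop (nhds (h j)) := fun j =>
    ((tendsto_pi_nhds.1 hlim) j).comp hφ.tendsto_atTop
  refine ⟨y, fun j => le_of_tendsto_of_tendsto' (h1 j) (h2 j) fun k => hx (φ k) j, ?_⟩
  intro j hj
  refine tendsto_nhds_unique (h1 j) ((h2 j).congr fun k => ?_)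
  exact (hI (φ k) hj).symm

lemma af_dual [DecidableEq ι] {I : Set ι} (hI : LinearIndepOn ℝ ℓ I) :
    ∃ b : ι → (Fin n → ℝ), ∀ j ∈ I, ∀ k ∈ I, ℓ k (b j) = if j = k then 1 else 0 := by
  classical
  obtain ⟨g, hg⟩ : ∃ g : Module.Dual ℝ (Module.Dual ℝ (Fin n → ℝ)) →ₗ[ℝ] (Fin n → ℝ),
      ∀ f (a : Module.Dual ℝ (Fin n → ℝ)), a (g f) = f a := by
    refine ⟨(Module.evalEquiv ℝ (Fin n → ℝ)).symm.toLinearMap, fun f a => ?_⟩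
    simp
  have hli : LinearIndependent ℝ (fun k : I => ℓ k) := hI
  have hex : ∀ j : I, ∃ f : Module.Dual ℝ (Module.Dual ℝ (Fin n → ℝ)),
      ∀ k : I, f (ℓ k) = if j = k then 1 else 0 := by
    intro j
    obtain ⟨f, hf⟩ := LinearMap.exists_extend ((Finsupp.lapply j).comp hli.repr :
      _ →ₗ[ℝ] ℝ)
    refine ⟨f, fun k => ?_⟩
    have hk : ℓ k ∈ Submodule.span ℝ (Set.range fun k : I => ℓ k) :=
      Submodule.subset_span ⟨k, rfl⟩
    have h1 := LinearMap.congr_fun hf ⟨ℓ k, hk⟩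
    have h2 := hli.repr_eq_single k ⟨ℓ k, hk⟩ rfl
    simp only [LinearMap.comp_apply, Submodule.subtype_apply, h2] at h1
    rw [h1]
    simp [Finsupp.single_apply, eq_comm]
  choose f hf using hex
  refine ⟨fun j => if hj : j ∈ I then g (f ⟨j, hj⟩) else 0, fun j hj k hk => ?_⟩
  beta_reduce
  rw [dif_pos hj]
  have := hg (f ⟨j, hj⟩) (ℓ k)
  rw [this]
  have := hf ⟨j, hj⟩ ⟨k, hk⟩
  rw [this]
  simp

/-- a direction not increasing active constraints is feasible. -/
lemma af_feasible [Finite ι] {h : ι → ℝ} {x : Fin n → ℝ} (hx : x ∈ afPol ℓ h) (d : Fin n → ℝ)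
    (hd : ∀ j ∈ afAct ℓ h x, ℓ j d ≤ 0) : ∃ t : ℝ, 0 < t ∧ x + t • d ∈ afPol ℓ h := by
  have key : ∀ j, ∀ᶠ t : ℝ in nhdsWithin 0 (Set.Ioi 0), ℓ j (x + t • d) ≤ h j := by
    intro j
    by_cases hj : j ∈ afAct ℓ h x
    · filter_upwards [self_mem_nhdsWithin] with t ht
      have h1 : ℓ j x = h j := hj
      have h2 := hd j hj
      have h3 : (0:ℝ) < t := ht
      simp only [map_add, map_smul, smul_eq_mul]
      nlinarith
    · have hlt : ℓ j x < h j := lt_of_le_of_ne (hx j) hj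
      have hc : Filter.Tendsto (fun t : ℝ => ℓ j (x + t • d)) (nhds 0) (nhds (ℓ j x)) := by
        have : Continuous (fun t : ℝ => ℓ j (x + t • d)) :=
          (af_lin_cont (ℓ j)).comp (by fun_prop)
        simpa using this.tendsto 0
      exact nhdsWithin_le_nhds ((hc.eventually (gt_mem_nhds hlt)).mono fun t ht => ht.le)
  have := (Filter.eventually_all.2 key).and self_mem_nhdsWithin
  obtain ⟨t, ht, ht0⟩ := this.exists
  exact ⟨t, ht0, ht⟩

lemma afSubo_self (h : ι → ℝ) : afSubo ℓ h h := fun x hx => ⟨x, hx, subset_rfl⟩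

lemma afSubo_add {h g h0 : ι → ℝ} (h1 : afSubo ℓ h h0) (h2 : afSubo ℓ g h0) :
    afSubo ℓ (h + g) h0 := by
  intro x hx
  obtain ⟨y, hy, hya⟩ := h1 x hx
  obtain ⟨z, hz, hza⟩ := h2 x hx
  refine ⟨y + z, fun j => ?_, fun j hj => ?_⟩
  · have := hy j; have := hz j; simp; linarith
  · have h3 : ℓ j y = h j := hya hj
    have h4 : ℓ j z = g j := hza hj
    change ℓ j (y + z) = h j + g j
    rw [map_add, h3, h4]

lemma afSubo_smul {h h0 : ι → ℝ} (t : ℝ) (ht : 0 ≤ t) (h1 : afSubo ℓ h h0) :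
    afSubo ℓ (t • h) h0 := by
  intro x hx
  obtain ⟨y, hy, hya⟩ := h1 x hx
  refine ⟨t • y, fun j => ?_, fun j hj => ?_⟩
  · have := hy j; simp; exact mul_le_mul_of_nonneg_left this ht
  · have h3 : ℓ j y = h j := hya hj
    change ℓ j (t • y) = t * h j
    rw [map_smul, h3]; rfl

lemma afSubo_trans_act {h h0 : ι → ℝ} {a : ℝ} (ha : 0 < a) [Finite ι] (hB : afBdd ℓ)
    (hne : (afPol ℓ h0).Nonempty) (h1 : afSubo ℓ h h0) :
    afSubo ℓ h0 (a • h0 + h) := by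
  intro x hx
  have hcomp : IsCompact (a • afPol ℓ h0 + afPol ℓ h) :=
    ((afPol_compact hB h0).smul a).add (afPol_compact hB h)
  have hconv : Convex ℝ (a • afPol ℓ h0 + afPol ℓ h) :=
    ((afPol_convex h0).smul a).add (afPol_convex h)
  have hmem : x ∈ a • afPol ℓ h0 + afPol ℓ h := by
    by_contra hxn
    obtain ⟨φ, u, hu1, hu2⟩ := geometric_hahn_banach_closed_point hconv hcomp.isClosed hxn
    obtain ⟨x0, hx0, hmax⟩ := (afPol_compact hB h0).exists_isMaxOn hne
      φ.continuous.continuousOn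
    obtain ⟨y, hy, hya⟩ := h1 x0 hx0
    have h3 := hu1 (a • x0 + y) (Set.add_mem_add (Set.smul_mem_smul_set hx0) hy)
    obtain ⟨t, ht, htm⟩ := af_feasible hx0 (x - (a • x0 + y)) (by
      intro j hj
      have e1 : ℓ j x0 = h0 j := hj
      have e2 : ℓ j y = h j := hya hj
      have e3 : ℓ j x ≤ a * h0 j + h j := hx j
      simp only [map_sub, map_add, map_smul, smul_eq_mul, e1, e2]
      linarith)
    have h4 := hmax htm
    simp only [Set.mem_ofPred_eq, map_add, map_smul, map_sub, smul_eq_mul] at h4 h3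
    nlinarith
  obtain ⟨z, hz, y, hy, rfl⟩ := hmem
  obtain ⟨x0, hx0, rfl⟩ := hz
  refine ⟨x0, hx0, fun j hj => ?_⟩
  have e : ℓ j (a • x0 + y) = a * h0 j + h j := hj
  simp only [map_add, map_smul, smul_eq_mul] at e
  have := hx0 j
  have := hy j
  change ℓ j x0 = h0 j
  nlinarith

lemma afReg_of_subo {h0 h : ι → ℝ} (hr : afReg ℓ h0) (hs : afSubo ℓ h0 h) : afReg ℓ h := by
  intro x hx
  obtain ⟨y, hy, hya⟩ := hs x hx
  exact (hr y hy).mono hya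

lemma afSubo_open [Fintype ι] {h0 : ι → ℝ} (hr : afReg ℓ h0) :
    ∀ᶠ δ : ι → ℝ in nhds 0, afSubo ℓ (h0 + δ) h0 := by
  classical
  have key : ∀ I : Set ι, ∀ᶠ δ : ι → ℝ in nhds 0, (∃ x ∈ afPol ℓ h0, afAct ℓ h0 x = I) →
      ∃ y ∈ afPol ℓ (h0 + δ), I ⊆ afAct ℓ (h0 + δ) y := by
    intro I
    by_cases hI : ∃ x ∈ afPol ℓ h0, afAct ℓ h0 x = I
    swap
    · exact Filter.Eventually.of_forall fun δ h => absurd h hI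
    obtain ⟨x, hx, rfl⟩ := hI
    obtain ⟨b, hb⟩ := af_dual (hr x hx)
    let y : (ι → ℝ) → (Fin n → ℝ) := fun δ =>
      x + ∑ j, (if j ∈ afAct ℓ h0 x then δ j else 0) • b j
    have hyc : Continuous y := by
      refine continuous_const.add (continuous_finsetSum _ fun j _ => ?_)
      by_cases hj : j ∈ afAct ℓ h0 x
      · simp only [hj, if_true]; fun_prop
      · simp only [hj, if_false]; fun_prop
    have hya : ∀ δ, ∀ k ∈ afAct ℓ h0 x, ℓ k (y δ) = h0 k + δ k := by
      intro δ k hk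
      have e : ℓ k x = h0 k := hk
      simp only [y, map_add, map_sum, map_smul, smul_eq_mul, e]
      congr 1
      rw [Finset.sum_eq_single k]
      · simp [hk, hb k hk k hk]
      · intro j _ hjk
        by_cases hj : j ∈ afAct ℓ h0 x
        · simp [hb j hj k hk, hjk]
        · simp [hj]
      · simp
    have hyn : ∀ k, k ∉ afAct ℓ h0 x → ∀ᶠ δ : ι → ℝ in nhds 0, ℓ k (y δ) < h0 k + δ k := by
      intro k hk
      have hlt : ℓ k x < h0 k := lt_of_le_of_ne (hx k) hk
      have hc1 : Continuous fun δ => ℓ k (y δ) := (af_lin_cont _).comp hyc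
      have hc2 : Continuous fun δ : ι → ℝ => h0 k + δ k := by fun_prop
      have := (isOpen_lt hc1 hc2).mem_nhds (x := (0 : ι → ℝ)) (by simp [y, hlt])
      exact this
    have hall : ∀ᶠ δ : ι → ℝ in nhds 0, ∀ k, k ∉ afAct ℓ h0 x → ℓ k (y δ) < h0 k + δ k := by
      rw [Filter.eventually_all]
      intro k
      by_cases hk : k ∈ afAct ℓ h0 x
      · exact Filter.Eventually.of_forall fun δ h => absurd hk h
      · exact (hyn k hk).mono fun δ h _ => h
    filter_upwards [hall] with δ hδ _
    refine ⟨y δ, fun k => ?_, fun k hk => hya δ k hk⟩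
    by_cases hk : k ∈ afAct ℓ h0 x
    · exact (hya δ k hk).le
    · exact (hδ k hk).le
  have := Filter.eventually_all.2 key
  filter_upwards [this] with δ hδ x hx
  exact hδ _ ⟨x, hx, rfl⟩

def afCone (ℓ : ι → (Fin n → ℝ) →ₗ[ℝ] ℝ) (h0 : ι → ℝ) : Set (ι → ℝ) :=
  {h | ∃ a : ℝ, 0 < a ∧ afSubo ℓ (h - a • h0) h0}

lemma afCone_reg [Finite ι] (hB : afBdd ℓ) {h0 : ι → ℝ} (hr : afReg ℓ h0)
    (hne : (afPol ℓ h0).Nonempty) : ∀ h ∈ afCone ℓ h0, afReg ℓ h := by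
  rintro h ⟨a, ha, hs⟩
  have := afSubo_trans_act ha hB hne hs
  rw [add_sub_cancel] at this
  exact afReg_of_subo hr this

lemma afCone_add {h0 h g : ι → ℝ} (h1 : h ∈ afCone ℓ h0) (h2 : g ∈ afCone ℓ h0) :
    h + g ∈ afCone ℓ h0 := by
  obtain ⟨a, ha, hs⟩ := h1
  obtain ⟨b, hb, ht⟩ := h2
  refine ⟨a + b, by positivity, ?_⟩
  convert afSubo_add hs ht using 1
  rw [add_smul]; abel

lemma afCone_smul {h0 h : ι → ℝ} (t : ℝ) (ht : 0 < t) (h1 : h ∈ afCone ℓ h0) :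
    t • h ∈ afCone ℓ h0 := by
  obtain ⟨a, ha, hs⟩ := h1
  refine ⟨t * a, by positivity, ?_⟩
  convert afSubo_smul t ht.le hs using 1
  rw [smul_sub, smul_smul]

lemma afCone_mem {h0 g : ι → ℝ} (a : ℝ) (ha : 0 < a) (h1 : afSubo ℓ g h0) :
    g + a • h0 ∈ afCone ℓ h0 := ⟨a, ha, by rwa [add_sub_cancel_right]⟩

lemma afCone_open [Fintype ι] {h0 : ι → ℝ} (hr : afReg ℓ h0) : IsOpen (afCone ℓ h0) := by
  rw [isOpen_iff_mem_nhds]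
  rintro h ⟨a, ha, hs⟩
  have hc : Filter.Tendsto (fun g : ι → ℝ => (2 / a) • (g - h)) (nhds h) (nhds 0) := by
    have : Continuous (fun g : ι → ℝ => (2 / a) • (g - h)) := by fun_prop
    simpa using this.tendsto h
  filter_upwards [hc.eventually (afSubo_open hr)] with g hg
  refine ⟨a / 2, by positivity, ?_⟩
  have := afSubo_add hs (afSubo_smul (a / 2) (by positivity) hg)
  convert this using 1
  ext j
  simp
  field_simp
  ring

lemma af_exists_reg [Fintype ι] (hB : afBdd ℓ) (H : ι → ℝ) :
    ∃ h0 : ι → ℝ, (∀ j, H j < h0 j) ∧ afReg ℓ h0 ∧ afSubo ℓ H h0 := by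
  classical
  have h1 : ∀ᶠ h in nhds H, afSubo ℓ H h := by
    have : ∀ I : Set ι, ∀ᶠ h in nhds H, (∃ x ∈ afPol ℓ h, I ⊆ afAct ℓ h x) →
        ∃ x ∈ afPol ℓ H, I ⊆ afAct ℓ H x := by
      intro I
      by_cases hI : ∃ x ∈ afPol ℓ H, I ⊆ afAct ℓ H x
      · exact Filter.Eventually.of_forall fun _ _ => hI
      · filter_upwards [(af_closed_act hB I).isOpen_compl.mem_nhds hI] with h hh hh2
        exact absurd hh2 hh
    filter_upwards [Filter.eventually_all.2 this] with h hh x hx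
    exact hh _ ⟨x, hx, subset_rfl⟩
  have h2 : ∀ I : Set ι, ∃ U : Set (ι → ℝ), IsOpen U ∧ Dense U ∧
      ∀ h ∈ U, ∀ x, I ⊆ afAct ℓ h x → LinearIndepOn ℝ ℓ I := by
    intro I
    by_cases hI : LinearIndepOn ℝ ℓ I
    · exact ⟨Set.univ, isOpen_univ, dense_univ, fun _ _ _ _ => hI⟩
    · have hI' : ¬ LinearIndependent ℝ (fun k : I => ℓ k) := hI
      rw [Fintype.not_linearIndependent_iff] at hI'
      obtain ⟨g, hg, i, hi⟩ := hI'
      let f : (ι → ℝ) →ₗ[ℝ] ℝ := ∑ k : I, g k • LinearMap.proj (k : ι)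
      have hf : ∀ h, f h = ∑ k : I, g k * h k := by intro h; simp [f]
      refine ⟨(LinearMap.ker f : Set (ι → ℝ))ᶜ, ?_, ?_, ?_⟩
      · exact (Submodule.closed_of_finiteDimensional _).isOpen_compl
      · rw [← interior_eq_empty_iff_dense_compl]
        by_contra hne
        have := Submodule.eq_top_of_nonempty_interior' _ (Set.nonempty_iff_ne_empty.2 hne)
        have h3 : (Pi.single (i : ι) 1 : ι → ℝ) ∈ LinearMap.ker f := by rw [this]; trivial
        rw [LinearMap.mem_ker, hf, Finset.sum_eq_single i] at h3
        · simp at h3; exact hi h3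
        · intro k _ hk
          have : (k : ι) ≠ i := fun h => hk (Subtype.ext h)
          simp [this]
        · simp
      · intro h hh x hx
        exfalso
        apply hh
        change f h = 0
        rw [hf]
        have := LinearMap.congr_fun hg x
        simp only [LinearMap.sum_apply, LinearMap.smul_apply, smul_eq_mul,
          LinearMap.zero_apply] at this
        rw [← this]
        refine Finset.sum_congr rfl fun k _ => ?_
        have e : ℓ k x = h k := hx k.2
        rw [e]
  choose U hUo hUd hU using h2
  have hD : Dense (⋂ I, U I) := dense_iInter_of_isOpen hUo hUd
  obtain ⟨W, hWs, hWo, hWH⟩ := mem_nhds_iff.1 h1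
  have hpos : IsOpen {h : ι → ℝ | ∀ j, H j < h j} := by
    have : {h : ι → ℝ | ∀ j, H j < h j} = ⋂ j, {h | H j < h j} := by ext; simp
    rw [this]
    exact isOpen_iInter_of_finite fun j => isOpen_lt continuous_const (continuous_apply j)
  have hne : (W ∩ {h : ι → ℝ | ∀ j, H j < h j}).Nonempty := by
    have hc : Filter.Tendsto (fun t : ℝ => fun j => H j + t) (nhds 0) (nhds H) := by
      have : Continuous (fun t : ℝ => fun j => H j + t) := by fun_prop
      simpa using this.tendsto 0
    have h4 : ∀ᶠ t : ℝ in nhdsWithin 0 (Set.Ioi 0), (fun j => H j + t) ∈ W :=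
      nhdsWithin_le_nhds (hc.eventually (hWo.mem_nhds hWH))
    obtain ⟨t, ht, ht0⟩ := (h4.and self_mem_nhdsWithin).exists
    refine ⟨_, ht, fun j => ?_⟩
    have : (0:ℝ) < t := ht0
    simp [this]
  obtain ⟨h0, hh, hhU⟩ := hD.inter_open_nonempty _ (hWo.inter hpos) hne
  refine ⟨h0, hh.2, fun x hx => ?_, hWs hh.1⟩
  exact hU _ h0 (Set.mem_iInter.1 hhU _) x subset_rfl
end


section
variable {n : ℕ} {ι : Type} {ℓ : ι → (Fin n → ℝ) →ₗ[ℝ] ℝ}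

lemma af_slater [Fintype ι] {h : ι → ℝ} (hr : afReg ℓ h) (hne : (afPol ℓ h).Nonempty) :
    ∃ x, ∀ j, ℓ j x < h j := by
  classical
  obtain ⟨x, hx⟩ := hne
  obtain ⟨b, hb⟩ := af_dual (hr x hx)
  let d : Fin n → ℝ := -∑ j, (if j ∈ afAct ℓ h x then (1:ℝ) else 0) • b j
  have hd : ∀ k ∈ afAct ℓ h x, ℓ k d = -1 := by
    intro k hk
    simp only [d, map_neg, map_sum, map_smul, smul_eq_mul]
    congr 1
    rw [Finset.sum_eq_single k]
    · simp [hk, hb k hk k hk]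
    · intro j _ hjk
      by_cases hj : j ∈ afAct ℓ h x
      · simp [hb j hj k hk, hjk]
      · simp [hj]
    · simp
  have key : ∀ j, ∀ᶠ t : ℝ in nhdsWithin 0 (Set.Ioi 0), ℓ j (x + t • d) < h j := by
    intro j
    by_cases hj : j ∈ afAct ℓ h x
    · filter_upwards [self_mem_nhdsWithin] with t ht
      have h1 : ℓ j x = h j := hj
      have h3 : (0:ℝ) < t := ht
      simp only [map_add, map_smul, smul_eq_mul, hd j hj]
      linarith
    · have hlt : ℓ j x < h j := lt_of_le_of_ne (hx j) hj
      have hc : Filter.Tendsto (fun t : ℝ => ℓ j (x + t • d)) (nhds 0) (nhds (ℓ j x)) := by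
        have : Continuous (fun t : ℝ => ℓ j (x + t • d)) :=
          (af_lin_cont (ℓ j)).comp (by fun_prop)
        simpa using this.tendsto 0
      exact nhdsWithin_le_nhds (hc.eventually (gt_mem_nhds hlt))
  obtain ⟨t, ht⟩ := (Filter.eventually_all.2 key).exists
  exact ⟨_, ht⟩

lemma af_dich [Fintype ι] (hB : afBdd ℓ) {C : Set (ι → ℝ)} (hC : IsPreconnected C)
    (hr : ∀ h ∈ C, afReg ℓ h) (hne : ∃ h ∈ C, (afPol ℓ h).Nonempty) :
    ∀ h ∈ C, (afPol ℓ h).Nonempty := by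
  let O : Set (ι → ℝ) := {h | ∃ x, ∀ j, ℓ j x < h j}
  let N : Set (ι → ℝ) := {h | ∃ x ∈ afPol ℓ h, (∅ : Set ι) ⊆ afAct ℓ h x}
  have hO : IsOpen O := by
    have : O = ⋃ x, ⋂ j, {h : ι → ℝ | ℓ j x < h j} := by ext; simp [O]
    rw [this]
    exact isOpen_iUnion fun x => isOpen_iInter_of_finite fun j =>
      isOpen_lt continuous_const (continuous_apply j)
  have hN : IsClosed N := af_closed_act hB ∅
  have hsub : C ⊆ O := by
    refine hC.subset_left_of_subset_union hO hN.isOpen_compl ?_ ?_ ?_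
    · rw [Set.disjoint_left]
      rintro h ⟨x, hx⟩ hn
      exact hn ⟨x, fun j => (hx j).le, Set.empty_subset _⟩
    · intro h hh
      by_cases hn : h ∈ N
      · obtain ⟨x, hx, _⟩ := hn
        exact Or.inl (af_slater (hr h hh) ⟨x, hx⟩)
      · exact Or.inr hn
    · obtain ⟨h, hh, hx⟩ := hne
      exact ⟨h, hh, af_slater (hr h hh) hx⟩
  intro h hh
  obtain ⟨x, hx⟩ := hsub hh
  exact ⟨x, fun j => (hx j).le⟩

lemma afPol_translate (h : ι → ℝ) (z : Fin n → ℝ) :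
    volume.real (afPol ℓ (h + fun j => ℓ j z)) = volume.real (afPol ℓ h) := by
  have : afPol ℓ (h + fun j => ℓ j z) = (fun x => x + (-z)) ⁻¹' afPol ℓ h := by
    ext x
    simp [afPol, ← sub_eq_add_neg]
  rw [this, measureReal_def, measureReal_def, measure_preimage_add_right]

lemma afPol_smul (h : ι → ℝ) (t : ℝ) (ht : 0 < t) :
    volume.real (afPol ℓ (t • h)) = t ^ n * volume.real (afPol ℓ h) := by
  have : afPol ℓ (t • h) = t • afPol ℓ h := by
    ext x
    rw [Set.mem_smul_set_iff_inv_smul_mem₀ ht.ne']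
    simp only [afPol, Set.mem_ofPred_eq, Pi.smul_apply, smul_eq_mul, map_smul]
    refine forall_congr' fun j => ?_
    rw [inv_mul_le_iff₀ ht]
  rw [this, measureReal_def, measureReal_def, Measure.addHaar_smul]
  simp [abs_of_pos ht, ENNReal.toReal_mul, ht.le]
end

section
variable {n : ℕ} {ι : Type}

def afFl (ℓ : ι → (Fin (n+1) → ℝ) →ₗ[ℝ] ℝ) (i : ι) (ψ : (Fin n → ℝ) →ₗ[ℝ] (Fin (n+1) → ℝ)) :
    {j // j ≠ i} → (Fin n → ℝ) →ₗ[ℝ] ℝ := fun j => (ℓ j).comp ψ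

def afFL (ℓ : ι → (Fin (n+1) → ℝ) →ₗ[ℝ] ℝ) (i : ι) (z : Fin (n+1) → ℝ) :
    (ι → ℝ) →ₗ[ℝ] ({j // j ≠ i} → ℝ) where
  toFun h := fun j => h j - h i * ℓ j z
  map_add' h g := by ext j; simp; ring
  map_smul' t h := by ext j; simp; ring

variable {ℓ : ι → (Fin (n+1) → ℝ) →ₗ[ℝ] ℝ} {i : ι} {ψ : (Fin n → ℝ) →ₗ[ℝ] (Fin (n+1) → ℝ)}
  {z : Fin (n+1) → ℝ}

lemma af_exists_psi (f : (Fin (n+1) → ℝ) →ₗ[ℝ] ℝ) (hf : f ≠ 0) :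
    ∃ (ψ : (Fin n → ℝ) →ₗ[ℝ] (Fin (n+1) → ℝ)) (z : Fin (n+1) → ℝ), f z = 1 ∧
      Function.Injective ψ ∧ LinearMap.range ψ = LinearMap.ker f := by
  obtain ⟨x, hx⟩ : ∃ x, f x ≠ 0 := by
    by_contra h; push Not at h; exact hf (LinearMap.ext h)
  have hr : Module.finrank ℝ (LinearMap.ker f) = n := by
    have h1 := LinearMap.finrank_range_add_finrank_ker f
    have h2 : LinearMap.range f = ⊤ := LinearMap.range_eq_top.2 (LinearMap.surjective hf)
    rw [h2] at h1
    simp at h1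
    omega
  have e : (Fin n → ℝ) ≃ₗ[ℝ] LinearMap.ker f := LinearEquiv.ofFinrankEq _ _ (by simp [hr])
  refine ⟨(LinearMap.ker f).subtype.comp e.toLinearMap, (f x)⁻¹ • x, by simp [hx], ?_, ?_⟩
  · exact (Submodule.injective_subtype _).comp e.injective
  · rw [LinearMap.range_comp]; simp

lemma afFL_surj [DecidableEq ι] : Function.Surjective (afFL ℓ i z) := by
  intro g
  refine ⟨fun j => if hj : j ≠ i then g ⟨j, hj⟩ else 0, ?_⟩
  ext j
  simp [afFL, j.2]

lemma afFL_single [DecidableEq ι] (j : {j // j ≠ i}) :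
    afFL ℓ i z (Pi.single (j : ι) 1) = Pi.single j 1 := by
  ext k
  have : i ≠ j := fun h => j.2 h.symm
  simp [afFL, Pi.single_apply, this, Subtype.ext_iff]

lemma af_psi_ker (hr : LinearMap.range ψ = LinearMap.ker (ℓ i)) (y) : ℓ i (ψ y) = 0 := by
  have : ψ y ∈ LinearMap.ker (ℓ i) := by rw [← hr]; exact ⟨y, rfl⟩
  exact this

lemma afF_mem (hz : ℓ i z = 1) (hr : LinearMap.range ψ = LinearMap.ker (ℓ i)) (h : ι → ℝ)
    (y : Fin n → ℝ) :
    y ∈ afPol (afFl ℓ i ψ) (afFL ℓ i z h) ↔ ψ y + h i • z ∈ afPol ℓ h := by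
  constructor
  · intro hy j
    by_cases hj : j = i
    · subst hj; simp [af_psi_ker hr, hz]
    · have := hy ⟨j, hj⟩
      simp [afFl, afFL] at this ⊢
      linarith
  · intro hy j
    have := hy j
    simp [afFl, afFL] at this ⊢
    linarith

lemma afF_act (h : ι → ℝ) (y : Fin n → ℝ) (j : {j // j ≠ i}) :
    j ∈ afAct (afFl ℓ i ψ) (afFL ℓ i z h) y ↔ (j : ι) ∈ afAct ℓ h (ψ y + h i • z) := by
  simp [afFl, afFL, afAct, eq_sub_iff_add_eq]

lemma afF_act_i (hz : ℓ i z = 1) (hr : LinearMap.range ψ = LinearMap.ker (ℓ i)) (h : ι → ℝ)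
    (y : Fin n → ℝ) : i ∈ afAct ℓ h (ψ y + h i • z) := by
  simp [afAct, af_psi_ker hr, hz]

lemma afF_surj (hz : ℓ i z = 1) (hr : LinearMap.range ψ = LinearMap.ker (ℓ i)) (h : ι → ℝ)
    (x : Fin (n+1) → ℝ) (hx : ℓ i x = h i) : ∃ y, x = ψ y + h i • z := by
  have : x - h i • z ∈ LinearMap.ker (ℓ i) := by simp [hx, hz]
  rw [← hr] at this
  obtain ⟨y, hy⟩ := this
  exact ⟨y, by rw [hy]; simp⟩

lemma afF_reg (hz : ℓ i z = 1) (hr : LinearMap.range ψ = LinearMap.ker (ℓ i)) (h : ι → ℝ)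
    (hreg : afReg ℓ h) : afReg (afFl ℓ i ψ) (afFL ℓ i z h) := by
  classical
  intro y hy
  have h1 := hreg _ ((afF_mem hz hr h y).1 hy)
  have hi := afF_act_i hz hr h y
  rw [LinearIndepOn, linearIndependent_iff'] at h1 ⊢
  intro s g hg k hk
  obtain ⟨b, hb⟩ := af_dual (hreg _ ((afF_mem hz hr h y).1 hy))
  have hki : (k : {j // j ≠ i}).1 ∈ afAct ℓ h (ψ y + h i • z) := (afF_act h y k.1).1 k.2
  have h0 := hb _ hki i hi
  rw [if_neg k.1.2] at h0
  have hbk : b k.1.1 ∈ LinearMap.ker (ℓ i) := h0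
  rw [← hr] at hbk
  obtain ⟨w, hw⟩ := hbk
  have h2 := LinearMap.congr_fun hg w
  simp only [LinearMap.sum_apply, LinearMap.smul_apply, afFl, LinearMap.comp_apply, hw,
    LinearMap.zero_apply, smul_eq_mul] at h2
  rw [Finset.sum_eq_single k] at h2
  · rw [hb _ hki _ hki] at h2
    simpa using h2
  · intro m _ hm
    have hmi : (m : {j // j ≠ i}).1 ∈ afAct ℓ h (ψ y + h i • z) := (afF_act h y m.1).1 m.2
    rw [hb _ hki _ hmi, if_neg, mul_zero]
    intro e
    exact hm (Subtype.ext (Subtype.ext e.symm))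
  · intro hkn; exact absurd hk hkn

lemma afF_bdd (hz : ℓ i z = 1) (hr : LinearMap.range ψ = LinearMap.ker (ℓ i))
    (hinj : Function.Injective ψ) (hB : afBdd ℓ) : afBdd (afFl ℓ i ψ) := by
  classical
  intro g
  obtain ⟨h, rfl⟩ := afFL_surj (ℓ := ℓ) (i := i) (z := z) g
  have hsub : ψ '' afPol (afFl ℓ i ψ) (afFL ℓ i z h) ⊆
      (fun x => x + -(h i • z)) '' afPol ℓ h := by
    rintro _ ⟨y, hy, rfl⟩
    exact ⟨_, (afF_mem hz hr h y).1 hy, by simp⟩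
  have hb : Bornology.IsBounded (ψ '' afPol (afFl ℓ i ψ) (afFL ℓ i z h)) :=
    (((afPol_compact hB h).image (by fun_prop)).isBounded).subset hsub
  obtain ⟨g, hg⟩ := LinearMap.exists_leftInverse_of_injective ψ (LinearMap.ker_eq_bot.2 hinj)
  have h3 : afPol (afFl ℓ i ψ) (afFL ℓ i z h) ⊆
      g '' closure (ψ '' afPol (afFl ℓ i ψ) (afFL ℓ i z h)) := by
    intro y hy
    exact ⟨ψ y, subset_closure ⟨y, hy, rfl⟩, LinearMap.congr_fun hg y⟩
  exact ((hb.isCompact_closure.image g.continuous_of_finiteDimensional).isBounded).subset h3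

lemma afF_vol [DecidableEq ι] (hz : ℓ i z = 1) (hr : LinearMap.range ψ = LinearMap.ker (ℓ i))
    (hinj : Function.Injective ψ) (hB : afBdd ℓ) :
    ∃ c : ℝ, 0 < c ∧ ∀ h : ι → ℝ,
      Measurable (fun s => volume.real (afPol (afFl ℓ i ψ) (afFL ℓ i z (Function.update h i s))))
      ∧ ∀ t, IntegrableOn
        (fun s => volume.real (afPol (afFl ℓ i ψ) (afFL ℓ i z (Function.update h i s))))
          (Set.Iic t) ∧
      volume.real (afPol ℓ (Function.update h i t)) = c * ∫ s in Set.Iic t,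
        volume.real (afPol (afFl ℓ i ψ) (afFL ℓ i z (Function.update h i s))) := by
  let e0 : ((Fin n → ℝ) × ℝ) →ₗ[ℝ] (Fin (n+1) → ℝ) :=
    ψ.comp (LinearMap.fst ℝ _ _) + (LinearMap.toSpanSingleton ℝ _ z).comp (LinearMap.snd ℝ _ _)
  have he0 : ∀ y s, e0 (y, s) = ψ y + s • z := fun y s => by simp [e0]
  have hbij : Function.Bijective e0 := by
    constructor
    · rw [← LinearMap.ker_eq_bot, LinearMap.ker_eq_bot']
      rintro ⟨y, s⟩ h
      rw [he0] at h
      have h1 := congrArg (ℓ i) h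
      simp [af_psi_ker hr, hz] at h1
      subst h1
      simp at h
      have : y = 0 := hinj (by simpa using h)
      simp [this]
    · intro x
      have : x - ℓ i x • z ∈ LinearMap.ker (ℓ i) := by simp [hz]
      rw [← hr] at this
      obtain ⟨y, hy⟩ := this
      exact ⟨(y, ℓ i x), by rw [he0, hy]; simp⟩
  let e1 := (LinearEquiv.ofBijective e0 hbij).toContinuousLinearEquiv
  have he1 : ∀ y s, e1 (y, s) = ψ y + s • z := fun y s => he0 y s
  let μ : Measure (Fin (n+1) → ℝ) := Measure.map e1 (volume.prod volume)
  have : μ.IsAddHaarMeasure := ContinuousLinearEquiv.isAddHaarMeasure_map e1 _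
  have hμ := Measure.isAddLeftInvariant_eq_smul (volume : Measure (Fin (n+1) → ℝ)) μ
  set c0 := Measure.addHaarScalarFactor (volume : Measure (Fin (n+1) → ℝ)) μ with hc0
  have hcpos : 0 < c0 := Measure.addHaarScalarFactor_pos_of_isAddHaarMeasure _ _
  refine ⟨c0, by exact_mod_cast hcpos, fun h => ?_⟩
  have hcl : IsClosed {q : (Fin n → ℝ) × ℝ |
      q.1 ∈ afPol (afFl ℓ i ψ) (afFL ℓ i z (Function.update h i q.2))} := by
    have : {q : (Fin n → ℝ) × ℝ |
        q.1 ∈ afPol (afFl ℓ i ψ) (afFL ℓ i z (Function.update h i q.2))} =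
        ⋂ j : {j // j ≠ i}, {q | ℓ j (ψ q.1) ≤ h j - q.2 * ℓ j z} := by
      ext q
      simp only [afPol, afFl, afFL, Set.mem_ofPred_eq, Set.mem_iInter]
      refine forall_congr' fun j => ?_
      simp [j.2]
    rw [this]
    refine isClosed_iInter fun j => isClosed_le ?_ (by fun_prop)
    exact ((ℓ j).comp ψ).continuous_of_finiteDimensional.comp continuous_fst
  have hm : Measurable (fun s => volume (afPol (afFl ℓ i ψ) (afFL ℓ i z (Function.update h i s)))) :=
    measurable_measure_prodMk_right (μ := (volume : Measure (Fin n → ℝ))) hcl.measurableSet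
  have hB' := afF_bdd hz hr hinj hB
  have hfin : ∀ g, volume (afPol (afFl ℓ i ψ) g) ≠ ⊤ := fun g => (hB' g).measure_lt_top.ne
  refine ⟨hm.ennreal_toReal, fun t => ?_⟩
  have hvol : volume (afPol ℓ (Function.update h i t)) = c0 * ∫⁻ s in Set.Iic t,
      volume (afPol (afFl ℓ i ψ) (afFL ℓ i z (Function.update h i s))) := by
    have hpre : e1 ⁻¹' (afPol ℓ (Function.update h i t)) =
        {q : (Fin n → ℝ) × ℝ | q.1 ∈ afPol (afFl ℓ i ψ) (afFL ℓ i z (Function.update h i q.2))}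
          ∩ Prod.snd ⁻¹' (Set.Iic t) := by
      ext ⟨y, s⟩
      simp only [Set.mem_preimage, he1, Set.mem_inter_iff, Set.mem_ofPred_eq, Set.mem_Iic]
      constructor
      · intro hy
        have h1 := hy i
        simp [af_psi_ker hr, hz] at h1
        refine ⟨fun j => ?_, h1⟩
        have := hy j
        simp [afFl, afFL, j.2] at this ⊢
        linarith
      · rintro ⟨hy, hs⟩ j
        by_cases hj : j = i
        · subst hj; simpa [af_psi_ker hr, hz] using hs
        · have := hy ⟨j, hj⟩
          simp [afFl, afFL, hj] at this ⊢
          linarith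
    have h1 : volume (afPol ℓ (Function.update h i t)) =
        c0 * (volume.prod volume) (e1 ⁻¹' (afPol ℓ (Function.update h i t))) := by
      conv_lhs => rw [hμ]
      rw [Measure.smul_apply, Measure.map_apply e1.continuous.measurable
        (afPol_closed _).measurableSet]
      rfl
    rw [h1, hpre, Measure.prod_apply_symm
      (hcl.measurableSet.inter (measurable_snd measurableSet_Iic)),
      ← lintegral_indicator measurableSet_Iic]
    congr 1
    refine lintegral_congr fun s => ?_
    by_cases hs : s ≤ t
    · rw [Set.indicator_of_mem (by exact hs)]
      congr 1
      ext y; simp [hs]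
    · rw [Set.indicator_of_notMem (by exact hs)]
      refine (congrArg (volume : Measure (Fin n → ℝ)) ?_).trans measure_empty
      ext y; simp [hs]
  have hVfin : volume (afPol ℓ (Function.update h i t)) ≠ ⊤ := (hB _).measure_lt_top.ne
  have hIfin : ∫⁻ s in Set.Iic t,
      volume (afPol (afFl ℓ i ψ) (afFL ℓ i z (Function.update h i s))) ≠ ⊤ := by
    intro hh
    rw [hh] at hvol
    apply hVfin
    rw [hvol, ENNReal.mul_top]
    simpa using hcpos.ne'
  refine ⟨?_, ?_⟩
  · exact integrable_toReal_of_lintegral_ne_top hm.aemeasurable hIfin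
  · rw [measureReal_def, hvol, ENNReal.toReal_mul]
    congr 1
    simp only [measureReal_def]
    rw [integral_toReal hm.aemeasurable]
    exact Filter.Eventually.of_forall fun s => (hfin _).lt_top

lemma afF_deriv [DecidableEq ι] (hz : ℓ i z = 1) (hr : LinearMap.range ψ = LinearMap.ker (ℓ i))
    (hinj : Function.Injective ψ) (hB : afBdd ℓ) :
    ∃ c : ℝ, 0 < c ∧ ∀ h : ι → ℝ,
      ContinuousAt (fun s => volume.real
        (afPol (afFl ℓ i ψ) (afFL ℓ i z (Function.update h i s)))) (h i) →
      HasDerivAt (fun t => volume.real (afPol ℓ (Function.update h i t)))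
        (c * volume.real (afPol (afFl ℓ i ψ) (afFL ℓ i z h))) (h i) := by
  obtain ⟨c, hc, H⟩ := afF_vol hz hr hinj hB
  refine ⟨c, hc, fun h hcont => ?_⟩
  obtain ⟨hm, H⟩ := H h
  set G : ℝ → ℝ := fun s => volume.real
    (afPol (afFl ℓ i ψ) (afFL ℓ i z (Function.update h i s))) with hG
  have h1 : (fun t => volume.real (afPol ℓ (Function.update h i t))) =
      fun t => c * ((∫ s in Set.Iic (h i), G s) + ∫ s in (h i)..t, G s) := by
    funext t
    rw [(H t).2, ← intervalIntegral.integral_Iic_sub_Iic (H (h i)).1 (H t).1]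
    ring
  have h2 := intervalIntegral.integral_hasDerivAt_right (f := G) (a := h i) (b := h i)
    (by simp) (hm.stronglyMeasurable.stronglyMeasurableAtFilter) hcont
  have h3 : G (h i) = volume.real (afPol (afFl ℓ i ψ) (afFL ℓ i z h)) := by
    simp [hG]
  rw [h1, ← h3]
  exact (h2.const_add _).const_mul c
end


lemma af_frechet {ι : Type} [Fintype ι] [DecidableEq ι] (V : (ι → ℝ) → ℝ) (C : Set (ι → ℝ))
    (hC : IsOpen C) (G : ι → (ι → ℝ) → ℝ) (hG : ∀ i, Continuous (G i))
    (hd : ∀ h ∈ C, ∀ i, HasDerivAt (fun t : ℝ => V (h + t • Pi.single i 1)) (G i h) 0)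
    (h : ι → ℝ) (hh : h ∈ C) :
    HasFDerivAt V (∑ i, G i h • ContinuousLinearMap.proj (R := ℝ) (φ := fun _ : ι => ℝ) i) h := by
  rw [hasFDerivAt_iff_isLittleO_nhds_zero, Asymptotics.isLittleO_iff]
  intro ε hε
  set N : ℝ := Fintype.card ι + 1 with hN
  have hNpos : 0 < N := by positivity
  have h1 : ∀ᶠ y in nhds h, y ∈ C ∧ ∀ i, |G i y - G i h| ≤ ε / N := by
    refine Filter.Eventually.and (hC.mem_nhds hh) (Filter.eventually_all.2 fun i => ?_)
    have : Filter.Tendsto (fun y => |G i y - G i h|) (nhds h) (nhds 0) := by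
      have hc : Continuous (fun y => |G i y - G i h|) := ((hG i).sub continuous_const).abs
      simpa using hc.tendsto h
    exact (this.eventually (gt_mem_nhds (show 0 < ε / N by positivity))).mono fun y hy => hy.le
  obtain ⟨r, hr, hball⟩ := Metric.eventually_nhds_iff_ball.1 h1
  rw [Metric.eventually_nhds_iff_ball]
  refine ⟨r, hr, fun d hdr => ?_⟩
  rw [mem_ball_zero_iff] at hdr
  set u : Finset ι → ι → ℝ := fun S => ∑ i ∈ S, d i • Pi.single i 1 with hu
  have huapp : ∀ S j, u S j = if j ∈ S then d j else 0 := by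
    intro S j
    simp only [hu, Finset.sum_apply, Pi.smul_apply, smul_eq_mul, Pi.single_apply, mul_ite, mul_one,
      mul_zero]
    rw [Finset.sum_ite_eq]
  have key : ∀ S : Finset ι, |V (h + u S) - V h - ∑ i ∈ S, G i h * d i| ≤
      ∑ i ∈ S, ε / N * |d i| := by
    intro S
    induction S using Finset.induction_on with
    | empty => simp [hu]
    | insert a S ha ih =>
      have hmem : ∀ s ∈ Set.uIcc 0 (d a), h + u S + s • Pi.single a 1 ∈ Metric.ball h r := by
        intro s hs
        rw [mem_ball_iff_norm]
        refine lt_of_le_of_lt ?_ hdr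
        rw [pi_norm_le_iff_of_nonneg (norm_nonneg _)]
        intro j
        have hdj := norm_le_pi_norm d j
        simp only [Pi.sub_apply, Pi.add_apply, huapp, Pi.smul_apply, smul_eq_mul, Pi.single_apply]
        by_cases hj : j = a
        · subst hj
          simp only [ha, if_false, if_true]
          refine le_trans ?_ hdj
          simp only [Real.norm_eq_abs]
          have := Set.abs_sub_left_of_mem_uIcc hs
          simpa using this
        · simp only [hj, if_false]
          by_cases hjS : j ∈ S
          · simpa [hjS] using hdj
          · simp [hjS]
      have hder : ∀ s ∈ Set.uIcc 0 (d a), HasDerivWithinAt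
          (fun s : ℝ => V (h + u S + s • Pi.single a 1) - s * G a h)
          (G a (h + u S + s • Pi.single a 1) - G a h) (Set.uIcc 0 (d a)) s := by
        intro s hs
        have h2 := hd _ (hball _ (hmem s hs)).1 a
        have h3 : HasDerivAt (fun s : ℝ => V (h + u S + s • Pi.single a 1))
            (G a (h + u S + s • Pi.single a 1)) s := by
          rw [← sub_self s] at h2
          have h4 := HasDerivAt.comp_sub_const s s h2
          refine h4.congr_of_eventuallyEq (Filter.Eventually.of_forall fun x => ?_)
          simp only
          congr 1
          rw [add_assoc (h + u S), ← add_smul]; simp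
        have h5 : HasDerivAt (fun s : ℝ => s * G a h) (G a h) s := by
          simpa using (hasDerivAt_id s).mul_const (G a h)
        exact (h3.fun_sub h5).hasDerivWithinAt
      have hmv := Convex.norm_image_sub_le_of_norm_hasDerivWithin_le (C := ε / N) hder
        (fun s hs => (hball _ (hmem s hs)).2 a) (convex_uIcc 0 (d a)) (Set.left_mem_uIcc)
        (Set.right_mem_uIcc)
      simp only [zero_smul, add_zero, zero_mul, sub_zero, Real.norm_eq_abs] at hmv
      have hui : h + u (insert a S) = h + u S + d a • Pi.single a 1 := by
        simp only [hu, Finset.sum_insert ha]; abel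
      rw [hui, Finset.sum_insert ha, Finset.sum_insert ha]
      have := abs_add_le (V (h + u S + d a • Pi.single a 1) - d a * G a h - V (h + u S))
        (V (h + u S) - V h - ∑ i ∈ S, G i h * d i)
      have e : V (h + u S + d a • Pi.single a 1) - V h - (G a h * d a + ∑ i ∈ S, G i h * d i)
        = V (h + u S + d a • Pi.single a 1) - d a * G a h - V (h + u S) +
        (V (h + u S) - V h - ∑ i ∈ S, G i h * d i) := by ring
      rw [e]
      linarith
  have hU : u Finset.univ = d := by ext j; simp [huapp]
  have hk := key Finset.univ
  rw [hU] at hk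
  have e2 : (∑ i, G i h • ContinuousLinearMap.proj (R := ℝ) (φ := fun _ : ι => ℝ) i) d
      = ∑ i, G i h * d i := by simp
  rw [e2, Real.norm_eq_abs]
  refine hk.trans ?_
  have : ∑ i, ε / N * |d i| ≤ ∑ i : ι, ε / N * ‖d‖ :=
    Finset.sum_le_sum fun i _ => mul_le_mul_of_nonneg_left (norm_le_pi_norm d i) (by positivity)
  refine this.trans ?_
  rw [Finset.sum_const, nsmul_eq_mul, ← mul_assoc]
  refine mul_le_mul_of_nonneg_right ?_ (norm_nonneg _)
  rw [mul_div_assoc', div_le_iff₀ hNpos, Finset.card_univ, hN]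
  nlinarith

lemma af_poly_ext {ι : Type} [Fintype ι] {C : Set (ι → ℝ)} (hC : IsOpen C) (hne : C.Nonempty)
    (p q : MvPolynomial ι ℝ) (h : ∀ x ∈ C, MvPolynomial.eval x p = MvPolynomial.eval x q) :
    p = q := by
  obtain ⟨x, hx⟩ := hne
  obtain ⟨r, hr, hb⟩ := Metric.isOpen_iff.1 hC x hx
  refine MvPolynomial.funext_set (fun i => Metric.ball (x i) r) (fun i => ?_) ?_
  · rw [Real.ball_eq_Ioo]; exact Set.Ioo_infinite (by linarith)
  · intro y hy
    apply h
    apply hb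
    rw [← ball_pi _ hr] at *
    exact hy

lemma af_partial {ι : Type} [Fintype ι] [DecidableEq ι] {C : Set (ι → ℝ)} (hC : IsOpen C)
    (V : (ι → ℝ) → ℝ) (p : MvPolynomial ι ℝ) (hV : ∀ h ∈ C, V h = MvPolynomial.eval h p)
    (h : ι → ℝ) (hh : h ∈ C) (i : ι) :
    HasDerivAt (fun t : ℝ => V (h + t • Pi.single i 1))
      (MvPolynomial.eval h (MvPolynomial.pderiv i p)) 0 := by
  have := afD_deriv p h (Pi.single i 1) 0
  rw [afD_single, zero_smul, add_zero] at this
  refine this.congr_of_eventuallyEq ?_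
  have hc : Continuous (fun t : ℝ => h + t • (Pi.single i 1 : ι → ℝ)) := by fun_prop
  have : ∀ᶠ t : ℝ in nhds 0, h + t • (Pi.single i 1 : ι → ℝ) ∈ C :=
    hc.continuousAt.eventually (by simpa using hC.mem_nhds hh)
  exact this.mono fun t ht => hV _ ht

lemma af_polyn {ι : Type} [Fintype ι] [DecidableEq ι] (n : ℕ) (V : (ι → ℝ) → ℝ)
    (C : Set (ι → ℝ)) (hC : IsOpen C) (hne : C.Nonempty)
    (hhom : ∀ h, ∀ t : ℝ, 0 < t → V (t • h) = t ^ (n + 1) * V h)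
    (q : ι → MvPolynomial ι ℝ) (hq : ∀ i, (q i).IsHomogeneous n)
    (hd : ∀ h ∈ C, ∀ i, HasDerivAt (fun t : ℝ => V (h + t • Pi.single i 1))
      (MvPolynomial.eval h (q i)) 0) :
    ∃ p : MvPolynomial ι ℝ, p.IsHomogeneous (n + 1) ∧ (∀ h ∈ C, V h = MvPolynomial.eval h p) ∧
      ∀ i, MvPolynomial.pderiv i p = q i := by
  let p : MvPolynomial ι ℝ := MvPolynomial.C ((n + 1 : ℝ)⁻¹) * ∑ i, MvPolynomial.X i * q i
  have hp : p.IsHomogeneous (n + 1) := by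
    have : (∑ i, MvPolynomial.X i * q i).IsHomogeneous (n + 1) := by
      apply MvPolynomial.IsHomogeneous.sum
      intro i _
      rw [add_comm]
      exact (MvPolynomial.isHomogeneous_X ℝ i).mul (hq i)
    simpa using (MvPolynomial.isHomogeneous_C ι ((n + 1 : ℝ)⁻¹)).mul this
  have hV : ∀ h ∈ C, V h = MvPolynomial.eval h p := by
    intro h hh
    have h1 := af_frechet V C hC (fun i x => MvPolynomial.eval x (q i))
      (fun i => MvPolynomial.continuous_eval _) hd h hh
    have h2 : HasDerivAt (fun t : ℝ => t • h) h 1 := by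
      simpa using (hasDerivAt_id (1:ℝ)).smul_const h
    have h3 : HasDerivAt (fun t : ℝ => V (t • h)) _ 1 :=
      HasFDerivAt.comp_hasDerivAt_of_eq (1:ℝ) h1 h2 (by simp)
    have h4 : HasDerivAt (fun t : ℝ => V (t • h)) ((n + 1) * V h) 1 := by
      have h5 : HasDerivAt (fun t : ℝ => t ^ (n + 1) * V h) ((n + 1) * V h) 1 := by
        simpa using (hasDerivAt_pow (n + 1) (1:ℝ)).mul_const (V h)
      refine h5.congr_of_eventuallyEq ?_
      filter_upwards [lt_mem_nhds (show (0:ℝ) < 1 by norm_num)] with t ht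
      exact hhom h t ht
    have h6 := h3.unique h4
    simp at h6
    simp only [p, map_mul, map_sum, MvPolynomial.eval_C, MvPolynomial.eval_X]
    have : (n + 1 : ℝ) ≠ 0 := by positivity
    field_simp
    rw [mul_comm, ← h6]
    exact Finset.sum_congr rfl fun i _ => mul_comm _ _
  refine ⟨p, hp, hV, fun i => ?_⟩
  apply af_poly_ext hC hne
  intro h hh
  exact (af_partial hC V p hV h hh i).unique (hd h hh i)


lemma af_conn {n : ℕ} (hn : 2 ≤ n) {ι : Type} [Fintype ι] {ℓ : ι → (Fin n → ℝ) →ₗ[ℝ] ℝ}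
    (hB : afBdd ℓ) (h : ι → ℝ) (x0 : Fin n → ℝ) (hx0 : ∀ j, ℓ j x0 < h j) (S : Set ι)
    (x1 : Fin n → ℝ) (hx1 : x1 ∈ afPol ℓ h) (i1 : ι) (hi1 : i1 ∈ S) (he1 : ℓ i1 x1 = h i1)
    (x2 : Fin n → ℝ) (hx2 : x2 ∈ afPol ℓ h) (i2 : ι) (hi2 : i2 ∉ S) (he2 : ℓ i2 x2 = h i2) :
    ∃ i ∈ S, ∃ j ∉ S, ∃ x ∈ afPol ℓ h, ℓ i x = h i ∧ ℓ j x = h j := by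
  set v : ι → ℝ := fun j => h j - ℓ j x0 with hv
  have hvpos : ∀ j, 0 < v j := fun j => sub_pos.2 (hx0 j)
  let R : ι → Set (Fin n → ℝ) := fun i => {z | ∀ j, ℓ j z * v i ≤ ℓ i z * v j}
  have hRc : ∀ i, IsClosed (R i) := by
    intro i
    have : R i = ⋂ j, {z | ℓ j z * v i ≤ ℓ i z * v j} := by ext; simp [R]
    rw [this]
    exact isClosed_iInter fun j => isClosed_le ((af_lin_cont _).mul continuous_const)
      ((af_lin_cont _).mul continuous_const)
  have hpc : IsPreconnected ({0}ᶜ : Set (Fin n → ℝ)) := by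
    refine (isConnected_compl_singleton_of_one_lt_rank ?_ 0).isPreconnected
    rw [rank_fin_fun]
    exact_mod_cast hn
  have hcl : ∀ T : Set ι, IsClosed (⋃ i ∈ T, R i) := fun T =>
    (Set.toFinite T).isClosed_biUnion fun i _ => hRc i
  have hfac : ∀ (i : ι) (x : Fin n → ℝ), x ∈ afPol ℓ h → ℓ i x = h i →
      x - x0 ∈ R i ∧ x - x0 ≠ 0 := by
    intro i x hx hi
    have e : ℓ i (x - x0) = v i := by simp [hi, hv]
    refine ⟨fun j => ?_, fun h0 => ?_⟩
    · rw [e, mul_comm (v i)]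
      refine mul_le_mul_of_nonneg_right ?_ (hvpos i).le
      have := hx j
      simp [hv]; exact this
    · rw [h0] at e
      have := hvpos i
      simp at e
      linarith
  obtain ⟨z, hz0, hzS, hzT⟩ := isPreconnected_closed_iff.1 hpc _ _ (hcl S) (hcl Sᶜ) (by
      intro z _
      obtain ⟨i, _, hi⟩ := Finset.exists_max_image (Finset.univ : Finset ι)
        (fun j => ℓ j z / v j) ⟨i1, Finset.mem_univ _⟩
      have hzi : z ∈ R i := by
        intro j
        have := hi j (Finset.mem_univ _)
        rwa [div_le_div_iff₀ (hvpos j) (hvpos i)] at this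
      by_cases hiS : i ∈ S
      · exact Or.inl (Set.mem_biUnion hiS hzi)
      · exact Or.inr (Set.mem_biUnion (show i ∈ Sᶜ from hiS) hzi))
    ⟨x1 - x0, (hfac i1 x1 hx1 he1).2, Set.mem_biUnion hi1 (hfac i1 x1 hx1 he1).1⟩
    ⟨x2 - x0, (hfac i2 x2 hx2 he2).2, Set.mem_biUnion (show i2 ∈ Sᶜ from hi2)
      (hfac i2 x2 hx2 he2).1⟩
  simp only [Set.mem_iUnion] at hzS hzT
  obtain ⟨i, hiS, hzi⟩ := hzS
  obtain ⟨j, hjS, hzj⟩ := hzT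
  have hpos : 0 < ℓ i z := by
    by_contra hneg
    push Not at hneg
    have hall : ∀ k, ℓ k z ≤ 0 := by
      intro k
      have h1 := hzi k
      have h2 := hvpos i
      have h3 := hvpos k
      by_contra hk
      push Not at hk
      nlinarith [mul_pos hk h2, mul_nonneg (neg_nonneg.2 hneg) h3.le]
    have hray : ∀ t : ℝ, 0 ≤ t → x0 + t • z ∈ afPol ℓ h := by
      intro t ht k
      have := hall k
      have := hx0 k
      simp only [map_add, map_smul, smul_eq_mul]
      nlinarith
    obtain ⟨M, hM⟩ := (hB h).exists_norm_le
    have hzn : 0 < ‖z‖ := norm_pos_iff.2 hz0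
    have hM0 : 0 ≤ M := (norm_nonneg _).trans (hM _ (hray 0 le_rfl))
    have h4 := hM _ (hray ((M + ‖x0‖ + 1) / ‖z‖) (by positivity))
    have h5 : ‖((M + ‖x0‖ + 1) / ‖z‖) • z‖ = M + ‖x0‖ + 1 := by
      rw [norm_smul, Real.norm_of_nonneg (by positivity)]
      field_simp
    have h6 : ‖((M + ‖x0‖ + 1) / ‖z‖) • z‖ ≤ ‖x0 + ((M + ‖x0‖ + 1) / ‖z‖) • z‖ + ‖x0‖ := by
      have := norm_sub_le (x0 + ((M + ‖x0‖ + 1) / ‖z‖) • z) x0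
      simpa using this
    linarith
  have hk : ∀ k, ℓ k (x0 + (v i / ℓ i z) • z) = ℓ k x0 + ℓ k z * v i / ℓ i z := by
    intro k
    simp only [map_add, map_smul, smul_eq_mul]
    ring
  refine ⟨i, hiS, j, hjS, x0 + (v i / ℓ i z) • z, fun k => ?_, ?_, ?_⟩
  · rw [hk]
    have h1 : ℓ k z * v i / ℓ i z ≤ v k := by
      rw [div_le_iff₀ hpos, mul_comm (v k)]; exact hzi k
    simp only [hv] at h1 ⊢
    linarith
  · rw [hk, mul_div_assoc, mul_div_cancel₀ _ hpos.ne']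
    simp [hv]
  · rw [hk]
    have h1 : ℓ j z * v i = ℓ i z * v j := le_antisymm (hzi j) (hzj i)
    rw [h1, mul_div_cancel_left₀ _ hpos.ne']
    simp [hv]

structure afCn {n : ℕ} {ι : Type} (ℓ : ι → (Fin n → ℝ) →ₗ[ℝ] ℝ) (C : Set (ι → ℝ)) : Prop where
  op : IsOpen C
  ne : C.Nonempty
  add : ∀ h ∈ C, ∀ g ∈ C, h + g ∈ C
  smul : ∀ t : ℝ, 0 < t → ∀ h ∈ C, t • h ∈ C
  reg : ∀ h ∈ C, afReg ℓ h

structure afOK {n : ℕ} {ι : Type} [Fintype ι] [DecidableEq ι] (ℓ : ι → (Fin n → ℝ) →ₗ[ℝ] ℝ)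
    (C : Set (ι → ℝ)) (p : MvPolynomial ι ℝ) : Prop where
  hom : p.IsHomogeneous n
  vol : ∀ h ∈ C, volume.real (afPol ℓ h) = MvPolynomial.eval h p
  pos : (∀ h ∈ C, (afPol ℓ h).Nonempty) → ∀ l : List (ι → ℝ), (∀ v ∈ l, v ∈ C) → l.length = n →
    0 < afM p l
  fac : ∀ i, ∀ l : List (ι → ℝ), (∀ v ∈ l, v ∈ C) → l.length + 1 = n →
    0 ≤ afM p (Pi.single i 1 :: l) ∧ ((∃ h ∈ C, ∃ x ∈ afPol ℓ h, ℓ i x = h i) →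
      0 < afM p (Pi.single i 1 :: l))
  AF : ∀ l : List (ι → ℝ), (∀ v ∈ l, v ∈ C) → ∀ v ∈ C, ∀ w, l.length + 2 = n →
    afM p (w :: w :: l) * afM p (v :: v :: l) ≤ afM p (w :: v :: l) ^ 2

lemma afCn.pre {n : ℕ} {ι : Type} {ℓ : ι → (Fin n → ℝ) →ₗ[ℝ] ℝ} {C : Set (ι → ℝ)}
    (h : afCn ℓ C) : IsPreconnected C := by
  apply Convex.isPreconnected
  rw [convex_iff_forall_pos]
  intro x hx y hy a b ha hb _
  exact h.add _ (h.smul a ha x hx) _ (h.smul b hb y hy)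

lemma afM_zero {ι : Type} (l : List (ι → ℝ)) : afM (0 : MvPolynomial ι ℝ) l = 0 := by
  simp [afM, afDl_zero]

lemma afOK_zero {n : ℕ} {ι : Type} [Fintype ι] [DecidableEq ι] {ℓ : ι → (Fin n → ℝ) →ₗ[ℝ] ℝ}
    {C : Set (ι → ℝ)} {p : MvPolynomial ι ℝ} (hC : afCn ℓ C) (h : afOK ℓ C p)
    (he : ∀ h ∈ C, ¬ (afPol ℓ h).Nonempty) : p = 0 := by
  apply af_poly_ext hC.op hC.ne
  intro x hx
  rw [← h.vol x hx, Set.not_nonempty_iff_eq_empty.1 (he x hx)]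
  simp

lemma afM_sub {ι κ : Type} [Fintype ι] [DecidableEq ι] (L : (ι → ℝ) →ₗ[ℝ] (κ → ℝ))
    (q : MvPolynomial κ ℝ) (c : ℝ) (l : List (ι → ℝ)) :
    afM (c • afSub L q) l = c * afM q (l.map L) := by
  rw [afM, afDl_smul, afSub_Dl, MvPolynomial.smul_eval, afSub_eval, map_zero]
  rfl

/-- the data attached to the facet `i` -/
structure afFD {n : ℕ} {ι : Type} [Fintype ι] [DecidableEq ι] (ℓ : ι → (Fin (n+1) → ℝ) →ₗ[ℝ] ℝ)
    (C : Set (ι → ℝ)) (i : ι) (q : MvPolynomial ι ℝ) : Prop where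
  hom : q.IsHomogeneous n
  der : ∀ h ∈ C, HasDerivAt (fun t : ℝ => volume.real (afPol ℓ (h + t • Pi.single i 1)))
      (MvPolynomial.eval h q) 0
  zero : (¬ ∃ h ∈ C, ∃ x ∈ afPol ℓ h, ℓ i x = h i) → q = 0
  all : (∃ h ∈ C, ∃ x ∈ afPol ℓ h, ℓ i x = h i) → ∀ h ∈ C, ∃ x ∈ afPol ℓ h, ℓ i x = h i
  pos : (∃ h ∈ C, ∃ x ∈ afPol ℓ h, ℓ i x = h i) → ∀ l : List (ι → ℝ), (∀ v ∈ l, v ∈ C) →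
    l.length = n → 0 < afM q l
  fac : ∀ j, j ≠ i → ∀ l : List (ι → ℝ), (∀ v ∈ l, v ∈ C) → l.length + 1 = n →
    0 ≤ afM q (Pi.single j 1 :: l) ∧
      ((∃ h ∈ C, ∃ x ∈ afPol ℓ h, ℓ i x = h i ∧ ℓ j x = h j) → 0 < afM q (Pi.single j 1 :: l))
  AF : ∀ l : List (ι → ℝ), (∀ v ∈ l, v ∈ C) → ∀ v ∈ C, ∀ w, l.length + 2 = n →
    afM q (w :: w :: l) * afM q (v :: v :: l) ≤ afM q (w :: v :: l) ^ 2

lemma af_update_eq {ι : Type} [DecidableEq ι] (h : ι → ℝ) (i : ι) (t : ℝ) :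
    h + t • Pi.single i 1 = Function.update h i (h i + t) := by
  ext j
  by_cases hj : j = i
  · subst hj; simp
  · simp [hj]

lemma afFD_zero {n : ℕ} {ι : Type} [Fintype ι] [DecidableEq ι]
    {ℓ : ι → (Fin (n+1) → ℝ) →ₗ[ℝ] ℝ} (hB : afBdd ℓ)
    {C : Set (ι → ℝ)} (hC : afCn ℓ C) (i : ι) (hi : ℓ i = 0) : afFD ℓ C i 0 := by
  have hno : ∀ h ∈ C, ∀ x ∈ afPol ℓ h, ℓ i x ≠ h i := by
    intro h hh x hx he
    have h1 : LinearIndependent ℝ (fun k : afAct ℓ h x => ℓ k) := hC.reg h hh x hx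
    exact h1.ne_zero ⟨i, he⟩ hi
  have hno' : ¬ ∃ h ∈ C, ∃ x ∈ afPol ℓ h, ℓ i x = h i := by
    rintro ⟨h, hh, x, hx, he⟩; exact hno h hh x hx he
  refine ⟨MvPolynomial.isHomogeneous_zero _ _ _, ?_, fun _ => rfl, fun h => absurd h hno',
    fun h => absurd h hno', ?_, ?_⟩
  · intro h hh
    rw [map_zero]
    have hmem : ∀ᶠ t : ℝ in nhds 0, h + t • (Pi.single i 1 : ι → ℝ) ∈ C := by
      have hc : Continuous (fun t : ℝ => h + t • (Pi.single i 1 : ι → ℝ)) := by fun_prop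
      exact hc.continuousAt.eventually (by simpa using hC.op.mem_nhds hh)
    by_cases hpos : 0 < h i
    · refine (hasDerivAt_const (0:ℝ) (volume.real (afPol ℓ h))).congr_of_eventuallyEq ?_
      filter_upwards [lt_mem_nhds (show -(h i) < 0 by linarith)] with t ht
      congr 1
      ext x
      refine forall_congr' fun j => ?_
      by_cases hj : j = i
      · subst hj
        simp only [hi, LinearMap.zero_apply, Pi.add_apply, Pi.smul_apply, Pi.single_eq_same,
          smul_eq_mul, mul_one]
        constructor <;> intro <;> linarith
      · simp [hj]
    · have hemp : ¬ (afPol ℓ h).Nonempty := by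
        rintro ⟨x, hx⟩
        have h1 := hx i
        have h2 := hno h hh x hx
        simp [hi] at h1 h2
        exact h2 (le_antisymm h1 (not_lt.1 hpos))
      refine (hasDerivAt_const (0:ℝ) (0:ℝ)).congr_of_eventuallyEq ?_
      filter_upwards [hmem] with t ht
      have : ¬ (afPol ℓ (h + t • (Pi.single i 1 : ι → ℝ))).Nonempty := fun hne =>
        hemp (af_dich hB hC.pre hC.reg ⟨_, ht, hne⟩ h hh)
      rw [Set.not_nonempty_iff_eq_empty.1 this]
      simp
  · intro j _ l _ _
    rw [afM_zero]
    refine ⟨le_rfl, ?_⟩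
    rintro ⟨h, hh, x, hx, he, _⟩
    exact absurd he (hno h hh x hx)
  · intro l _ v _ w _
    simp [afM_zero]

lemma afFD_exists {n : ℕ}
    (IH : ∀ (κ : Type) [Fintype κ] [DecidableEq κ] (ℓ : κ → (Fin n → ℝ) →ₗ[ℝ] ℝ)
      (C : Set (κ → ℝ)), afBdd ℓ → afCn ℓ C → ∃ p, afOK ℓ C p)
    {ι : Type} [Fintype ι] [DecidableEq ι]
    {ℓ : ι → (Fin (n+1) → ℝ) →ₗ[ℝ] ℝ} (hB : afBdd ℓ)
    {C : Set (ι → ℝ)} (hC : afCn ℓ C) (i : ι) : ∃ q, afFD ℓ C i q := by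
  by_cases hi : ℓ i = 0
  · exact ⟨0, afFD_zero hB hC i hi⟩
  obtain ⟨ψ, z, hz, hinj, hr⟩ := af_exists_psi (ℓ i) hi
  set L := afFL ℓ i z with hL
  have hB' := afF_bdd hz hr hinj hB
  have hC' : afCn (afFl ℓ i ψ) (L '' C) := by
    refine ⟨?_, hC.ne.image _, ?_, ?_, ?_⟩
    · exact LinearMap.isOpenMap_of_finiteDimensional L afFL_surj _ hC.op
    · rintro _ ⟨h, hh, rfl⟩ _ ⟨g, hg, rfl⟩
      exact ⟨h + g, hC.add h hh g hg, map_add _ _ _⟩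
    · rintro t ht _ ⟨h, hh, rfl⟩
      exact ⟨t • h, hC.smul t ht h hh, map_smul _ _ _⟩
    · rintro _ ⟨h, hh, rfl⟩
      exact afF_reg hz hr h (hC.reg h hh)
  obtain ⟨q, hq⟩ := IH _ (afFl ℓ i ψ) (L '' C) hB' hC'
  obtain ⟨c, hc, hder⟩ := afF_deriv hz hr hinj hB
  have hmap : ∀ l : List (ι → ℝ), (∀ v ∈ l, v ∈ C) → ∀ v ∈ l.map L, v ∈ L '' C := by
    intro l hl v hv
    obtain ⟨u, hu, rfl⟩ := List.mem_map.1 hv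
    exact ⟨u, hl u hu, rfl⟩
  have hall : (∃ h ∈ C, ∃ x ∈ afPol ℓ h, ℓ i x = h i) →
      ∀ g ∈ L '' C, (afPol (afFl ℓ i ψ) g).Nonempty := by
    rintro ⟨h, hh, x, hx, he⟩
    apply af_dich hB' hC'.pre hC'.reg
    obtain ⟨y, rfl⟩ := afF_surj hz hr h x he
    exact ⟨L h, ⟨h, hh, rfl⟩, y, (afF_mem hz hr h y).2 hx⟩
  refine ⟨c • afSub L q, ?_, ?_, ?_, ?_, ?_, ?_, ?_⟩
  · rw [MvPolynomial.smul_eq_C_mul]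
    simpa using (MvPolynomial.isHomogeneous_C ι c).mul (afSub_hom L q hq.hom)
  · intro h hh
    have hmem : ∀ᶠ s : ℝ in nhds (h i), Function.update h i s ∈ C := by
      have hcu : Continuous (fun s : ℝ => Function.update h i s) :=
        continuous_const.update i continuous_id
      exact hcu.continuousAt.eventually (by simpa using hC.op.mem_nhds hh)
    have hcont : ContinuousAt (fun s => volume.real
        (afPol (afFl ℓ i ψ) (L (Function.update h i s)))) (h i) := by
      have h1 : Continuous (fun s : ℝ => MvPolynomial.eval (L (Function.update h i s)) q) := by
        refine (MvPolynomial.continuous_eval q).comp ?_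
        exact L.continuous_of_finiteDimensional.comp (continuous_const.update i continuous_id)
      refine h1.continuousAt.congr ?_
      filter_upwards [hmem] with s hs
      exact (hq.vol _ ⟨_, hs, rfl⟩).symm
    have h2 := hder h hcont
    rw [MvPolynomial.smul_eval, afSub_eval, ← hq.vol _ ⟨h, hh, rfl⟩]
    rw [show h i = h i + 0 by simp] at h2
    have h3 := HasDerivAt.comp_const_add (h i) 0 h2
    simp only [af_update_eq]
    exact h3
  · intro hno
    have : q = 0 := by
      apply afOK_zero hC' hq
      rintro _ ⟨h, hh, rfl⟩ ⟨y, hy⟩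
      exact hno ⟨h, hh, _, (afF_mem hz hr h y).1 hy, afF_act_i hz hr h y⟩
    rw [this]; simp
  · intro hex h hh
    obtain ⟨y, hy⟩ := hall hex (L h) ⟨h, hh, rfl⟩
    exact ⟨_, (afF_mem hz hr h y).1 hy, afF_act_i hz hr h y⟩
  · intro hex l hl hlen
    rw [afM_sub]
    exact mul_pos hc (hq.pos (hall hex) _ (hmap l hl) (by simpa using hlen))
  · intro j hj l hl hlen
    rw [afM_sub, List.map_cons, hL, afFL_single ⟨j, hj⟩, ← hL]
    have := hq.fac ⟨j, hj⟩ (l.map L) (hmap l hl) (by simpa using hlen)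
    refine ⟨mul_nonneg hc.le this.1, ?_⟩
    rintro ⟨h, hh, x, hx, he, hej⟩
    refine mul_pos hc (this.2 ?_)
    obtain ⟨y, rfl⟩ := afF_surj hz hr h x he
    exact ⟨L h, ⟨h, hh, rfl⟩, y, (afF_mem hz hr h y).2 hx, (afF_act h y ⟨j, hj⟩).2 hej⟩
  · intro l hl v hv w hlen
    simp only [afM_sub, List.map_cons]
    have := hq.AF (l.map L) (hmap l hl) (L v) ⟨v, hv, rfl⟩ (L w) (by simpa using hlen)
    have hc2 : 0 ≤ c ^ 2 := by positivity
    nlinarith [mul_le_mul_of_nonneg_left this hc2]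


lemma af_sig (X Y Z a b : ℝ) (hb : b ≠ 0) (hX : 0 < X)
    (h : a ^ 2 * X - 2 * a * b * Y + b ^ 2 * Z ≤ 0) : Z * X ≤ Y ^ 2 := by
  have hb2 : 0 < b ^ 2 := by positivity
  have h1 : X * (a ^ 2 * X - 2 * a * b * Y + b ^ 2 * Z) ≤ 0 :=
    mul_nonpos_of_nonneg_of_nonpos hX.le h
  by_contra hc
  push Not at hc
  nlinarith [sq_nonneg (a * X - b * Y), mul_pos hb2 (sub_pos.2 hc)]

lemma afOK_base {ι : Type} [Fintype ι] [DecidableEq ι] {ℓ : ι → (Fin 0 → ℝ) →ₗ[ℝ] ℝ}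
    (hB : afBdd ℓ) {C : Set (ι → ℝ)} (hC : afCn ℓ C) : ∃ p, afOK ℓ C p := by
  by_cases hne : ∃ h ∈ C, (afPol ℓ h).Nonempty
  · have hall := af_dich hB hC.pre hC.reg hne
    refine ⟨1, MvPolynomial.isHomogeneous_one _ _, ?_, ?_, ?_, ?_⟩
    · intro h hh
      have : afPol ℓ h = Set.univ := (hall h hh).eq_univ
      rw [this, map_one]
      simp [measureReal_def, volume_pi]
    · intro _ l _ hl
      rw [List.length_eq_zero_iff] at hl
      subst hl
      simp [afM, afDl]
    · intro i l _ hl; omega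
    · intro l _ v _ w hl; omega
  · refine ⟨0, MvPolynomial.isHomogeneous_zero _ _ _, ?_, ?_, ?_, ?_⟩
    · intro h hh
      have : ¬ (afPol ℓ h).Nonempty := fun h' => hne ⟨h, hh, h'⟩
      rw [Set.not_nonempty_iff_eq_empty.1 this]
      simp
    · intro hall
      obtain ⟨h, hh⟩ := hC.ne
      exact absurd ⟨h, hh, hall h hh⟩ hne
    · intro i l _ hl; omega
    · intro l _ v _ w hl; omega

lemma af_transl {n : ℕ} {ι : Type} [Fintype ι] [DecidableEq ι] {ℓ : ι → (Fin n → ℝ) →ₗ[ℝ] ℝ}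
    {C : Set (ι → ℝ)} (hC : afCn ℓ C) (p : MvPolynomial ι ℝ)
    (hV : ∀ h ∈ C, volume.real (afPol ℓ h) = MvPolynomial.eval h p) (x : Fin n → ℝ) :
    afD (fun j => ℓ j x) p = 0 := by
  apply af_poly_ext hC.op hC.ne
  intro h hh
  have h1 := afD_deriv p h (fun j => ℓ j x) 0
  have h2 : HasDerivAt (fun t : ℝ => MvPolynomial.eval (h + t • (fun j => ℓ j x)) p) 0 0 := by
    refine (hasDerivAt_const (0:ℝ) (MvPolynomial.eval h p)).congr_of_eventuallyEq ?_
    have hc : Continuous (fun t : ℝ => h + t • (fun j => ℓ j x)) := by fun_prop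
    have : ∀ᶠ t : ℝ in nhds 0, h + t • (fun j => ℓ j x) ∈ C :=
      hc.continuousAt.eventually (by simpa using hC.op.mem_nhds hh)
    filter_upwards [this] with t ht
    rw [← hV _ ht, ← hV _ hh, ← afPol_translate h (t • x)]
    congr 2
    ext j; simp
  have := h1.unique h2
  simpa using this

section
variable {n : ℕ} {ι : Type} [Fintype ι] [DecidableEq ι] {ℓ : ι → (Fin (n+1) → ℝ) →ₗ[ℝ] ℝ}
  {C : Set (ι → ℝ)} {p : MvPolynomial ι ℝ} {q : ι → MvPolynomial ι ℝ}

lemma afM_transl (hC : afCn ℓ C)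
    (hV : ∀ h ∈ C, volume.real (afPol ℓ h) = MvPolynomial.eval h p) (x : Fin (n+1) → ℝ)
    (v : ι → ℝ) (l : List (ι → ℝ)) :
    afM p ((v - fun j => ℓ j x) :: l) = afM p (v :: l) := by
  have h1 : afM p ((fun j => ℓ j x) :: l) = 0 := by
    simp only [afM, afDl]
    rw [← afDl_comm, af_transl hC p hV, afDl_zero, map_zero]
  have h2 := afM_add p (v - fun j => ℓ j x) (fun j => ℓ j x) l
  rw [sub_add_cancel, h1] at h2
  linarith

lemma af_qnn (hq : ∀ i, afFD ℓ C i (q i)) (i : ι) (l : List (ι → ℝ)) (hl : ∀ v ∈ l, v ∈ C)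
    (hlen : l.length = n) : 0 ≤ afM (q i) l := by
  by_cases hex : ∃ h ∈ C, ∃ x ∈ afPol ℓ h, ℓ i x = h i
  · exact ((hq i).pos hex l hl hlen).le
  · rw [(hq i).zero hex, afM_zero]

lemma af_facet_exists (hB : afBdd ℓ) (v : ι → ℝ) (hne : (afPol ℓ v).Nonempty) :
    ∃ i, ∃ x ∈ afPol ℓ v, ℓ i x = v i := by
  obtain ⟨x, hx, hmax⟩ := (afPol_compact hB v).exists_isMaxOn hne
    (continuous_apply (0 : Fin (n+1))).continuousOn
  by_contra hno
  push Not at hno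
  obtain ⟨t, ht, hxt⟩ := af_feasible hx (Pi.single 0 1) (fun j hj => absurd hj (hno j x hx))
  have := hmax hxt
  simp at this
  linarith

lemma af_pos (hB : afBdd ℓ) (hC : afCn ℓ C)
    (hV : ∀ h ∈ C, volume.real (afPol ℓ h) = MvPolynomial.eval h p)
    (hq : ∀ i, afFD ℓ C i (q i)) (hp : ∀ i, MvPolynomial.pderiv i p = q i)
    (hne : ∀ h ∈ C, (afPol ℓ h).Nonempty) (l : List (ι → ℝ)) (hl : ∀ v ∈ l, v ∈ C)
    (hlen : l.length = n + 1) : 0 < afM p l := by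
  match l, hl, hlen with
  | v :: l, hl, hlen =>
    have hvC : v ∈ C := hl v (by simp)
    have hl' : ∀ u ∈ l, u ∈ C := fun u hu => hl u (by simp [hu])
    have hlen' : l.length = n := by simpa using hlen
    obtain ⟨x, hx⟩ := af_slater (hC.reg v hvC) (hne v hvC)
    rw [← afM_transl hC hV x, afM_cons]
    obtain ⟨i, y, hy, hi⟩ := af_facet_exists hB v (hne v hvC)
    apply Finset.sum_pos'
    · intro j _
      rw [afM_cons_pderiv, hp]
      exact mul_nonneg (sub_nonneg.2 (hx j).le) (af_qnn hq j l hl' hlen')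
    · refine ⟨i, Finset.mem_univ _, ?_⟩
      rw [afM_cons_pderiv, hp]
      exact mul_pos (sub_pos.2 (hx i)) ((hq i).pos ⟨v, hvC, y, hy, hi⟩ l hl' hlen')

lemma af_AF_step (hB : afBdd ℓ) (hC : afCn ℓ C)
    (hV : ∀ h ∈ C, volume.real (afPol ℓ h) = MvPolynomial.eval h p)
    (hq : ∀ i, afFD ℓ C i (q i)) (hp : ∀ i, MvPolynomial.pderiv i p = q i)
    (hne : ∀ h ∈ C, (afPol ℓ h).Nonempty) (u : ι → ℝ) (huC : u ∈ C) (l : List (ι → ℝ))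
    (hl : ∀ v ∈ l, v ∈ C) (v : ι → ℝ) (hv : v ∈ C) (w : ι → ℝ) (hlen : l.length + 2 = n) :
    afM p (w :: w :: u :: l) * afM p (v :: v :: u :: l) ≤ afM p (w :: v :: u :: l) ^ 2 := by
  obtain ⟨x, hx⟩ := af_slater (hC.reg u huC) (hne u huC)
  have hqM : ∀ i l, afM p (Pi.single i 1 :: l) = afM (q i) l := fun i l => by
    rw [afM_cons_pderiv, hp]
  have hT := fun v l => afM_transl (n := n) hC hV x v l
  set v' : ι → ℝ := u - fun j => ℓ j x with hv'
  have hv'pos : ∀ i, 0 < v' i := fun i => sub_pos.2 (hx i)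
  have hul : ∀ w ∈ u :: l, w ∈ C := by
    intro w hw
    rcases List.mem_cons.1 hw with rfl | h
    · exact huC
    · exact hl w h
  have huul : ∀ w ∈ u :: u :: l, w ∈ C := by
    intro w hw
    rcases List.mem_cons.1 hw with rfl | h
    · exact huC
    · exact hul w h
  let A : ι → ι → ℝ := fun i j => afM p (Pi.single i 1 :: Pi.single j 1 :: u :: l)
  have hA1 : ∀ i w, ∑ j, A i j * w j = afM p (Pi.single i 1 :: w :: u :: l) := by
    intro i w
    rw [afM_swap, afM_cons]
    refine Finset.sum_congr rfl fun j _ => ?_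
    rw [mul_comm, afM_swap]
  have hA2 : ∀ w z : ι → ℝ, ∑ i, z i * ∑ j, A i j * w j = afM p (z :: w :: u :: l) := by
    intro w z
    rw [afM_cons]
    exact Finset.sum_congr rfl fun i _ => by rw [hA1]
  have hAv' : ∀ i, ∑ j, A i j * v' j = afM (q i) (u :: u :: l) := by
    intro i
    rw [hA1, afM_swap, hT, afM_swap, hqM]
  have hJmem : ∀ i, (∃ h ∈ C, ∃ x ∈ afPol ℓ h, ℓ i x = h i) ∨ q i = 0 := by
    intro i
    by_cases hex : ∃ h ∈ C, ∃ x ∈ afPol ℓ h, ℓ i x = h i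
    · exact Or.inl hex
    · exact Or.inr ((hq i).zero hex)
  have key := af_LA A (fun i j => afM_swap _ _ _ _)
    {i | ∃ h ∈ C, ∃ x ∈ afPol ℓ h, ℓ i x = h i}
    (by
      intro i hi j
      simp only [A]
      rw [hqM, (hq i).zero hi, afM_zero])
    (by
      intro i j hij
      simp only [A]
      rw [hqM]
      exact ((hq i).fac j hij.symm (u :: l) hul (by simpa using hlen)).1)
    v' hv'pos
    (by
      intro i hi
      rw [hAv']
      exact (hq i).pos hi _ huul (by simpa using hlen))
    (by
      rintro S ⟨i1, hi1, hi1S⟩ ⟨i2, hi2, hi2S⟩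
      obtain ⟨x1, hx1, he1⟩ := (hq i1).all hi1 u huC
      obtain ⟨x2, hx2, he2⟩ := (hq i2).all hi2 u huC
      obtain ⟨i, hiS, j, hjS, y, hy, hei, hej⟩ := af_conn (by omega) hB u x hx S x1 hx1 i1 hi1S he1
        x2 hx2 i2 hi2S he2
      refine ⟨i, ⟨u, huC, y, hy, hei⟩, j, ⟨u, huC, y, hy, hej⟩, hiS, hjS, ?_⟩
      simp only [A]
      rw [hqM]
      refine ((hq i).fac j ?_ (u :: l) hul (by simpa using hlen)).2 ⟨u, huC, y, hy, hei, hej⟩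
      rintro rfl
      exact hjS hiS)
    (by
      intro w
      rw [hA2]
      have e : afM p (w :: w :: u :: l) = ∑ i, v' i * afM (q i) (w :: w :: l) := by
        rw [afM_perm (l' := u :: w :: w :: l), ← hT, afM_cons]
        · exact Finset.sum_congr rfl fun i _ => by rw [hqM]
        · exact (List.Perm.cons w (List.Perm.swap _ _ _)).trans (List.Perm.swap _ _ _)
      rw [e]
      refine Finset.sum_le_sum fun i _ => ?_
      rw [hAv', hA1, hqM]
      rcases hJmem i with hi | hi
      · have hpos := (hq i).pos hi _ huul (by simpa using hlen)
        rw [mul_div_assoc]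
        refine mul_le_mul_of_nonneg_left ?_ (hv'pos i).le
        rw [le_div_iff₀ hpos]
        exact (hq i).AF l hl u huC w hlen
      · simp [hi, afM_zero])
  have hpp : ∀ a ∈ C, ∀ b ∈ C, 0 < afM p (a :: b :: u :: l) := by
    intro a ha b hb
    refine af_pos hB hC hV hq hp hne _ ?_ (by simp; omega)
    intro z hz
    rcases List.mem_cons.1 hz with rfl | hz
    · exact ha
    rcases List.mem_cons.1 hz with rfl | hz
    · exact hb
    exact hul z hz
  set a := afM p (u :: w :: u :: l)
  set b := afM p (u :: v :: u :: l)
  have hlin1 : ∀ l, afM p ((a • v + (-b) • w) :: l) = a * afM p (v :: l) - b * afM p (w :: l) := by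
    intro l
    rw [afM_add, afM_smul, afM_smul]; ring
  have hlin2 : ∀ z l, afM p (z :: (a • v + (-b) • w) :: l)
      = a * afM p (z :: v :: l) - b * afM p (z :: w :: l) := by
    intro z l
    rw [afM_swap, hlin1, afM_swap, afM_swap p w]
  have := key (a • v + (-b) • w) (by
    rw [hA2, hT, hlin2]
    simp only [a, b]; ring)
  rw [hA2, hlin1, hlin2, hlin2, afM_swap p v w] at this
  refine af_sig _ _ _ a b (hpp u huC v hv).ne' (hpp v hv v hv) ?_
  linarith

lemma af_bm_case {ι : Type} [Fintype ι] [DecidableEq ι] {ℓ : ι → (Fin 2 → ℝ) →ₗ[ℝ] ℝ}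
    {C : Set (ι → ℝ)} {p : MvPolynomial ι ℝ} (hB : afBdd ℓ) (hC : afCn ℓ C)
    (hV : ∀ h ∈ C, volume.real (afPol ℓ h) = MvPolynomial.eval h p) (hom : p.IsHomogeneous 2)
    (hpos : ∀ v ∈ C, ∀ w ∈ C, 0 < afM p [v, w]) (v : ι → ℝ) (hv : v ∈ C) (w : ι → ℝ) :
    afM p [w, w] * afM p [v, v] ≤ afM p [w, v] ^ 2 := by
  have hQ : ∀ h, afM p [h, h] = 2 * MvPolynomial.eval h p := by
    intro h
    rw [← afM_eval [h, h] p (by simpa using hom) h]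
    simp only [afDl]
    rw [af_euler _ 1 (afD_hom h hom), af_euler _ 2 hom]
    push_cast; ring
  have hexp : ∀ (a b : ι → ℝ) (t : ℝ), afM p [a + t • b, a + t • b]
      = afM p [a, a] + 2 * t * afM p [a, b] + t ^ 2 * afM p [b, b] := by
    intro a b t
    have e : ∀ z, afM p [a + t • b, z] = afM p [a, z] + t * afM p [b, z] := by
      intro z; rw [afM_add, afM_smul]
    rw [e, afM_swap p a, afM_swap p b, e, e, afM_swap p b a]
    ring
  have hCC : ∀ w ∈ C, afM p [w, w] * afM p [v, v] ≤ afM p [w, v] ^ 2 := by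
    intro w hw
    have hv0 := hpos v hv v hv
    have hw0 := hpos w hw w hw
    have hvw := hpos v hv w hw
    obtain ⟨t, ht, ht2⟩ : ∃ t : ℝ, 0 < t ∧ t ^ 2 * afM p [w, w] = afM p [v, v] := by
      refine ⟨Real.sqrt (afM p [v, v] / afM p [w, w]), Real.sqrt_pos.2 (div_pos hv0 hw0), ?_⟩
      rw [Real.sq_sqrt (div_pos hv0 hw0).le, div_mul_cancel₀ _ hw0.ne']
    have htw := hC.smul t ht w hw
    have hbm := af_bm_fin2 (afPol ℓ v) (afPol ℓ (t • w)) (afPol ℓ (v + t • w))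
      (afPol_compact hB _) (afPol_compact hB _) (afPol_compact hB _) (by
        intro a ha b hb j
        have h1 := ha j
        have h2 := hb j
        simp only [map_add, Pi.add_apply]
        linarith)
    rw [hV _ hv, hV _ htw, hV _ (hC.add _ hv _ htw)] at hbm
    have e1 : afM p [t • w, t • w] = afM p [v, v] := by
      rw [afM_smul, afM_swap, afM_smul, ← ht2]; ring
    have e2 := hexp v w t
    rw [ht2] at e2
    have e3 := hQ v
    have e4 := hQ (t • w)
    have e5 := hQ (v + t • w)
    rw [e1] at e4
    generalize hX : afM p [v, v] = X at *
    generalize hY : afM p [v, w] = Y at *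
    generalize hZ : afM p [w, w] = Z at *
    have e6 : 16 * X * X ≤ (2 * X + 2 * t * Y) ^ 2 := by
      have : 16 * X * X ≤ afM p [v + t • w, v + t • w] ^ 2 := by rw [e5]; nlinarith
      rw [e2] at this
      nlinarith
    have e7 : 4 * X ≤ 2 * X + 2 * t * Y := by
      have h0 : 0 ≤ 2 * X + 2 * t * Y := by positivity
      have h1 : (4 * X) ^ 2 ≤ (2 * X + 2 * t * Y) ^ 2 := by linarith [e6]
      exact (pow_le_pow_iff_left₀ (by positivity) h0 two_ne_zero).1 h1
    have e8 : X ^ 2 ≤ (t * Y) ^ 2 := pow_le_pow_left₀ hv0.le (by linarith) 2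
    rw [afM_swap p w v, hY]
    have ht2' : 0 < t ^ 2 := by positivity
    have : t ^ 2 * (Z * X) ≤ t ^ 2 * Y ^ 2 := by nlinarith
    exact le_of_mul_le_mul_left this ht2'
  have hc : Continuous (fun t : ℝ => v + t • w) := by fun_prop
  have hev : ∀ᶠ t : ℝ in nhds 0, v + t • w ∈ C :=
    hc.continuousAt.eventually (by simpa using hC.op.mem_nhds hv)
  obtain ⟨δ, hδC, hδ⟩ := ((hev.filter_mono nhdsWithin_le_nhds).and
    (self_mem_nhdsWithin (s := Set.Ioi (0:ℝ)))).exists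
  have h1 := hCC _ hδC
  rw [hexp, afM_add, afM_smul, afM_swap p v w] at h1
  have hδ2 : 0 < δ ^ 2 := by have : (0:ℝ) < δ := hδ; positivity
  refine le_of_mul_le_mul_left ?_ hδ2
  nlinarith

lemma afOK_step (IH : ∀ (κ : Type) [Fintype κ] [DecidableEq κ] (ℓ : κ → (Fin n → ℝ) →ₗ[ℝ] ℝ)
      (C : Set (κ → ℝ)), afBdd ℓ → afCn ℓ C → ∃ p, afOK ℓ C p)
    (hB : afBdd ℓ) (hC : afCn ℓ C) : ∃ p, afOK ℓ C p := by
  choose q hq using fun i => afFD_exists IH hB hC i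
  obtain ⟨p, hom, hV, hp⟩ := af_polyn n (fun h => volume.real (afPol ℓ h)) C hC.op hC.ne
    (fun h t ht => afPol_smul h t ht) q (fun i => (hq i).hom) (fun h hh i => (hq i).der h hh)
  have hpos := fun hne => af_pos hB hC hV hq hp hne
  refine ⟨p, hom, hV, hpos, ?_, ?_⟩
  · intro i l hl hlen
    rw [afM_cons_pderiv, hp]
    exact ⟨af_qnn hq i l hl (by omega), fun hex => (hq i).pos hex l hl (by omega)⟩
  · intro l hl v hv w hlen
    by_cases hne : ∀ h ∈ C, (afPol ℓ h).Nonempty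
    · match l, hl, hlen with
      | [], hl, hlen =>
        obtain rfl : n = 1 := by simpa using hlen.symm
        refine af_bm_case hB hC hV hom ?_ v hv w
        intro a ha b hb
        refine hpos hne _ ?_ (by simp)
        simp [ha, hb]
      | u :: l, hl, hlen =>
        exact af_AF_step hB hC hV hq hp hne u (hl u (by simp)) l (fun z hz => hl z (by simp [hz]))
          v hv w (by simp at hlen; omega)
    · have hemp : ∀ h ∈ C, ¬ (afPol ℓ h).Nonempty := fun h hh hn =>
        hne (af_dich hB hC.pre hC.reg ⟨h, hh, hn⟩)
      have : p = 0 := by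
        apply af_poly_ext hC.op hC.ne
        intro x hx
        rw [← hV x hx, Set.not_nonempty_iff_eq_empty.1 (hemp x hx)]
        simp
      simp [this, afM_zero]
end

theorem afOK_main (n : ℕ) : ∀ (κ : Type) [Fintype κ] [DecidableEq κ]
    (ℓ : κ → (Fin n → ℝ) →ₗ[ℝ] ℝ) (C : Set (κ → ℝ)), afBdd ℓ → afCn ℓ C → ∃ p, afOK ℓ C p := by
  induction n with
  | zero => intro κ _ _ ℓ C hB hC; exact afOK_base hB hC
  | succ n ih => intro κ _ _ ℓ C hB hC; exact afOK_step ih hB hC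


section
variable {E : Type} [AddCommGroup E] [Module ℝ E]

def afH (A : Set E) : Prop :=
  ∃ (κ : Type) (_ : Fintype κ) (f : κ → E →ₗ[ℝ] ℝ) (b : κ → ℝ), A = {x | ∀ k, f k x ≤ b k}

lemma af_fm_real {κ : Type} [Fintype κ] (u c : κ → ℝ) :
    (∃ t : ℝ, ∀ k, u k + t * c k ≤ 0) ↔
      (∀ k, c k = 0 → u k ≤ 0) ∧ ∀ k l, 0 < c k → c l < 0 → u k * (-c l) + u l * c k ≤ 0 := by
  constructor
  · rintro ⟨t, ht⟩
    refine ⟨fun k hk => by have := ht k; rw [hk] at this; simpa using this, fun k l hk hl => ?_⟩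
    have h1 := mul_le_mul_of_nonneg_right (ht k) (neg_nonneg.2 hl.le)
    have h2 := mul_le_mul_of_nonneg_right (ht l) hk.le
    nlinarith
  · rintro ⟨h0, h1⟩
    obtain ⟨t, ht1, ht2⟩ : ∃ t : ℝ, (∀ l, c l < 0 → -u l / c l ≤ t) ∧
        (∀ k, 0 < c k → t ≤ -u k / c k) := by
      have hle : ∀ k l, 0 < c k → c l < 0 → -u l / c l ≤ -u k / c k := by
        intro k l hk hl
        rw [div_le_iff_of_neg hl, div_mul_eq_mul_div, div_le_iff₀ hk]
        have := h1 k l hk hl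
        linarith
      by_cases hn : ∃ l, c l < 0
      · obtain ⟨l0, hl0⟩ := hn
        obtain ⟨l, hl, hmax⟩ := Finset.exists_max_image
          (Finset.univ.filter (fun l => c l < 0)) (fun l => -u l / c l) ⟨l0, by simpa using hl0⟩
        refine ⟨-u l / c l, fun l' hl' => hmax l' (by simpa using hl'), fun k hk => ?_⟩
        exact hle k l hk (by simpa using hl)
      · push Not at hn
        by_cases hp : ∃ k, 0 < c k
        · obtain ⟨k0, hk0⟩ := hp
          obtain ⟨k, hk, hmin⟩ := Finset.exists_min_image
            (Finset.univ.filter (fun k => 0 < c k)) (fun k => -u k / c k) ⟨k0, by simpa using hk0⟩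
          exact ⟨-u k / c k, fun l' hl' => absurd hl' (not_lt.2 (hn l')),
            fun k' hk' => hmin k' (by simpa using hk')⟩
        · push Not at hp
          exact ⟨0, fun l' hl' => absurd hl' (not_lt.2 (hn l')),
            fun k' hk' => absurd hk' (not_lt.2 (hp k'))⟩
    refine ⟨t, fun k => ?_⟩
    rcases lt_trichotomy (c k) 0 with hk | hk | hk
    · have := ht1 k hk
      rw [div_le_iff_of_neg hk] at this
      linarith
    · rw [hk]; have := h0 k hk; linarith
    · have := ht2 k hk
      rw [le_div_iff₀ hk] at this
      linarith

lemma afH_ray {A : Set E} (hA : afH A) (a : E) : afH {x | ∃ t : ℝ, 0 ≤ t ∧ x - t • a ∈ A} := by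
  classical
  obtain ⟨κ, _, f, b, rfl⟩ := hA
  let f' : Option κ → E →ₗ[ℝ] ℝ := fun k => k.elim 0 f
  let b' : Option κ → ℝ := fun k => k.elim 0 b
  let c : Option κ → ℝ := fun k => k.elim (-1) (fun k => - f k a)
  refine ⟨Option κ ⊕ Option κ × Option κ, inferInstance,
    fun k => k.elim (fun k => if c k = 0 then f' k else 0)
      (fun k => if 0 < c k.1 ∧ c k.2 < 0 then (-c k.2) • f' k.1 + c k.1 • f' k.2 else 0),
    fun k => k.elim (fun k => if c k = 0 then b' k else 0)
      (fun k => if 0 < c k.1 ∧ c k.2 < 0 then (-c k.2) * b' k.1 + c k.1 * b' k.2 else 0), ?_⟩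
  ext x
  have h1 := af_fm_real (fun k => f' k x - b' k) c
  have h2 : (∃ t : ℝ, 0 ≤ t ∧ x - t • a ∈ {x | ∀ k, f k x ≤ b k}) ↔
      ∃ t : ℝ, ∀ k, (fun k => f' k x - b' k) k + t * c k ≤ 0 := by
    refine exists_congr fun t => ?_
    rw [Option.forall]
    simp only [f', b', c, Option.elim_none, Option.elim_some, LinearMap.zero_apply]
    refine and_congr ⟨fun h => by linarith, fun h => by linarith⟩ (forall_congr' fun k => ?_)
    simp only [map_sub, map_smul, smul_eq_mul]
    constructor <;> intro h <;> linarith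
  show (∃ t : ℝ, 0 ≤ t ∧ x - t • a ∈ {x | ∀ k, f k x ≤ b k}) ↔ ∀ k, _
  rw [h2, h1, Sum.forall]
  refine and_congr (forall_congr' fun k => ?_) ?_
  · by_cases hk : c k = 0
    · simp [hk]
    · simp [hk]
  · rw [Prod.forall]
    refine forall_congr' fun k => forall_congr' fun l => ?_
    by_cases hk : 0 < c k ∧ c l < 0
    · simp only [hk.1, hk.2, forall_const, Sum.elim_inr, and_self, if_true, LinearMap.add_apply,
        LinearMap.smul_apply, smul_eq_mul]
      constructor <;> intro h <;> linarith
    · simp only [Sum.elim_inr, hk, if_false, LinearMap.zero_apply, le_refl, iff_true]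
      exact fun h3 h4 => absurd ⟨h3, h4⟩ hk

def afCc : List E → Set E
  | [] => {0}
  | a :: l => {x | ∃ t : ℝ, 0 ≤ t ∧ x - t • a ∈ afCc l}

lemma afCc_H (h0 : afH ({0} : Set E)) (l : List E) : afH (afCc l) := by
  induction l with
  | nil => exact h0
  | cons a l ih => exact afH_ray ih a

lemma afCc_zero (l : List E) : (0 : E) ∈ afCc l := by
  induction l with
  | nil => simp [afCc]
  | cons a l ih => exact ⟨0, le_rfl, by simpa using ih⟩

lemma afCc_add (l : List E) : ∀ x ∈ afCc l, ∀ y ∈ afCc l, x + y ∈ afCc l := by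
  induction l with
  | nil => simp [afCc]
  | cons a l ih =>
    rintro x ⟨t, ht, hx⟩ y ⟨s, hs, hy⟩
    refine ⟨t + s, add_nonneg ht hs, ?_⟩
    have := ih _ hx _ hy
    convert this using 1
    rw [add_smul]; abel

lemma afCc_smul (l : List E) (c : ℝ) (hc : 0 ≤ c) : ∀ x ∈ afCc l, c • x ∈ afCc l := by
  induction l with
  | nil => simp [afCc]
  | cons a l ih =>
    rintro x ⟨t, ht, hx⟩
    refine ⟨c * t, mul_nonneg hc ht, ?_⟩
    have := ih _ hx
    rwa [smul_sub, smul_smul] at this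

lemma afCc_mem (l : List E) : ∀ a ∈ l, a ∈ afCc l := by
  induction l with
  | nil => simp
  | cons a l ih =>
    intro x hx
    rcases List.mem_cons.1 hx with rfl | hx
    · exact ⟨1, zero_le_one, by simpa using afCc_zero l⟩
    · exact ⟨0, le_rfl, by simpa using ih x hx⟩
end

lemma af_conv_iff {n : ℕ} (F : Finset (Fin n → ℝ)) (hF : F.Nonempty) (x : Fin n → ℝ) :
    x ∈ convexHull ℝ (F : Set (Fin n → ℝ)) ↔
      ((x, 1) : (Fin n → ℝ) × ℝ) ∈ afCc (F.toList.map fun y => ((y, 1) : (Fin n → ℝ) × ℝ)) := by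
  constructor
  · intro hx
    have : convexHull ℝ (F : Set (Fin n → ℝ)) ⊆ {x | ((x, 1) : (Fin n → ℝ) × ℝ) ∈
        afCc (F.toList.map fun y => ((y, 1) : (Fin n → ℝ) × ℝ))} := by
      apply convexHull_min
      · intro y hy
        exact afCc_mem _ _ (List.mem_map.2 ⟨y, by simpa using hy, rfl⟩)
      · intro y hy z hz a b ha hb hab
        have := afCc_add _ _ (afCc_smul _ a ha _ hy) _ (afCc_smul _ b hb _ hz)
        simpa [hab] using this
    exact this hx
  · intro hx
    have hQ := convex_convexHull ℝ (F : Set (Fin n → ℝ))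
    have key : ∀ l : List (Fin n → ℝ), (∀ y ∈ l, y ∈ convexHull ℝ (F : Set (Fin n → ℝ))) →
        ∀ (x : Fin n → ℝ) (s : ℝ), ((x, s) : (Fin n → ℝ) × ℝ) ∈
          afCc (l.map fun y => ((y, 1) : (Fin n → ℝ) × ℝ)) →
          0 ≤ s ∧ x ∈ s • convexHull ℝ (F : Set (Fin n → ℝ)) := by
      intro l
      induction l with
      | nil =>
        intro _ x s h
        have h' : ((x, s) : (Fin n → ℝ) × ℝ) = 0 := h
        obtain ⟨rfl, rfl⟩ := Prod.mk_eq_zero.1 h'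
        refine ⟨le_rfl, ?_⟩
        obtain ⟨y, hy⟩ := hF
        exact ⟨y, subset_convexHull ℝ _ hy, by simp⟩
      | cons a l ih =>
        rintro hl x s ⟨t, ht, hx⟩
        obtain ⟨h1, h2⟩ := ih (fun y hy => hl y (by simp [hy])) (x - t • a) (s - t) (by
          simpa using hx)
        refine ⟨by linarith, ?_⟩
        have h3 : t • a ∈ t • convexHull ℝ (F : Set (Fin n → ℝ)) :=
          Set.smul_mem_smul_set (hl a (by simp))
        have h4 := Set.add_mem_add h2 h3
        rw [← hQ.add_smul h1 ht] at h4
        simpa using h4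
    have := (key F.toList (fun y hy => subset_convexHull ℝ _ (by simpa using hy)) x 1 hx).2
    simpa using this

lemma af_MW {n : ℕ} (F : Finset (Fin n → ℝ)) (hF : F.Nonempty) :
    ∃ T : Finset ((Fin n → ℝ) →ₗ[ℝ] ℝ), ∀ x, (∀ f ∈ T, ∀ c, (∀ y ∈ F, f y ≤ c) → f x ≤ c) →
      x ∈ convexHull ℝ (F : Set (Fin n → ℝ)) := by
  classical
  have h0 : afH ({0} : Set ((Fin n → ℝ) × ℝ)) := by
    refine ⟨(Fin n ⊕ Unit) × Bool, inferInstance, fun k =>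
      (if k.2 then (1:ℝ) else -1) • k.1.elim
        (fun i => (LinearMap.proj i).comp (LinearMap.fst ℝ (Fin n → ℝ) ℝ))
        (fun _ => LinearMap.snd ℝ (Fin n → ℝ) ℝ), fun _ => 0, ?_⟩
    ext ⟨x, s⟩
    simp only [Set.mem_singleton_iff, Prod.mk_eq_zero]
    constructor
    · rintro ⟨rfl, rfl⟩ ⟨k, b⟩
      rcases k with k | k <;> cases b <;> simp
    · intro h
      refine ⟨?_, ?_⟩
      · ext i
        have h1 := h (Sum.inl i, true)
        have h2 := h (Sum.inl i, false)
        simp at h1 h2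
        exact le_antisymm h1 h2
      · have h1 := h (Sum.inr (), true)
        have h2 := h (Sum.inr (), false)
        simp at h1 h2
        exact le_antisymm h1 h2
  obtain ⟨κ, _, f, b, hfb⟩ := afCc_H h0 (F.toList.map fun y => ((y, 1) : (Fin n → ℝ) × ℝ))
  refine ⟨Finset.univ.image (fun k => (f k).comp (LinearMap.inl ℝ (Fin n → ℝ) ℝ)), ?_⟩
  intro x hx
  rw [af_conv_iff F hF, hfb]
  have hdec : ∀ k (y : Fin n → ℝ), f k (y, 1) = f k (y, 0) + f k (0, 1) := by
    intro k y
    rw [← map_add]; simp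
  intro k
  have h1 := hx _ (Finset.mem_image_of_mem _ (Finset.mem_univ k)) (b k - f k (0, 1)) (by
    intro y hy
    have h2 := (af_conv_iff F hF y).1 (subset_convexHull ℝ _ hy)
    rw [hfb] at h2
    have h3 := h2 k
    rw [hdec] at h3
    simp only [LinearMap.comp_apply, LinearMap.inl_apply]
    linarith)
  simp only [LinearMap.comp_apply, LinearMap.inl_apply] at h1
  rw [hdec]; linarith


lemma af_comb {J : Type} [Fintype J] [DecidableEq J] (F : (J → J) → ℝ)
    (hF : ∀ S : J → J, ∀ k l, k ≠ l →
      F (Function.update S l (S k)) + F (Function.update S k (S l)) ≤ 2 * F S) (S : J → J) :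
    ∑ k, F (fun _ => S k) ≤ Fintype.card J * F S := by
  rcases isEmpty_or_nonempty J with hJ | hJ
  · simp
  let ψ : (J → J) → ℝ := fun S => Fintype.card J * F S - ∑ k, F (fun _ => S k)
  suffices h : 0 ≤ ψ S by simp only [ψ] at h; linarith
  have hψ : ∀ S : J → J, ∀ k l, k ≠ l →
      ψ (Function.update S l (S k)) + ψ (Function.update S k (S l)) ≤ 2 * ψ S := by
    intro S k l hkl
    have h1 := hF S k l hkl
    have hs : ∀ i x, ∑ j, F (fun _ => Function.update S i x j)
        = ∑ j, F (fun _ => S j) + (F (fun _ => x) - F (fun _ => S i)) := by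
      intro i x
      rw [← Finset.add_sum_erase _ _ (Finset.mem_univ i),
        ← Finset.add_sum_erase Finset.univ (fun j => F (fun _ => S j)) (Finset.mem_univ i)]
      have : ∑ j ∈ univ.erase i, F (fun _ => Function.update S i x j)
          = ∑ j ∈ univ.erase i, F (fun _ => S j) := by
        refine Finset.sum_congr rfl fun j hj => ?_
        rw [Function.update_of_ne (Finset.ne_of_mem_erase hj)]
      rw [this, Function.update_self]
      ring
    simp only [ψ, hs]
    have h2 : (0:ℝ) ≤ Fintype.card J := Nat.cast_nonneg _
    nlinarith [mul_le_mul_of_nonneg_left h1 h2]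
  have hconst : ∀ a, ψ (fun _ => a) = 0 := by
    intro a
    simp [ψ]
  obtain ⟨S0, _, hS0⟩ := Finset.exists_min_image (Finset.univ : Finset (J → J)) ψ
    ⟨id, Finset.mem_univ _⟩
  have hmin : ∀ S, ψ S0 ≤ ψ S := fun S => hS0 S (Finset.mem_univ _)
  let cnt : (J → J) × J → ℕ := fun x => (univ.filter (fun k => x.1 k = x.2)).card
  obtain ⟨k0⟩ := hJ
  obtain ⟨⟨S1, a⟩, hmem, hmax⟩ := Finset.exists_max_image
    ((Finset.univ : Finset ((J → J) × J)).filter (fun x => ψ x.1 = ψ S0)) cnt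
    ⟨(S0, k0), by simp⟩
  have hS1 : ψ S1 = ψ S0 := by simpa using hmem
  have hmax' : ∀ T b, ψ T = ψ S0 → cnt (T, b) ≤ cnt (S1, a) :=
    fun T b hT => hmax (T, b) (by simpa using hT)
  have hexl : ∃ l, S1 l = a := by
    by_contra hno
    push Not at hno
    have h1 : cnt (S1, a) = 0 := by
      simp only [cnt, Finset.card_eq_zero, Finset.filter_eq_empty_iff]
      intro k _; exact hno k
    have h2 := hmax' S1 (S1 k0) hS1
    rw [h1] at h2
    have : 0 < cnt (S1, S1 k0) := Finset.card_pos.2 ⟨k0, by simp⟩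
    omega
  obtain ⟨k, hk⟩ := hexl
  have hall : ∀ l, S1 l = a := by
    intro l
    by_contra hl
    have hkl : k ≠ l := by rintro rfl; exact hl hk
    have h1 := hψ S1 k l hkl
    have h2 := hmin (Function.update S1 l (S1 k))
    have h3 := hmin (Function.update S1 k (S1 l))
    have h4 : ψ (Function.update S1 l (S1 k)) = ψ S0 := by linarith
    have h5 := hmax' _ a h4
    have h6 : cnt (S1, a) < cnt (Function.update S1 l (S1 k), a) := by
      apply Finset.card_lt_card
      rw [Finset.ssubset_iff_of_subset]
      · exact ⟨l, by simp [hk], by simp [hl]⟩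
      · intro j hj
        simp only [Finset.mem_filter, Finset.mem_univ, true_and] at hj ⊢
        by_cases hjl : j = l
        · subst hjl; simp [hk]
        · rw [Function.update_of_ne hjl]; exact hj
    omega
  have : S1 = fun _ => a := funext hall
  have h0 : ψ S0 = 0 := by rw [← hS1, this, hconst]
  rw [← h0]; exact hmin S

lemma af_final {n p : ℕ} (hp1 : 1 ≤ p) (hpn : p ≤ n) {V : Type} (G : (Fin n → V) → ℝ) (C : Set V)
    (hsym : ∀ (σ : Equiv.Perm (Fin n)) f, G (f ∘ σ) = G f)
    (hpos : ∀ f, (∀ i, f i ∈ C) → 0 < G f)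
    (hAF : ∀ f, (∀ i, f i ∈ C) → ∀ i j, i ≠ j →
      G (Function.update f i (f j)) * G (Function.update f j (f i)) ≤ G f ^ 2)
    (K : Fin p → V) (L : Fin (n - p) → V) (hK : ∀ i, K i ∈ C) (hL : ∀ i, L i ∈ C) :
    ∏ s : Fin p, ∏ i ∈ Finset.univ.erase s, G (fam hp1 hpn (fun _ => K i) (K s) L) ≤
      G (combine hpn K L) ^ (p * (p - 1)) := by
  have hcC : ∀ A : Fin p → V, (∀ i, A i ∈ C) → ∀ i, combine hpn A L i ∈ C := by
    intro A hA i
    unfold combine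
    split_ifs
    · exact hA _
    · exact hL _
  have hcu : ∀ (A : Fin p → V) (i : Fin p) (x : V),
      combine hpn (Function.update A i x) L
        = Function.update (combine hpn A L) (Fin.castLE hpn i) x := by
    intro A i x
    ext j
    by_cases hj : j = Fin.castLE hpn i
    · subst hj
      simp [combine]
    · rw [Function.update_of_ne hj]
      unfold combine
      split_ifs with h
      · rw [Function.update_of_ne]
        rintro rfl
        exact hj (by ext; simp)
      · rfl
  have hcK : ∀ (A : Fin p → V) (i : Fin p), combine hpn A L (Fin.castLE hpn i) = A i := by
    intro A i; simp [combine]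
  have hone : ∀ s : Fin p, ∏ i ∈ Finset.univ.erase s, G (fam hp1 hpn (fun _ => K i) (K s) L) ≤
      G (combine hpn K L) ^ (p - 1) := by
    intro s
    let J := {i : Fin p // i ≠ s}
    let X : (J → J) → Fin p → V := fun S i => if h : i = s then K s else K (S ⟨i, h⟩)
    have hX : ∀ S i, X S i ∈ C := by
      intro S i
      simp only [X]
      split_ifs <;> exact hK _
    have hXu : ∀ S (l : J) y, X (Function.update S l y) = Function.update (X S) l (K y) := by
      intro S l y
      ext i
      by_cases hi : i = l
      · subst hi
        simp [X, l.2]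
      · rw [Function.update_of_ne hi]
        simp only [X]
        split_ifs with h
        · rfl
        · rw [Function.update_of_ne]
          rintro rfl
          exact hi rfl
    have hXv : ∀ S (l : J), X S l = K (S l) := by
      intro S l; simp [X, l.2]
    have h1 := af_comb (fun S : J → J => Real.log (G (combine hpn (X S) L))) (by
      intro S k l hkl
      have hkl' : Fin.castLE hpn (k : Fin p) ≠ Fin.castLE hpn (l : Fin p) := by
        intro h
        exact hkl (Subtype.ext (Fin.castLE_injective hpn h))
      have h2 := hAF (combine hpn (X S) L) (hcC _ (hX S)) _ _ hkl'
      rw [hcK, hcK, ← hcu, ← hcu, hXv, hXv, ← hXu, ← hXu] at h2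
      rw [← Real.log_mul (hpos _ (hcC _ (hX _))).ne' (hpos _ (hcC _ (hX _))).ne', mul_comm]
      have := Real.log_le_log (mul_pos (hpos _ (hcC _ (hX _))) (hpos _ (hcC _ (hX _)))) h2
      rwa [Real.log_pow] at this) id
    have hid : X id = K := by
      ext i
      simp only [X]
      split_ifs with h
      · rw [h]
      · rfl
    rw [hid] at h1
    have hcard : Fintype.card J = p - 1 := by
      simp [J]
    rw [hcard, ← Real.log_pow, ← Real.log_prod (s := univ)
      (f := fun k : J => G (combine hpn (X fun _ => id k) L))
      (fun k _ => (hpos _ (hcC _ (hX (fun _ => id k)))).ne')] at h1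
    have h3 := (Real.log_le_log_iff
      (Finset.prod_pos fun k _ => hpos _ (hcC _ (hX (fun _ => id k))))
      (pow_pos (hpos _ (hcC _ hK)) _)).1 h1
    refine le_trans (le_of_eq ?_) h3
    have hfam : ∀ k : J, G (fam hp1 hpn (fun _ => K k) (K s) L)
        = G (combine hpn (X (fun _ => id k)) L) := by
      intro k
      rw [← hsym (Equiv.swap (Fin.castLE hpn s) ⟨p - 1, by omega⟩)
        (combine hpn (X (fun _ => id k)) L)]
      congr 1
      ext i
      simp only [Function.comp_apply]
      by_cases hi1 : i = ⟨p - 1, by omega⟩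
      · subst hi1
        rw [Equiv.swap_apply_right, hcK]
        simp [fam, X]
      · have hi1' : (i : ℕ) ≠ p - 1 := fun h => hi1 (Fin.ext h)
        by_cases hi2 : i = Fin.castLE hpn s
        · subst hi2
          rw [Equiv.swap_apply_left]
          have := s.2
          simp only [Fin.val_castLE] at hi1'
          have h4 : (s : ℕ) < p - 1 := by omega
          have h5 : (⟨p - 1, by omega⟩ : Fin p) ≠ s := fun h => by
            have := congrArg Fin.val h
            simp at this; omega
          simp [fam, X, combine, h4, h5, show p - 1 < p by omega]
        · rw [Equiv.swap_apply_of_ne_of_ne hi2 hi1]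
          have hi2' : ∀ h : (i : ℕ) < p, (⟨i, h⟩ : Fin p) ≠ s := by
            rintro h rfl
            exact hi2 (by ext; simp)
          by_cases h6 : (i : ℕ) < p - 1
          · have h7 : (i : ℕ) < p := by omega
            simp [fam, combine, X, h6, h7, hi2' h7]
          · have h7 : ¬ (i : ℕ) < p := by omega
            simp [fam, combine, h6, h7, hi1']
    rw [← Finset.prod_congr rfl (fun k _ => hfam k)]
    rw [← Finset.prod_subtype (univ.erase s) (p := fun i => i ≠ s) (by simp)
      (fun i => G (fam hp1 hpn (fun _ => K i) (K s) L))]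
  calc _ ≤ ∏ s : Fin p, G (combine hpn K L) ^ (p - 1) := by
        refine Finset.prod_le_prod (fun s _ => Finset.prod_nonneg fun i _ => (hpos _ ?_).le)
          (fun s _ => hone s)
        intro j
        unfold fam
        split_ifs
        · exact hK _
        · exact hK _
        · exact hL _
    _ = _ := by rw [Finset.prod_const, ← pow_mul, mul_comm, Finset.card_univ, Fintype.card_fin]


noncomputable def afG {n : ℕ} {ι : Type} (p : MvPolynomial ι ℝ) (f : Fin n → ι → ℝ) : ℝ :=
  ∑ T ∈ (univ : Finset (Fin n)).powerset,
    (-1 : ℝ) ^ ((univ : Finset (Fin n)).card + T.card) * MvPolynomial.eval (0 + ∑ i ∈ T, f i) p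

lemma afG_cont {n : ℕ} {ι : Type} (p : MvPolynomial ι ℝ) :
    Continuous (afG (n := n) p) := by
  unfold afG
  refine continuous_finsetSum _ fun T _ => continuous_const.mul ?_
  refine (MvPolynomial.continuous_eval p).comp (continuous_const.add ?_)
  exact continuous_finsetSum _ fun i _ => continuous_apply i

section
variable {n : ℕ} {ι : Type} [Fintype ι] [DecidableEq ι] {p : MvPolynomial ι ℝ}

lemma afG_eq (hp : p.IsHomogeneous n) (f : Fin n → ι → ℝ) :
    afG p f = afM p ((univ : Finset (Fin n)).toList.map f) :=
  af_polar f univ p (by simpa using hp) 0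

lemma afG_sym (hp : p.IsHomogeneous n) (σ : Equiv.Perm (Fin n)) (f : Fin n → ι → ℝ) :
    afG p (f ∘ σ) = afG p f := by
  rw [afG_eq hp, afG_eq hp]
  apply afM_perm
  rw [← Multiset.coe_eq_coe, ← Multiset.map_coe, ← Multiset.map_coe, Finset.coe_toList,
    ← Multiset.map_map]
  congr 1
  exact Multiset.map_univ_val_equiv σ

lemma afG_two (hp : p.IsHomogeneous n) (f : Fin n → ι → ℝ) (i j : Fin n) (hij : i ≠ j) :
    afG p f = afM p (f i :: f j :: (((univ : Finset (Fin n)).erase i).erase j).toList.map f) := by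
  rw [afG_eq hp]
  apply afM_perm
  have h1 : (univ : Finset (Fin n)).toList.Perm
      (i :: j :: (((univ : Finset (Fin n)).erase i).erase j).toList) := by
    have h2 : insert i (insert j ((univ.erase i).erase j)) = (univ : Finset (Fin n)) := by
      rw [Finset.insert_erase (by simp [hij.symm]), Finset.insert_erase (by simp)]
    conv_lhs => rw [← h2]
    refine (Finset.toList_insert (by simp [hij])).trans (List.Perm.cons _ ?_)
    exact Finset.toList_insert (by simp)
  exact h1.map f

lemma afG_AF {ℓ : ι → (Fin n → ℝ) →ₗ[ℝ] ℝ} {C : Set (ι → ℝ)} (hp : afOK ℓ C p)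
    (f : Fin n → ι → ℝ) (hf : ∀ i, f i ∈ C) (i j : Fin n) (hij : i ≠ j) :
    afG p (Function.update f i (f j)) * afG p (Function.update f j (f i)) ≤ afG p f ^ 2 := by
  have hm : ∀ (k : Fin n) (x : ι → ℝ), (k = i ∨ k = j) →
      (((univ : Finset (Fin n)).erase i).erase j).toList.map (Function.update f k x)
      = (((univ : Finset (Fin n)).erase i).erase j).toList.map f := by
    intro k x hk
    apply List.map_congr_left
    intro a ha
    rw [Finset.mem_toList] at ha
    simp only [Finset.mem_erase] at ha
    rw [Function.update_of_ne]
    rcases hk with rfl | rfl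
    · exact ha.2.1
    · exact ha.1
  rw [afG_two hp.hom _ i j hij, afG_two hp.hom (Function.update f j (f i)) i j hij,
    afG_two hp.hom f i j hij, hm i _ (Or.inl rfl), hm j _ (Or.inr rfl)]
  simp only [Function.update_self, Function.update_of_ne hij, Function.update_of_ne hij.symm]
  rw [mul_comm]
  refine hp.AF _ ?_ _ (hf j) _ ?_
  · intro v hv
    obtain ⟨k, _, rfl⟩ := List.mem_map.1 hv
    exact hf k
  · rw [List.length_map, Finset.length_toList, Finset.card_erase_of_mem (by simp [hij.symm]),
      Finset.card_erase_of_mem (by simp)]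
    have h1 := i.2
    have h2 := j.2
    have h3 : (i : ℕ) ≠ j := fun h => hij (Fin.ext h)
    simp only [Finset.card_univ, Fintype.card_fin]
    omega

lemma afG_pos {ℓ : ι → (Fin n → ℝ) →ₗ[ℝ] ℝ} {C : Set (ι → ℝ)} (hp : afOK ℓ C p)
    (hne : ∀ h ∈ C, (afPol ℓ h).Nonempty)
    (f : Fin n → ι → ℝ) (hf : ∀ i, f i ∈ C) : 0 < afG p f := by
  rw [afG_eq hp.hom]
  refine hp.pos hne _ ?_ (by simp)
  intro v hv
  obtain ⟨k, _, rfl⟩ := List.mem_map.1 hv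
  exact hf k

lemma afG_MV (hn : n ≠ 0) (hp : p.IsHomogeneous n) (f : Fin n → ι → ℝ)
    (Q : Fin n → Set (Fin n → ℝ))
    (h : ∀ S : Finset (Fin n), vol (∑ i ∈ S, Q i) = MvPolynomial.eval (∑ i ∈ S, f i) p) :
    afG p f = MV n Q := by
  have h0 : MvPolynomial.eval 0 p = 0 := by
    have h1 := af_euler p n hp 0
    have h2 : afD (0 : ι → ℝ) p = 0 := by rw [afD_eq]; simp
    rw [h2, map_zero] at h1
    have h3 : (n:ℝ) ≠ 0 := by exact_mod_cast hn
    exact (mul_eq_zero.1 h1.symm).resolve_left h3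
  unfold afG MV
  rw [Finset.sum_powerset]
  simp only [Finset.card_univ, Fintype.card_fin]
  have hr : Finset.range (n + 1) = insert 0 (Finset.Icc 1 n) := by
    ext k; simp; omega
  rw [hr, Finset.sum_insert (by simp)]
  simp only [Finset.powersetCard_zero, Finset.sum_singleton, Finset.card_empty, Finset.sum_empty,
    add_zero, zero_add, h0, mul_zero]
  refine Finset.sum_congr rfl fun j hj => ?_
  rw [Finset.mul_sum]
  refine Finset.sum_congr rfl fun S hS => ?_
  rw [h, (Finset.mem_powersetCard.1 hS).2]
  congr 1
  have := (Finset.mem_Icc.1 hj).2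
  obtain ⟨k, rfl⟩ := Nat.exists_eq_add_of_le this
  rw [Nat.add_sub_cancel_left, show j + k + j = k + 2 * j by ring, pow_add, pow_mul]
  simp

/-- continuity of the volume along the direction `h0` -/
lemma af_vol_lim {ℓ : ι → (Fin n → ℝ) →ₗ[ℝ] ℝ} (hB : afBdd ℓ) (h h0 : ι → ℝ)
    (hne : (afPol ℓ h0).Nonempty)
    (hp : ∀ ε : ℝ, 0 < ε → volume.real (afPol ℓ (h + ε • h0)) = MvPolynomial.eval (h + ε • h0) p) :
    volume.real (afPol ℓ h) = MvPolynomial.eval h p := by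
  obtain ⟨x0, hx0⟩ := hne
  set h1 : ι → ℝ := h0 - fun j => ℓ j x0 with hh1
  have h1nn : ∀ j, 0 ≤ h1 j := fun j => sub_nonneg.2 (hx0 j)
  let ε : ℕ → ℝ := fun k => 1 / ((k : ℝ) + 1)
  have hε : ∀ k, 0 < ε k := fun k => by positivity
  have hlim : Filter.Tendsto ε Filter.atTop (nhds 0) := tendsto_one_div_add_atTop_nhds_zero_nat
  have hanti : Antitone ε := by
    intro a b hab
    have : (a:ℝ) ≤ b := by exact_mod_cast hab
    exact one_div_le_one_div_of_le (by positivity) (by linarith)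
  have e : ∀ k, volume.real (afPol ℓ (h + ε k • h1)) = MvPolynomial.eval (h + ε k • h0) p := by
    intro k
    rw [← hp _ (hε k), ← afPol_translate (h + ε k • h1) (ε k • x0)]
    congr 2
    ext j
    simp [hh1]
    ring
  have t1 : Filter.Tendsto (fun k => MvPolynomial.eval (h + ε k • h0) p) Filter.atTop
      (nhds (MvPolynomial.eval h p)) := by
    have hc : Continuous (fun t : ℝ => MvPolynomial.eval (h + t • h0) p) :=
      (MvPolynomial.continuous_eval p).comp (by fun_prop)
    have := (hc.tendsto 0).comp hlim
    simp only [zero_smul, add_zero] at this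
    exact this
  have hI : afPol ℓ h = ⋂ k, afPol ℓ (h + ε k • h1) := by
    ext x
    simp only [Set.mem_iInter]
    constructor
    · intro hx k j
      have := hx j
      have := mul_nonneg (hε k).le (h1nn j)
      simp only [Pi.add_apply, Pi.smul_apply, smul_eq_mul]
      linarith
    · intro hx j
      have hc : Continuous (fun t : ℝ => h j + t * h1 j) := by fun_prop
      have := (hc.tendsto 0).comp hlim
      simp only [zero_mul, add_zero] at this
      exact ge_of_tendsto' this fun k => hx k j
  have t2 : Filter.Tendsto (fun k => volume.real (afPol ℓ (h + ε k • h1))) Filter.atTop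
      (nhds (volume.real (afPol ℓ h))) := by
    have := tendsto_measure_iInter_atTop (μ := (volume : Measure (Fin n → ℝ)))
      (s := fun k => afPol ℓ (h + ε k • h1))
      (fun k => (afPol_closed _).measurableSet.nullMeasurableSet)
      (by
        intro a b hab
        refine afPol_mono fun j => ?_
        have := mul_le_mul_of_nonneg_right (hanti hab) (h1nn j)
        simp only [Pi.add_apply, Pi.smul_apply, smul_eq_mul]
        linarith)
      ⟨0, (afPol_compact hB _).measure_lt_top.ne⟩
    rw [← hI] at this
    exact (ENNReal.tendsto_toReal (afPol_compact hB _).measure_lt_top.ne).comp this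
  simp only [e] at t2
  exact tendsto_nhds_unique t2 t1
end


noncomputable def afSup {n : ℕ} (F : Finset (Fin n → ℝ)) (f : (Fin n → ℝ) →ₗ[ℝ] ℝ) : ℝ :=
  sSup (f '' (F : Set (Fin n → ℝ)))

lemma afSup_le {n : ℕ} (F : Finset (Fin n → ℝ)) (f : (Fin n → ℝ) →ₗ[ℝ] ℝ) (x : Fin n → ℝ)
    (hx : x ∈ convexHull ℝ (F : Set (Fin n → ℝ))) : f x ≤ afSup F f := by
  have h1 : convexHull ℝ (F : Set (Fin n → ℝ)) ⊆ {x | f x ≤ afSup F f} := by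
    refine convexHull_min ?_ (convex_halfSpace_le f.isLinear _)
    intro y hy
    exact le_csSup ((F.finite_toSet.image f).bddAbove) ⟨y, hy, rfl⟩
  exact h1 hx

lemma afSup_att {n : ℕ} (F : Finset (Fin n → ℝ)) (hF : F.Nonempty) (f : (Fin n → ℝ) →ₗ[ℝ] ℝ) :
    ∃ y ∈ F, f y = afSup F f := by
  have : afSup F f ∈ f '' (F : Set (Fin n → ℝ)) :=
    Set.Nonempty.csSup_mem (Set.Nonempty.image f hF) (F.finite_toSet.image f)
  obtain ⟨y, hy, h⟩ := this
  exact ⟨y, hy, h⟩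

lemma af_MWs {n : ℕ} (F : Fin n → Finset (Fin n → ℝ)) (hF : ∀ i, (F i).Nonempty)
    (c : Fin n → Fin n) (S : Finset (Fin n)) :
    ∃ T : Finset ((Fin n → ℝ) →ₗ[ℝ] ℝ), ∀ x, (∀ f ∈ T, f x ≤ ∑ k ∈ S, afSup (F (c k)) f) →
      x ∈ ∑ k ∈ S, convexHull ℝ (F (c k) : Set (Fin n → ℝ)) := by
  classical
  choose! y hy hye using fun (k : Fin n) f => afSup_att (F k) (hF k) f
  have hmem : ∀ f, ∑ k ∈ S, y (c k) f ∈ ∑ k ∈ S, F (c k) := by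
    intro f
    rw [← Finset.mem_coe, Finset.coe_sum]
    exact Set.finsetSum_mem_finsetSum _ _ _ fun k _ => hy (c k) f
  obtain ⟨T, hT⟩ := af_MW (∑ k ∈ S, F (c k)) ⟨_, hmem 0⟩
  refine ⟨T, fun x hx => ?_⟩
  rw [← convexHull_sum, ← Finset.coe_sum]
  refine hT x fun f hf C hC => (hx f hf).trans ?_
  have := hC _ (hmem f)
  rw [map_sum] at this
  simpa [hye] using this

lemma af_MWall {n : ℕ} (F : Fin n → Finset (Fin n → ℝ)) (hF : ∀ i, (F i).Nonempty) :
    ∃ T : Finset ((Fin n → ℝ) →ₗ[ℝ] ℝ), afBdd (fun j : T => j.1) ∧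
      ∀ (c : Fin n → Fin n) (S : Finset (Fin n)),
      afPol (fun j : T => j.1) (∑ k ∈ S, fun j : T => afSup (F (c k)) j.1) =
        ∑ k ∈ S, convexHull ℝ (F (c k) : Set (Fin n → ℝ)) := by
  classical
  choose T hT using af_MWs F hF
  let T0 : Finset ((Fin n → ℝ) →ₗ[ℝ] ℝ) :=
    univ.image (fun i => LinearMap.proj i) ∪ univ.image (fun i => - LinearMap.proj i)
  let T1 := T0 ∪ univ.biUnion fun c : Fin n → Fin n => univ.biUnion fun S : Finset (Fin n) => T c S
  have hp : ∀ i : Fin n, (LinearMap.proj i : (Fin n → ℝ) →ₗ[ℝ] ℝ) ∈ T1 := by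
    intro i; simp [T1, T0]
  have hm : ∀ i : Fin n, (- LinearMap.proj i : (Fin n → ℝ) →ₗ[ℝ] ℝ) ∈ T1 := by
    intro i; simp [T1, T0]
  refine ⟨T1, ?_, ?_⟩
  · intro h
    refine (Metric.isBounded_Icc (fun i => - h ⟨_, hm i⟩) (fun i => h ⟨_, hp i⟩)).subset ?_
    intro x hx
    refine ⟨fun i => ?_, fun i => ?_⟩
    · have := hx ⟨_, hm i⟩
      simp at this
      simp; linarith
    · have := hx ⟨_, hp i⟩
      simpa using this
  · intro c S
    ext x
    constructor
    · intro hx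
      refine hT c S x fun f hf => ?_
      have hfT : f ∈ T1 := by
        simp only [T1, mem_union, mem_biUnion, mem_univ, true_and]
        exact Or.inr ⟨c, S, hf⟩
      have := hx ⟨f, hfT⟩
      simpa using this
    · intro hx j
      obtain ⟨g, hg, rfl⟩ := (Set.mem_finsetSum _ _ _).1 hx
      simp only [map_sum, Finset.sum_apply]
      exact Finset.sum_le_sum fun k hk => afSup_le _ _ _ (hg hk)

theorem af_polytope {n : ℕ} (hn : n ≠ 0) (F : Fin n → Finset (Fin n → ℝ))
    (hF : ∀ i, (F i).Nonempty) :
    ∃ (V : Type) (_ : NormedAddCommGroup V) (_ : NormedSpace ℝ V) (G : (Fin n → V) → ℝ) (C : Set V)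
      (h : Fin n → V) (h0 : V), Continuous G ∧
      (∀ (σ : Equiv.Perm (Fin n)) f, G (f ∘ σ) = G f) ∧
      (∀ f, (∀ i, f i ∈ C) → 0 < G f) ∧
      (∀ f, (∀ i, f i ∈ C) → ∀ i j, i ≠ j →
        G (Function.update f i (f j)) * G (Function.update f j (f i)) ≤ G f ^ 2) ∧
      (∀ i, ∀ ε : ℝ, 0 < ε → h i + ε • h0 ∈ C) ∧
      (∀ c : Fin n → Fin n, G (fun k => h (c k)) =
        MV n (fun k => convexHull ℝ (F (c k) : Set (Fin n → ℝ)))) := by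
  classical
  obtain ⟨T, hB, hT⟩ := af_MWall F hF
  set ℓ : T → (Fin n → ℝ) →ₗ[ℝ] ℝ := fun j => j.1 with hℓ
  let h : Fin n → T → ℝ := fun i j => afSup (F i) j.1
  have hT' : ∀ (c : Fin n → Fin n) (S : Finset (Fin n)), afPol ℓ (∑ k ∈ S, h (c k)) =
        ∑ k ∈ S, convexHull ℝ (F (c k) : Set (Fin n → ℝ)) := hT
  let H := ∑ k, h k
  obtain ⟨h0, hlt, hreg, hsub⟩ := af_exists_reg hB H
  have hH : afPol ℓ H = ∑ k, convexHull ℝ (F k : Set (Fin n → ℝ)) := hT' id univ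
  have hHne : (afPol ℓ H).Nonempty := by
    rw [hH]
    choose y hy using hF
    exact ⟨∑ k, y k, Set.finsetSum_mem_finsetSum _ _ _ fun k _ => subset_convexHull _ _ (hy k)⟩
  have h0ne : (afPol ℓ h0).Nonempty := hHne.mono (afPol_mono fun j => (hlt j).le)
  have hsubi : ∀ i, afSubo ℓ (h i) h0 := by
    intro i x hx
    obtain ⟨y, hy, hya⟩ := hsub x hx
    rw [hH] at hy
    obtain ⟨g, hg, rfl⟩ := (Set.mem_finsetSum _ _ _).1 hy
    have hle : ∀ k j, ℓ j (g k) ≤ h k j := fun k j => afSup_le _ _ _ (hg (mem_univ k))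
    refine ⟨g i, fun j => hle i j, fun j hj => ?_⟩
    have h1 : ℓ j (∑ k, g k) = (∑ k, h k) j := hya hj
    rw [map_sum, Finset.sum_apply] at h1
    exact (Finset.sum_eq_sum_iff_of_le fun k _ => hle k j).1 h1 i (mem_univ i)
  have hsubS : ∀ (c : Fin n → Fin n) (S : Finset (Fin n)), afSubo ℓ (∑ k ∈ S, h (c k)) h0 := by
    intro c S
    induction S using Finset.induction_on with
    | empty => simpa using afSubo_smul 0 le_rfl (afSubo_self (ℓ := ℓ) h0)
    | insert a s ha ih => rw [Finset.sum_insert ha]; exact afSubo_add (hsubi _) ih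
  have h0C : h0 ∈ afCone ℓ h0 := by
    have := afCone_mem 1 one_pos (hsubS id ∅)
    simpa using this
  have hC : afCn ℓ (afCone ℓ h0) :=
    ⟨afCone_open hreg, ⟨h0, h0C⟩, fun _ h1 _ h2 => afCone_add h1 h2,
      fun t ht _ h1 => afCone_smul t ht h1, afCone_reg hB hreg h0ne⟩
  obtain ⟨p, hp⟩ := afOK_main n T ℓ _ hB hC
  have hne := af_dich hB hC.pre hC.reg ⟨h0, h0C, h0ne⟩
  refine ⟨T → ℝ, inferInstance, inferInstance, afG p, afCone ℓ h0, h, h0, afG_cont p,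
    afG_sym hp.hom, afG_pos hp hne, afG_AF hp, fun i ε hε => afCone_mem ε hε (hsubi i), ?_⟩
  intro c
  refine afG_MV hn hp.hom _ _ fun S => ?_
  rw [← hT' c S]
  exact af_vol_lim hB _ h0 h0ne fun ε hε => hp.vol _ (afCone_mem ε hε (hsubS c S))


lemma af_combine_map {n p : ℕ} (hpn : p ≤ n) {α β : Type*} (φ : α → β) (K : Fin p → α)
    (L : Fin (n - p) → α) :
    (fun k => φ (combine hpn K L k)) = combine hpn (fun i => φ (K i)) (fun i => φ (L i)) := by
  funext k
  unfold combine
  split_ifs <;> rfl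

lemma af_fam_map {n p : ℕ} (hp1 : 1 ≤ p) (hpn : p ≤ n) {α β : Type*} (φ : α → β)
    (A : Fin (p - 1) → α) (H : α) (L : Fin (n - p) → α) :
    (fun k => φ (fam hp1 hpn A H L k)) = fam hp1 hpn (fun i => φ (A i)) (φ H) (fun i => φ (L i)) := by
  funext k
  unfold fam
  split_ifs <;> rfl

lemma af_ineq_poly {n p : ℕ} (hp1 : 1 ≤ p) (hpn : p ≤ n)
    (FK : Fin p → Finset (Fin n → ℝ)) (FL : Fin (n - p) → Finset (Fin n → ℝ))
    (hFK : ∀ i, (FK i).Nonempty) (hFL : ∀ i, (FL i).Nonempty) :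
    ∏ s : Fin p, ∏ i ∈ Finset.univ.erase s,
      MV n (fam hp1 hpn (fun _ => convexHull ℝ (FK i : Set (Fin n → ℝ)))
        (convexHull ℝ (FK s : Set (Fin n → ℝ))) (fun j => convexHull ℝ (FL j : Set (Fin n → ℝ)))) ≤
    MV n (combine hpn (fun i => convexHull ℝ (FK i : Set (Fin n → ℝ)))
      (fun j => convexHull ℝ (FL j : Set (Fin n → ℝ)))) ^ (p * (p - 1)) := by
  let a : Fin p → Fin n := fun i => ⟨i, by omega⟩
  let b : Fin (n - p) → Fin n := fun j => ⟨p + j, by omega⟩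
  let F := combine hpn FK FL
  have hFa : ∀ i, F (a i) = FK i := by intro i; simp [F, a, combine]
  have hFb : ∀ i, F (b i) = FL i := by intro i; simp [F, b, combine]
  have hF : ∀ k, (F k).Nonempty := by
    intro k
    simp only [F, combine]
    split_ifs
    · exact hFK _
    · exact hFL _
  obtain ⟨V, _, _, G, C, h, h0, hG, hsym, hpos, hAF, hmem, hMV⟩ := af_polytope (by omega) F hF
  have key : ∀ c : Fin n → Fin n, Filter.Tendsto (fun ε : ℝ => G (fun k => h (c k) + ε • h0))
      (nhdsWithin 0 (Set.Ioi 0)) (nhds (MV n (fun k => convexHull ℝ (F (c k) : Set (Fin n → ℝ))))) := by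
    intro c
    rw [← hMV c]
    have : Continuous (fun ε : ℝ => G (fun k => h (c k) + ε • h0)) := hG.comp (by fun_prop)
    have h2 := this.tendsto 0
    simp only [zero_smul, add_zero] at h2
    exact h2.mono_left nhdsWithin_le_nhds
  have hfam : ∀ s i, MV n (fam hp1 hpn (fun _ => convexHull ℝ (FK i : Set (Fin n → ℝ)))
        (convexHull ℝ (FK s : Set (Fin n → ℝ))) (fun j => convexHull ℝ (FL j : Set (Fin n → ℝ)))) =
      MV n (fun k => convexHull ℝ (F (fam hp1 hpn (fun _ => a i) (a s) b k) : Set (Fin n → ℝ))) := by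
    intro s i
    rw [af_fam_map hp1 hpn (fun k => convexHull ℝ (F k : Set (Fin n → ℝ)))]
    simp only [hFa, hFb]
  have hcomb : MV n (combine hpn (fun i => convexHull ℝ (FK i : Set (Fin n → ℝ)))
      (fun j => convexHull ℝ (FL j : Set (Fin n → ℝ)))) =
      MV n (fun k => convexHull ℝ (F (combine hpn a b k) : Set (Fin n → ℝ))) := by
    rw [af_combine_map hpn (fun k => convexHull ℝ (F k : Set (Fin n → ℝ)))]
    simp only [hFa, hFb]
  rw [hcomb]
  simp only [hfam]
  refine le_of_tendsto_of_tendsto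
    (tendsto_finsetProd _ fun s _ => tendsto_finsetProd _ fun i _ => key _) ((key _).pow _) ?_
  filter_upwards [self_mem_nhdsWithin] with ε hε
  have := af_final hp1 hpn G C hsym hpos hAF (fun i => h (a i) + ε • h0) (fun i => h (b i) + ε • h0)
    (fun i => hmem _ ε hε) (fun i => hmem _ ε hε)
  simp only [af_fam_map hp1 hpn (fun k => h k + ε • h0), af_combine_map hpn (fun k => h k + ε • h0)]
  exact this

lemma af_compact_sum {n : ℕ} {κ : Type*} (S : Finset κ) (K : κ → Set (Fin n → ℝ))
    (hK : ∀ i, IsCompact (K i)) : IsCompact (∑ i ∈ S, K i) := by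
  classical
  induction S using Finset.induction_on with
  | empty => rw [Finset.sum_empty]; exact isCompact_singleton
  | insert a s ha ih => rw [Finset.sum_insert ha]; exact (hK a).add ih

lemma af_vol_tendsto {n : ℕ} (S : Finset (Fin n)) (K : Fin n → Set (Fin n → ℝ))
    (hK : ∀ i, IsCompact (K i)) (δ : ℕ → ℝ) (hδ : ∀ m, 0 < δ m)
    (hlim : Filter.Tendsto δ Filter.atTop (nhds 0)) (Q : ℕ → Fin n → Set (Fin n → ℝ))
    (h1 : ∀ m i, K i ⊆ Q m i) (h2 : ∀ m i, Q m i ⊆ Metric.cthickening (δ m) (K i)) :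
    Filter.Tendsto (fun m => vol (∑ i ∈ S, Q m i)) Filter.atTop (nhds (vol (∑ i ∈ S, K i))) := by
  have hc := af_compact_sum S K hK
  have h3 : ∀ m, ∑ i ∈ S, Q m i ⊆ Metric.cthickening (S.card * δ m) (∑ i ∈ S, K i) := by
    intro m x hx
    obtain ⟨g, hg, rfl⟩ := (Set.mem_finsetSum _ _ _).1 hx
    have : ∀ i, ∃ y, i ∈ S → y ∈ K i ∧ dist (g i) y ≤ δ m := by
      intro i
      by_cases hi : i ∈ S
      · have := h2 m i (hg hi)
        rw [(hK i).cthickening_eq_biUnion_closedBall (hδ m).le] at this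
        simp only [Set.mem_iUnion, Metric.mem_closedBall, exists_prop] at this
        obtain ⟨y, hy, hd⟩ := this
        exact ⟨y, fun _ => ⟨hy, hd⟩⟩
      · exact ⟨0, fun h => absurd h hi⟩
    choose y hy using this
    refine Metric.mem_cthickening_of_dist_le _ (∑ i ∈ S, y i) _ _
      (Set.finsetSum_mem_finsetSum _ _ _ fun i hi => (hy i hi).1) ?_
    refine (dist_sum_sum_le S g y).trans ?_
    rw [← nsmul_eq_mul]
    exact Finset.sum_le_card_nsmul _ _ _ fun i hi => (hy i hi).2
  have h4 : Filter.Tendsto (fun m => vol (Metric.cthickening (S.card * δ m) (∑ i ∈ S, K i)))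
      Filter.atTop (nhds (vol (∑ i ∈ S, K i))) := by
    have h5 := tendsto_measure_cthickening_of_isCompact (μ := volume) hc
    have h6 : Filter.Tendsto (fun m => (S.card : ℝ) * δ m) Filter.atTop (nhds 0) := by
      simpa using hlim.const_mul (S.card : ℝ)
    exact (ENNReal.tendsto_toReal hc.measure_lt_top.ne).comp (h5.comp h6)
  have hfin : ∀ m, volume (Metric.cthickening (S.card * δ m) (∑ i ∈ S, K i)) ≠ ⊤ := fun m =>
    hc.cthickening.measure_lt_top.ne
  refine tendsto_of_tendsto_of_tendsto_of_le_of_le tendsto_const_nhds h4 (fun m => ?_) (fun m => ?_)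
  · refine ENNReal.toReal_mono ?_ (measure_mono (Set.finsetSum_subset_finsetSum _ _ _ fun i _ => h1 m i))
    exact ne_top_of_le_ne_top (hfin m) (measure_mono (h3 m))
  · exact ENNReal.toReal_mono (hfin m) (measure_mono (h3 m))

lemma af_MV_tendsto {n : ℕ} (K : Fin n → Set (Fin n → ℝ))
    (hK : ∀ i, IsCompact (K i)) (δ : ℕ → ℝ) (hδ : ∀ m, 0 < δ m)
    (hlim : Filter.Tendsto δ Filter.atTop (nhds 0)) (Q : ℕ → Fin n → Set (Fin n → ℝ))
    (h1 : ∀ m i, K i ⊆ Q m i) (h2 : ∀ m i, Q m i ⊆ Metric.cthickening (δ m) (K i)) :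
    Filter.Tendsto (fun m => MV n (Q m)) Filter.atTop (nhds (MV n K)) := by
  unfold MV
  exact tendsto_finsetSum _ fun j _ => (tendsto_finsetSum _ fun S _ =>
    af_vol_tendsto S K hK δ hδ hlim Q h1 h2).const_mul _

lemma af_approx {n : ℕ} (K : Set (Fin n → ℝ)) (hne : K.Nonempty) (hc : IsCompact K)
    (hcv : Convex ℝ K) (δ : ℝ) (hδ : 0 < δ) :
    ∃ F : Finset (Fin n → ℝ), F.Nonempty ∧ K ⊆ convexHull ℝ (F : Set (Fin n → ℝ)) ∧
      convexHull ℝ (F : Set (Fin n → ℝ)) ⊆ Metric.cthickening δ K := by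
  obtain ⟨F, h1, h2⟩ := Convex.exists_subset_interior_convexHull_finset_of_isCompact
    hcv hc (Metric.cthickening_mem_nhdsSet K hδ)
  have h3 := h1.trans interior_subset
  refine ⟨F, ?_, h3, h2⟩
  have := hne.mono h3
  rwa [convexHull_nonempty_iff] at this

/-- Intermediate inequality (7.3) in the proof of Theorem 7.3:
`MV(K₁, …, K_p, L₁, …, L_{n−p})^{p(p−1)} ≥
  Π_{s=1}^{p} Π_{i ≠ s} MV(K_i^{(p−1)}, K_s, L₁, …, L_{n−p})`. -/
theorem intermediate_inequality_three {n p : ℕ} (hp2 : 2 ≤ p) (hpn : p ≤ n)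
    (K : Fin p → Set (Fin n → ℝ)) (L : Fin (n - p) → Set (Fin n → ℝ))
    (hKne : ∀ i, (K i).Nonempty) (hKc : ∀ i, IsCompact (K i)) (hKcv : ∀ i, Convex ℝ (K i))
    (hLne : ∀ i, (L i).Nonempty) (hLc : ∀ i, IsCompact (L i)) (hLcv : ∀ i, Convex ℝ (L i)) :
    MV n (combine hpn K L) ^ (p * (p - 1)) ≥
      ∏ s : Fin p, ∏ i ∈ Finset.univ.erase s,
        MV n (fam (by omega) hpn (fun _ => K i) (K s) L) := by
  let δ : ℕ → ℝ := fun m => 1 / ((m : ℝ) + 1)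
  have hδ : ∀ m, 0 < δ m := fun m => by positivity
  have hlim : Filter.Tendsto δ Filter.atTop (nhds 0) := tendsto_one_div_add_atTop_nhds_zero_nat
  choose FK hFK1 hFK2 hFK3 using fun m i => af_approx (K i) (hKne i) (hKc i) (hKcv i) (δ m) (hδ m)
  choose FL hFL1 hFL2 hFL3 using fun m i => af_approx (L i) (hLne i) (hLc i) (hLcv i) (δ m) (hδ m)
  have hineq := fun m => af_ineq_poly (by omega : 1 ≤ p) hpn (FK m) (FL m) (hFK1 m) (hFL1 m)
  refine le_of_tendsto_of_tendsto' (b := Filter.atTop)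
    (tendsto_finsetProd _ fun s _ => tendsto_finsetProd _ fun i _ => ?_) (Filter.Tendsto.pow ?_ _) hineq
  · refine af_MV_tendsto _ ?_ δ hδ hlim _ ?_ ?_
    · intro k; unfold fam; split_ifs
      exacts [hKc _, hKc _, hLc _]
    · intro m k; unfold fam; split_ifs
      exacts [hFK2 _ _, hFK2 _ _, hFL2 _ _]
    · intro m k; unfold fam; split_ifs
      exacts [hFK3 _ _, hFK3 _ _, hFL3 _ _]
  · refine af_MV_tendsto _ ?_ δ hδ hlim _ ?_ ?_
    · intro k; unfold combine; split_ifs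
      exacts [hKc _, hLc _]
    · intro m k; unfold combine; split_ifs
      exacts [hFK2 _ _, hFL2 _ _]
    · intro m k; unfold combine; split_ifs
      exacts [hFK3 _ _, hFL3 _ _]
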